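/- Let p ∈ {2,3,5,7}, q = p−1, r = 48/(q(p+1)), m = 24/(p+1). The lattice N = √p (A_q^r, G) has genus II_{2m,0}(p^{ε_p(m+2)}) where ε_p = + for p = 2,5,7 and ε_p = − for p = 3 (with even 2-adic Jordan components in the case p = 2). The minimal norm of N is 4 for p = 2, 3, 5 and 6 for p = 7; this is the largest possible minimal norm of a lattice in this genus, and N is the unique lattice in this genus, up to isomorphism, attaining it. -/

import Mathlib

/-!
STATEMENT 7.
Let p ∈ {2,3,5,7}, q = p−1, r = 48/(q(p+1)), m = 24/(p+1).  The lattice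
N = √p (A_q^r, G) has genus II_{2m,0}(p^{ε_p(m+2)}) where ε_p = + for p = 2,5,7 and
ε_p = − for p = 3 (with even 2-adic Jordan components for p = 2).  The minimal norm
of N is 4 for p = 2,3,5 and 6 for p = 7; this is the largest possible minimal norm
of a lattice in this genus, and N is the unique lattice in this genus, up to
isomorphism, attaining it.

Formalization notes.  N is modeled as in the statement-6 file.  Membership in the
genus II_{2m,0}(p^{ε_p(m+2)}) is encoded by the complete list of its defining
invariants: even, positive definite, rank 2m, determinant p^{m+2} and level p
(i.e. p·(Gram matrix)⁻¹ integral with even diagonal).  For these ranks and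
determinants the sign ε_p (and, for p = 2, the evenness of the 2-adic Jordan
components) is uniquely determined by these invariants via the Milgram formula, so
this list of conditions characterizes the genus II_{2m,0}(p^{ε_p(m+2)}) exactly.
Lattices in the genus are represented by their Gram matrices B; isomorphism with N
is expressed by exhibiting a ℤ-basis of N with Gram matrix B.
-/

open scoped BigOperators Classical
open Matrix

/-- `t ∈ ℤ ⊆ ℚ`. -/
def isInt (t : ℚ) : Prop := ∃ z : ℤ, (z : ℚ) = t

/-- Membership in the dual `A_q' = A_{p-1}'` of the root lattice `A_{p-1}`, in the
standard model: `A_{p-1}' = {x ∈ ℚ^p | ∑ x_k = 0, x_k − x_l ∈ ℤ, p·x_k ∈ ℤ}`. -/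
def MemAqDual (p : ℕ) (x : Fin p → ℚ) : Prop :=
  (∑ k, x k) = 0 ∧ (∀ k l, isInt (x k - x l)) ∧ (∀ k, isInt ((p : ℚ) * x k))

/-- The class of `x ∈ A_{p-1}'` in the discriminant group `A_{p-1}'/A_{p-1} ≅ ℤ/pℤ`
(the class of the fundamental weight `Λ̄_i` being `i`); it is computed as
`−p·x_0 mod p`.  (Junk value if `x ∉ A_{p-1}'`.) -/
noncomputable def clsOf (p : ℕ) [NeZero p] (x : Fin p → ℚ) : ZMod p :=
  (((-((p : ℚ) * x 0)).num : ℤ) : ZMod p)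

/-- The glue code `G ⊆ 𝔽_p^r` from the appendix: the (extended) binary Hamming code of
length 16 for `p = 2` (cut out by the overall parity check and the four parity checks
given by the binary digits of the coordinate positions), the ternary zero-sum code of
length 6 for `p = 3`, and all of `𝔽_5^2` resp. `𝔽_7` for `p = 5, 7`. -/
noncomputable def glueCode (p r : ℕ) [NeZero p] : Finset (Fin r → ZMod p) :=
  Finset.univ.filter (fun x =>
    if p = 2 then
      ((∑ i, x i = 0) ∧ ∀ j : Fin 4, (∑ i, if Nat.testBit i.1 j.1 then x i else 0) = 0)
    else if p = 3 then (∑ i, x i = 0) else True)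

/-- Vectors of the ambient rational space `(ℚ^p)^r` containing `A_{p-1}^r` and its
glue lattices. -/
abbrev GVec (p r : ℕ) := Fin r → Fin p → ℚ

/-- Membership in the glue lattice `(A_q^r, G)`: each component lies in `A_q'` and the
vector of classes lies in the glue code `G`.  The lattice `N = √p (A_q^r, G)` is this
set of vectors equipped with the rescaled quadratic form `x ↦ p·|x|²/2`. -/
def MemGlue (p r : ℕ) [NeZero p] (x : GVec p r) : Prop :=
  (∀ i, MemAqDual p (x i)) ∧ (fun i => clsOf p (x i)) ∈ glueCode p r

/-- The bilinear form of `N = √p (A_q^r, G)`: `p` times the standard scalar product. -/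
def blN (p r : ℕ) (x y : GVec p r) : ℚ := (p : ℚ) * ∑ i, ∑ k, x i k * y i k

/-- The norm `x² = p·|x|²` of `N = √p (A_q^r, G)`. -/
def nrmN (p r : ℕ) (x : GVec p r) : ℚ := (p : ℚ) * ∑ i, ∑ k, (x i k) ^ 2

/-- Membership in the dual lattice `N'` of `N`. -/
def MemNdual (p r : ℕ) [NeZero p] (y : GVec p r) : Prop :=
  (∀ i, (∑ k, y i k) = 0 ∧ ∀ k l, isInt (y i k - y i l)) ∧
    ∀ x, MemGlue p r x → isInt (blN p r y x)

/-- A product of summable nonnegative functions is summable over the finite power. -/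
theorem summable_prod_int {f : ℤ → ℝ} (hf : Summable f) (h0 : ∀ z, 0 ≤ f z) (n : ℕ) :
    Summable fun v : Fin n → ℤ => ∏ i, f (v i) := by
  induction n with
  | zero => exact Summable.of_finite
  | succ n ih =>
    have h := hf.mul_of_nonneg ih h0 (fun v => Finset.prod_nonneg fun i _ => h0 _)
    rw [← (Fin.consEquiv (fun _ : Fin (n + 1) => ℤ)).summable_iff]
    refine h.congr fun x => ?_
    simp [Fin.consEquiv, Fin.prod_univ_succ]

theorem summable_gauss_int {δ : ℝ} (hδ : 0 < δ) (c : ℝ) :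
    Summable fun z : ℤ => Real.exp (-δ * (z : ℝ) ^ 2 + c * |(z : ℝ)|) := by
  have := summable_pow_mul_jacobiTheta₂_term_bound (c / (2 * Real.pi))
      (T := δ / Real.pi) (by positivity) 0
  refine this.congr fun z => ?_
  have := Real.pi_ne_zero
  simp only [pow_zero, one_mul, Int.cast_abs]
  congr 1
  field_simp
  ring

theorem summable_gauss_vec {δ : ℝ} (hδ : 0 < δ) (c : ℝ) (n : ℕ) :
    Summable fun v : Fin n → ℤ =>
      Real.exp (-δ * ∑ i, (v i : ℝ) ^ 2 + c * ∑ i, |(v i : ℝ)|) := by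
  refine (summable_prod_int (summable_gauss_int hδ c) (fun _ => (Real.exp_pos _).le) n).congr
    fun v => ?_
  rw [← Real.exp_sum, Finset.sum_add_distrib, Finset.mul_sum, Finset.mul_sum]

theorem Matrix.PosDef.exists_lower_bound {n : ℕ} {A : Matrix (Fin n) (Fin n) ℝ}
    (hA : A.PosDef) : ∃ ε > 0, ∀ x : Fin n → ℝ, ε * ∑ i, x i ^ 2 ≤ x ⬝ᵥ A *ᵥ x := by
  set S : Set (EuclideanSpace ℝ (Fin n)) := Metric.sphere 0 1 with hS
  have hc : IsCompact S := isCompact_sphere _ _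
  have hcont : Continuous fun x : EuclideanSpace ℝ (Fin n) => (x.ofLp) ⬝ᵥ A *ᵥ (x.ofLp) := by
    simp only [dotProduct, mulVec]
    fun_prop
  have hn2 : ∀ x : EuclideanSpace ℝ (Fin n), ‖x‖ ^ 2 = ∑ i, x i ^ 2 := by
    intro x
    rw [EuclideanSpace.norm_sq_eq]; simp
  have main : ∃ ε > 0, ∀ x ∈ S, ε ≤ (x.ofLp) ⬝ᵥ A *ᵥ (x.ofLp) := by
    rcases S.eq_empty_or_nonempty with h | h
    · exact ⟨1, one_pos, by simp [h]⟩
    · obtain ⟨y, hy, hmin⟩ := hc.exists_isMinOn h hcont.continuousOn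
      refine ⟨_, ?_, fun x hx => hmin hx⟩
      have hy0 : y.ofLp ≠ 0 := by
        intro h0
        have : y = 0 := by ext i; simp [h0]
        simp [hS, this] at hy
      simpa using hA.dotProduct_mulVec_pos hy0
  obtain ⟨ε, hε, h⟩ := main
  refine ⟨ε, hε, fun x => ?_⟩
  by_cases hx : x = 0
  · simp [hx]
  set y : EuclideanSpace ℝ (Fin n) := WithLp.toLp 2 x with hy
  have hy0 : y ≠ 0 := by
    intro h0
    apply hx
    have : y.ofLp = 0 := by rw [h0]; rfl
    simpa [hy] using this
  have hny : 0 < ‖y‖ := norm_pos_iff.mpr hy0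
  have h1 := h (‖y‖⁻¹ • y) (by simp [hS, norm_smul, hny.ne'])
  have h2 : ((‖y‖⁻¹ • y).ofLp) ⬝ᵥ A *ᵥ ((‖y‖⁻¹ • y).ofLp) = (‖y‖ ^ 2)⁻¹ * (x ⬝ᵥ A *ᵥ x) := by
    have : (‖y‖⁻¹ • y).ofLp = ‖y‖⁻¹ • x := rfl
    rw [this, mulVec_smul, smul_dotProduct, dotProduct_smul]
    simp only [smul_eq_mul]
    field_simp
  rw [h2] at h1
  have h3 : ∑ i, x i ^ 2 = ‖y‖ ^ 2 := by rw [hn2]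
  rw [h3]
  have := mul_le_mul_of_nonneg_right h1 (sq_nonneg ‖y‖)
  calc _ ≤ _ := this
    _ = _ := by field_simp

/-- The complex quadratic form attached to a real matrix. -/
noncomputable def qf {n : ℕ} (A : Matrix (Fin n) (Fin n) ℝ) (x : Fin n → ℂ) : ℂ :=
  ∑ i, ∑ j, (A i j : ℂ) * x i * x j

theorem qf_ofReal {n : ℕ} (A : Matrix (Fin n) (Fin n) ℝ) (x : Fin n → ℝ) :
    qf A (fun i => (x i : ℂ)) = ((x ⬝ᵥ A *ᵥ x : ℝ) : ℂ) := by
  simp only [qf, dotProduct, mulVec, Finset.mul_sum]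
  push_cast
  exact Finset.sum_congr rfl fun i _ => Finset.sum_congr rfl fun j _ => by ring

theorem summable_gauss {n : ℕ} {A : Matrix (Fin n) (Fin n) ℝ} (hA : A.PosDef) {t : ℂ}
    (ht : 0 < t.re) (b : Fin n → ℂ) : Summable fun v : Fin n → ℤ =>
      Complex.exp (-Real.pi * t * qf A (fun i => (v i : ℂ)) + 2 * Real.pi * ∑ i, b i * v i) := by
  obtain ⟨ε, hε, h⟩ := hA.exists_lower_bound
  have hb : ∃ c, ∀ i, ‖b i‖ ≤ c := by
    obtain ⟨c, hc⟩ := (Set.finite_range fun i => ‖b i‖).bddAbove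
    exact ⟨c, fun i => hc ⟨i, rfl⟩⟩
  obtain ⟨c, hc⟩ := hb
  refine Summable.of_norm_bounded
    (summable_gauss_vec (δ := Real.pi * t.re * ε) (by positivity) (2 * Real.pi * c) n) fun v => ?_
  rw [Complex.norm_exp, Real.exp_le_exp]
  have e : qf A (fun i => (v i : ℂ)) =
      (((fun i => (v i : ℝ)) ⬝ᵥ A *ᵥ (fun i => (v i : ℝ)) : ℝ) : ℂ) := by
    rw [← qf_ofReal]; simp
  have h1 := h (fun i => (v i : ℝ))
  rw [e]
  have r1 : (-(Real.pi : ℂ) * t * (((fun i => (v i : ℝ)) ⬝ᵥ A *ᵥ (fun i => (v i : ℝ)) : ℝ) : ℂ)).re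
      = -(Real.pi * t.re * ((fun i => (v i : ℝ)) ⬝ᵥ A *ᵥ (fun i => (v i : ℝ)))) := by
    rw [Complex.re_mul_ofReal]; simp
  have r2 : ((2 : ℂ) * Real.pi * ∑ i, b i * v i).re ≤ 2 * Real.pi * c * ∑ i, |(v i : ℝ)| := by
    calc _ ≤ ‖(2 : ℂ) * Real.pi * ∑ i, b i * v i‖ := Complex.re_le_norm _
      _ = 2 * Real.pi * ‖∑ i, b i * v i‖ := by
        simp [abs_of_pos Real.pi_pos]
      _ ≤ 2 * Real.pi * ∑ i, c * |(v i : ℝ)| := by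
        gcongr
        refine (norm_sum_le _ _).trans (Finset.sum_le_sum fun i _ => ?_)
        rw [norm_mul, Complex.norm_intCast]
        gcongr
        exact hc i
      _ = _ := by rw [← Finset.mul_sum]; ring
  rw [Complex.add_re, r1]
  have : Real.pi * t.re * (ε * ∑ i, (v i : ℝ) ^ 2) ≤
    Real.pi * t.re * ((fun i => (v i : ℝ)) ⬝ᵥ A *ᵥ (fun i => (v i : ℝ))) := by gcongr
  linarith

/-- The Schur complement of the top left entry. -/
noncomputable def schur {n : ℕ} (A : Matrix (Fin (n + 1)) (Fin (n + 1)) ℝ) :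
    Matrix (Fin n) (Fin n) ℝ :=
  Matrix.of fun i j => A i.succ j.succ - A 0 i.succ * A 0 j.succ / A 0 0

theorem qf_eq_schur {n : ℕ} {A : Matrix (Fin (n + 1)) (Fin (n + 1)) ℝ} (hs : A.IsSymm)
    (h0 : A 0 0 ≠ 0) (x : Fin (n + 1) → ℂ) :
    qf A x = A 0 0 * (x 0 + (∑ j : Fin n, (A 0 j.succ : ℂ) * x j.succ) / A 0 0) ^ 2
      + qf (schur A) (fun j => x j.succ) := by
  have h0' : (A 0 0 : ℂ) ≠ 0 := by exact_mod_cast h0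
  have e1 : qf (schur A) (fun j => x j.succ) =
      (∑ i : Fin n, ∑ j : Fin n, (A i.succ j.succ : ℂ) * x i.succ * x j.succ)
      - (∑ j : Fin n, (A 0 j.succ : ℂ) * x j.succ) ^ 2 / A 0 0 := by
    rw [pow_two, Finset.sum_mul_sum, Finset.sum_div, ← Finset.sum_sub_distrib]
    refine Finset.sum_congr rfl fun i _ => ?_
    rw [Finset.sum_div, ← Finset.sum_sub_distrib]
    refine Finset.sum_congr rfl fun j _ => ?_
    simp only [schur, Matrix.of_apply]
    push_cast
    ring
  have e2 : qf A x = A 0 0 * x 0 ^ 2 + 2 * x 0 * (∑ j : Fin n, (A 0 j.succ : ℂ) * x j.succ)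
      + ∑ i : Fin n, ∑ j : Fin n, (A i.succ j.succ : ℂ) * x i.succ * x j.succ := by
    simp only [qf, Fin.sum_univ_succ, Finset.sum_add_distrib]
    have : ∑ i : Fin n, (A i.succ 0 : ℂ) * x i.succ * x 0 =
      x 0 * ∑ j : Fin n, (A 0 j.succ : ℂ) * x j.succ := by
      rw [Finset.mul_sum]
      refine Finset.sum_congr rfl fun i _ => ?_
      rw [hs.apply 0 i.succ]; ring
    have h2 : ∑ i : Fin n, (A 0 i.succ : ℂ) * x 0 * x i.succ =
      x 0 * ∑ j : Fin n, (A 0 j.succ : ℂ) * x j.succ := by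
      rw [Finset.mul_sum]
      refine Finset.sum_congr rfl fun i _ => ?_
      ring
    rw [this, h2]; ring
  rw [e1, e2]
  field_simp
  ring

theorem isSymm_of_posDef {n : ℕ} {A : Matrix (Fin n) (Fin n) ℝ} (hA : A.PosDef) : A.IsSymm := by
  have := hA.1
  rwa [Matrix.IsHermitian, Matrix.conjTranspose_eq_transpose_of_trivial] at this

theorem schur_posDef {n : ℕ} {A : Matrix (Fin (n + 1)) (Fin (n + 1)) ℝ} (hA : A.PosDef) :
    (schur A).PosDef := by
  have hs := isSymm_of_posDef hA
  refine Matrix.PosDef.of_dotProduct_mulVec_pos ?_ fun x hx => ?_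
  · ext i j
    simp only [schur, conjTranspose_apply, of_apply, star_trivial]
    rw [hs.apply i.succ j.succ]; ring
  · set y : Fin (n + 1) → ℝ := Fin.cons (-(∑ j, A 0 j.succ * x j) / A 0 0) x with hy
    have hy0 : y ≠ 0 := by
      intro h
      apply hx
      funext i
      have := congrFun h i.succ
      simpa [hy] using this
    have h1 := hA.dotProduct_mulVec_pos hy0
    have h2 := qf_eq_schur hs hA.diag_pos.ne' (fun i => (y i : ℂ))
    rw [qf_ofReal, qf_ofReal] at h2
    have h3 : ((y 0 : ℂ) + (∑ j : Fin n, (A 0 j.succ : ℂ) * (y j.succ : ℂ)) / A 0 0) = 0 := by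
      simp only [hy, Fin.cons_zero, Fin.cons_succ]
      push_cast
      ring
    rw [h3] at h2
    simp only [ne_eq, OfNat.ofNat_ne_zero, not_false_eq_true, zero_pow, mul_zero, zero_add,
      Complex.ofReal_inj] at h2
    simp only [star_trivial] at h1 ⊢
    rw [h2] at h1
    simpa [hy] using h1

theorem det_eq_schur {n : ℕ} {A : Matrix (Fin (n + 1)) (Fin (n + 1)) ℝ} (hs : A.IsSymm)
    (h0 : A 0 0 ≠ 0) : A.det = A 0 0 * (schur A).det := by
  let e : Unit ⊕ Fin n ≃ Fin (n + 1) :=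
    ((finSuccEquiv n).trans ((Equiv.optionEquivSumPUnit _).trans (Equiv.sumComm _ _))).symm
  have e1 : ∀ u, e (Sum.inl u) = 0 := fun u => rfl
  have e2 : ∀ i, e (Sum.inr i) = i.succ := fun i => by
    simp [e]
  rw [← Matrix.det_submatrix_equiv_self e A]
  have : A.submatrix e e = Matrix.fromBlocks (Matrix.of fun _ _ : Unit => A 0 0)
      (Matrix.of fun _ j => A 0 j.succ) (Matrix.of fun i _ => A i.succ 0)
      (Matrix.of fun i j => A i.succ j.succ) := by
    ext (i | i) (j | j) <;> simp [e1, e2]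
  rw [this]
  have : Invertible (Matrix.of fun _ _ : Unit => A 0 0) := by
    apply Matrix.invertibleOfIsUnitDet
    simp [h0]
  rw [Matrix.det_fromBlocks₁₁]
  congr 1
  · simp
  · congr 1
    ext i j
    rw [Matrix.invOf_eq_nonsing_inv]
    simp only [schur, Matrix.sub_apply, Matrix.of_apply, Matrix.mul_apply, Finset.univ_unique,
      Finset.sum_singleton, Matrix.inv_def, Matrix.smul_apply, Matrix.adjugate_subsingleton,
      Matrix.one_apply_eq, smul_eq_mul, Matrix.det_unique, Ring.inverse_eq_inv']
    rw [hs.apply 0 i.succ]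
    field_simp

theorem qf_inv {n : ℕ} {A : Matrix (Fin n) (Fin n) ℝ} (hA : A.PosDef) {x y : Fin n → ℂ}
    (h : ∀ i, ∑ j, (A i j : ℂ) * x j = y i) : qf A⁻¹ y = ∑ i, x i * y i := by
  have hinv : A⁻¹ * A = 1 := Matrix.nonsing_inv_mul _ ((Matrix.isUnit_iff_isUnit_det _).mp hA.isUnit)
  have h1 : ∀ i, ∑ j, (A⁻¹ i j : ℂ) * y j = x i := by
    intro i
    simp_rw [← h, Finset.mul_sum]
    rw [Finset.sum_comm]
    have : ∀ k, ∑ j, (A⁻¹ i j : ℂ) * ((A j k : ℂ) * x k) = ((1 : Matrix (Fin n) (Fin n) ℝ) i k : ℂ) * x k := by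
      intro k
      rw [← hinv, Matrix.mul_apply]
      push_cast
      rw [Finset.sum_mul]
      exact Finset.sum_congr rfl fun j _ => by ring
    rw [Finset.sum_congr rfl fun k _ => this k]
    simp [Matrix.one_apply, apply_ite Complex.ofReal, ite_mul]
  simp only [qf]
  refine Finset.sum_congr rfl fun i _ => ?_
  rw [← h1 i, Finset.sum_mul]
  exact Finset.sum_congr rfl fun j _ => by ring

theorem exists_solve {n : ℕ} {A : Matrix (Fin n) (Fin n) ℝ} (hA : A.PosDef) (y : Fin n → ℂ) :
    ∃ x : Fin n → ℂ, ∀ i, ∑ j, (A i j : ℂ) * x j = y i := by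
  have hinv : A * A⁻¹ = 1 := Matrix.mul_nonsing_inv _ ((Matrix.isUnit_iff_isUnit_det _).mp hA.isUnit)
  refine ⟨fun j => ∑ k, (A⁻¹ j k : ℂ) * y k, fun i => ?_⟩
  simp only [Finset.mul_sum]
  rw [Finset.sum_comm]
  have : ∀ k, ∑ j, (A i j : ℂ) * ((A⁻¹ j k : ℂ) * y k) = ((1 : Matrix (Fin n) (Fin n) ℝ) i k : ℂ) * y k := by
    intro k
    rw [← hinv, Matrix.mul_apply]
    push_cast
    rw [Finset.sum_mul]
    exact Finset.sum_congr rfl fun j _ => by ring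
  rw [Finset.sum_congr rfl fun k _ => this k]
  simp [Matrix.one_apply, apply_ite Complex.ofReal, ite_mul]

theorem qf_inv_schur {n : ℕ} {A : Matrix (Fin (n + 1)) (Fin (n + 1)) ℝ} (hA : A.PosDef)
    (y : Fin (n + 1) → ℂ) :
    qf A⁻¹ y = y 0 ^ 2 / A 0 0
      + qf (schur A)⁻¹ (fun j => y j.succ - y 0 * A 0 j.succ / A 0 0) := by
  have hs := isSymm_of_posDef hA
  have h0' : (A 0 0 : ℂ) ≠ 0 := by exact_mod_cast hA.diag_pos.ne'
  obtain ⟨x, hx⟩ := exists_solve hA y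
  have hx0 := hx 0
  rw [Fin.sum_univ_succ] at hx0
  rw [qf_inv hA hx, qf_inv (schur_posDef hA) (x := fun j => x j.succ)]
  · rw [Fin.sum_univ_succ]
    have : ∑ i : Fin n, x i.succ * (y i.succ - y 0 * A 0 i.succ / A 0 0) =
      ∑ i : Fin n, x i.succ * y i.succ - (y 0 / A 0 0) * ∑ j : Fin n, (A 0 j.succ : ℂ) * x j.succ := by
      rw [Finset.mul_sum, ← Finset.sum_sub_distrib]
      exact Finset.sum_congr rfl fun j _ => by ring
    rw [this]
    have h2 : ∑ j : Fin n, (A 0 j.succ : ℂ) * x j.succ = y 0 - A 0 0 * x 0 := by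
      rw [← hx0]; ring
    rw [h2]
    field_simp
    ring
  · intro i
    have := hx i.succ
    rw [Fin.sum_univ_succ] at this
    rw [← this, ← hx0, hs.apply 0 i.succ]
    simp only [schur, of_apply]
    push_cast
    simp only [sub_mul, Finset.sum_sub_distrib]
    have h3 : ∑ j : Fin n, (A 0 i.succ : ℂ) * A 0 j.succ / A 0 0 * x j.succ =
      (A 0 i.succ / A 0 0) * ∑ j : Fin n, (A 0 j.succ : ℂ) * x j.succ := by
      rw [Finset.mul_sum]
      exact Finset.sum_congr rfl fun j _ => by ring
    rw [h3]
    field_simp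
    ring

theorem qf_add_I_mul {n : ℕ} {A : Matrix (Fin n) (Fin n) ℝ} (hs : A.IsSymm) (x y : Fin n → ℂ) :
    qf A (fun i => x i + y i) = qf A x + 2 * (∑ i, (∑ j, (A i j : ℂ) * y j) * x i) + qf A y := by
  simp only [qf, Finset.sum_mul, Finset.mul_sum]
  have : ∑ i, ∑ j, (A i j : ℂ) * y i * x j = ∑ i, ∑ j, (A i j : ℂ) * y j * x i := by
    rw [Finset.sum_comm]
    refine Finset.sum_congr rfl fun i _ => Finset.sum_congr rfl fun j _ => ?_
    rw [hs.apply i j]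
  have h2 : ∑ i, ∑ j, (A i j : ℂ) * (x i + y i) * (x j + y j) =
    ∑ i, ∑ j, (A i j : ℂ) * x i * x j + ∑ i, ∑ j, (A i j : ℂ) * y j * x i
    + ∑ i, ∑ j, (A i j : ℂ) * y i * x j + ∑ i, ∑ j, (A i j : ℂ) * y i * y j := by
    simp only [← Finset.sum_add_distrib]
    refine Finset.sum_congr rfl fun i _ => Finset.sum_congr rfl fun j _ => ?_
    ring
  rw [h2, this]
  simp only [← Finset.mul_sum]
  ring

theorem re_inv_pos {t : ℂ} (ht : 0 < t.re) : 0 < (1 / t).re := by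
  rw [one_div, Complex.inv_re]
  refine div_pos ht (Complex.normSq_pos.mpr ?_)
  rintro rfl
  simp at ht

theorem summable_gauss_dual {n : ℕ} {A : Matrix (Fin n) (Fin n) ℝ} (hA : A.PosDef) {t : ℂ}
    (ht : 0 < t.re) (b : Fin n → ℂ) : Summable fun w : Fin n → ℤ =>
      Complex.exp (-Real.pi / t * qf A⁻¹ (fun i => (w i : ℂ) + Complex.I * b i)) := by
  have hs := isSymm_of_posDef hA.inv
  have := (summable_gauss hA.inv (re_inv_pos ht)
    (fun i => -(1 / t) * ∑ j, (A⁻¹ i j : ℂ) * (Complex.I * b j))).mul_right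
    (Complex.exp (-Real.pi / t * qf A⁻¹ (fun i => Complex.I * b i)))
  refine this.congr fun w => ?_
  rw [qf_add_I_mul hs, ← Complex.exp_add]
  congr 1
  simp only [mul_assoc, ← Finset.mul_sum]
  ring

theorem theta_inversion {n : ℕ} {A : Matrix (Fin n) (Fin n) ℝ} (hA : A.PosDef) {t : ℂ}
    (ht : 0 < t.re) (b : Fin n → ℂ) :
    ∑' v : Fin n → ℤ,
      Complex.exp (-Real.pi * t * qf A (fun i => (v i : ℂ)) + 2 * Real.pi * ∑ i, b i * v i)
    = (1 / t ^ (1 / 2 : ℂ)) ^ n * (1 / (√A.det : ℝ) : ℂ) * ∑' w : Fin n → ℤ,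
      Complex.exp (-Real.pi / t * qf A⁻¹ (fun i => (w i : ℂ) + Complex.I * b i)) := by
  induction n with
  | zero => simp [qf]
  | succ n ih =>
    have hs := isSymm_of_posDef hA
    have hβ : 0 < A 0 0 := hA.diag_pos
    have hβ' : (A 0 0 : ℂ) ≠ 0 := by exact_mod_cast hβ.ne'
    have ht0 : t ≠ 0 := by rintro rfl; simp at ht
    set S := schur A with hS
    have hSp : S.PosDef := schur_posDef hA
    set c : Fin n → ℂ := fun j => (A 0 j.succ : ℂ) with hc
    set b' : ℤ → Fin n → ℂ := fun w0 j =>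
      b j.succ + Complex.I * (w0 + Complex.I * b 0) * c j / A 0 0 with hb'
    -- the common double series
    set E : (Fin n → ℤ) → ℤ → ℂ := fun v' w0 =>
      Complex.exp (-Real.pi * t * qf S (fun i => (v' i : ℂ)) + 2 * Real.pi * ∑ i, b' w0 i * v' i)
        * Complex.exp (-Real.pi / (t * A 0 0) * (w0 + Complex.I * b 0) ^ 2) with hE
    have hta : 0 < (t * A 0 0).re := by rw [Complex.re_mul_ofReal]; positivity
    have one_dim : ∀ v' : Fin n → ℤ, ∑' v0 : ℤ, Complex.exp (-Real.pi * t *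
        qf A (fun i => ((Fin.cons v0 v' : Fin (n + 1) → ℤ) i : ℂ)) +
          2 * Real.pi * ∑ i, b i * (Fin.cons v0 v' : Fin (n + 1) → ℤ) i)
        = 1 / (t * A 0 0) ^ (1 / 2 : ℂ) * ∑' w0 : ℤ, E v' w0 := by
      intro v'
      have h1 := Complex.tsum_exp_neg_quadratic hta (b 0 - t * ∑ j, c j * v' j)
      have l : ∀ v0 : ℤ, Complex.exp (-Real.pi * t *
          qf A (fun i => ((Fin.cons v0 v' : Fin (n + 1) → ℤ) i : ℂ)) +
          2 * Real.pi * ∑ i, b i * (Fin.cons v0 v' : Fin (n + 1) → ℤ) i)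
          = Complex.exp (-Real.pi * t * (qf S (fun i => (v' i : ℂ)) + (∑ j, c j * v' j) ^ 2 / A 0 0)
              + 2 * Real.pi * ∑ i : Fin n, b i.succ * v' i)
            * Complex.exp (-Real.pi * (t * A 0 0) * v0 ^ 2 +
              2 * Real.pi * (b 0 - t * ∑ j, c j * v' j) * v0) := by
        intro v0
        rw [qf_eq_schur hs hβ.ne', ← Complex.exp_add]
        congr 1
        simp only [Fin.cons_zero, Fin.cons_succ, Fin.sum_univ_succ]
        field_simp
        ring
      simp_rw [l]
      rw [tsum_mul_left, h1, mul_left_comm, ← tsum_mul_left]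
      congr 2
      funext w0
      simp only [hE, ← Complex.exp_add]
      congr 1
      have : ∑ i, b' w0 i * v' i = ∑ i : Fin n, b i.succ * v' i
          + Complex.I * (w0 + Complex.I * b 0) / A 0 0 * ∑ j, c j * v' j := by
        rw [Finset.mul_sum, ← Finset.sum_add_distrib]
        refine Finset.sum_congr rfl fun i _ => ?_
        simp only [hb']; ring
      rw [this]
      field_simp
      ring_nf
      simp only [Complex.I_sq]
      ring
    have hEsum : Summable (Function.uncurry E) := by
      have s1 := summable_gauss hSp ht (fun i => b i.succ - b 0 * c i / A 0 0)
      have s2 : Summable fun w0 : ℤ =>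
          Complex.exp (-Real.pi / (t * A 0 0) * (w0 + Complex.I * b 0) ^ 2) := by
        have := summable_gauss_dual (A := (Matrix.of fun _ _ : Fin 1 => A 0 0))
          (by
            refine Matrix.PosDef.of_dotProduct_mulVec_pos ?_ fun x hx => ?_
            · ext i j; simp
            · have : x 0 ≠ 0 := fun h => hx (by ext i; fin_cases i; exact h)
              simp [dotProduct, mulVec]
              have := mul_self_pos.mpr this
              nlinarith [mul_pos hβ this]) ht (fun _ => b 0)
        rw [← (Equiv.funUnique (Fin 1) ℤ).symm.summable_iff] at this
        refine this.congr fun w0 => ?_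
        simp [qf]
        congr 1
        field_simp
      have s3 := summable_mul_of_summable_norm s1.norm s2.norm
      refine Summable.of_norm (s3.norm.congr fun x => ?_)
      obtain ⟨v', w0⟩ := x
      simp only [Function.uncurry, hE, norm_mul]
      congr 1
      rw [Complex.norm_exp, Complex.norm_exp]
      congr 1
      simp only [Complex.add_re]
      congr 1
      have : ∑ i, b' w0 i * v' i = ∑ i : Fin n, (b i.succ - b 0 * c i / A 0 0) * v' i
          + ((w0 / A 0 0 * ∑ j : Fin n, A 0 j.succ * v' j : ℝ) : ℂ) * Complex.I := by
        push_cast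
        rw [Finset.mul_sum, Finset.sum_mul, ← Finset.sum_add_distrib]
        refine Finset.sum_congr rfl fun i _ => ?_
        simp only [hb', hc]
        ring_nf
        simp only [Complex.I_sq]
        ring
      rw [this, mul_add, Complex.add_re]
      have : ((2 : ℂ) * Real.pi * (((w0 / A 0 0 * ∑ j : Fin n, A 0 j.succ * v' j : ℝ) : ℂ) *
          Complex.I)).re = 0 := by
        rw [show (2 : ℂ) * Real.pi = ((2 * Real.pi : ℝ) : ℂ) by push_cast; ring]
        rw [Complex.re_ofReal_mul, Complex.re_ofReal_mul]
        simp
      rw [this, add_zero]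
    let ec := (Fin.consEquiv (fun _ : Fin (n + 1) => ℤ))
    -- left hand side
    have hL : ∑' v : Fin (n + 1) → ℤ, Complex.exp (-Real.pi * t * qf A (fun i => (v i : ℂ)) +
        2 * Real.pi * ∑ i, b i * v i) = ∑' v' : Fin n → ℤ, ∑' v0 : ℤ, Complex.exp (-Real.pi * t *
        qf A (fun i => ((Fin.cons v0 v' : Fin (n + 1) → ℤ) i : ℂ)) +
          2 * Real.pi * ∑ i, b i * (Fin.cons v0 v' : Fin (n + 1) → ℤ) i) := by
      have s := summable_gauss hA ht b
      rw [← ec.summable_iff, ← (Equiv.prodComm _ _).summable_iff] at s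
      rw [← ec.tsum_eq, ← (Equiv.prodComm _ _).tsum_eq]
      exact s.tsum_prod
    have hR : ∑' w : Fin (n + 1) → ℤ, Complex.exp (-Real.pi / t * qf A⁻¹
        (fun i => (w i : ℂ) + Complex.I * b i)) = ∑' w0 : ℤ, ∑' w' : Fin n → ℤ,
        Complex.exp (-Real.pi / t * qf A⁻¹
        (fun i => ((Fin.cons w0 w' : Fin (n + 1) → ℤ) i : ℂ) + Complex.I * b i)) := by
      have s := summable_gauss_dual hA ht b
      rw [← ec.summable_iff] at s
      rw [← ec.tsum_eq]
      exact s.tsum_prod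
    rw [hL, hR]
    simp_rw [one_dim]
    rw [tsum_mul_left, ← hEsum.tsum_comm]
    have inner : ∀ w0 : ℤ, ∑' v' : Fin n → ℤ, E v' w0 =
        (1 / t ^ (1 / 2 : ℂ)) ^ n * (1 / (√S.det : ℝ) : ℂ) * ∑' w' : Fin n → ℤ,
        Complex.exp (-Real.pi / t * qf A⁻¹
        (fun i => ((Fin.cons w0 w' : Fin (n + 1) → ℤ) i : ℂ) + Complex.I * b i)) := by
      intro w0
      simp only [hE]
      rw [tsum_mul_right, ih hSp (b' w0), mul_assoc, ← tsum_mul_right]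
      congr 2
      funext w'
      rw [← Complex.exp_add, qf_inv_schur hA]
      congr 1
      simp only [Fin.cons_zero, Fin.cons_succ, ← hS]
      have : (fun i => (w' i : ℂ) + Complex.I * b' w0 i) = fun j : Fin n =>
          (w' j : ℂ) + Complex.I * b j.succ - (w0 + Complex.I * b 0) * (A 0 j.succ) / (A 0 0) := by
        funext j
        simp only [hb', hc]
        ring_nf
        simp only [Complex.I_sq, Complex.I_pow_three]
        ring
      rw [this]
      generalize qf S⁻¹ _ = X
      field_simp
      ring
    simp_rw [inner]
    rw [tsum_mul_left, ← mul_assoc]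
    congr 1
    have hsq : (A 0 0 : ℂ) ^ (1 / 2 : ℂ) = ((√(A 0 0) : ℝ) : ℂ) := by
      rw [Real.sqrt_eq_rpow, Complex.ofReal_cpow hβ.le]
      norm_num
    have hcp : (t * A 0 0) ^ (1 / 2 : ℂ) = t ^ (1 / 2 : ℂ) * (A 0 0 : ℂ) ^ (1 / 2 : ℂ) := by
      rw [Complex.cpow_def_of_ne_zero (mul_ne_zero ht0 hβ'), Complex.cpow_def_of_ne_zero ht0,
        Complex.cpow_def_of_ne_zero hβ', ← Complex.exp_add, Complex.log_mul_ofReal _ hβ _ ht0,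
        Complex.ofReal_log hβ.le]
      ring_nf
    rw [det_eq_schur hs hβ.ne', Real.sqrt_mul hβ.le, hcp, hsq, ← hS]
    push_cast
    simp only [one_div, mul_inv]
    ring

theorem norm_second_diff_le (z : ℂ) :
    ‖Complex.exp z + Complex.exp (-z) - 2 - z ^ 2‖ ≤ 2 * (‖z‖ ^ 3 * Real.exp ‖z‖) := by
  have h1 := Complex.norm_exp_sub_sum_le_norm_mul_exp z 3
  have h2 := Complex.norm_exp_sub_sum_le_norm_mul_exp (-z) 3
  rw [norm_neg] at h2
  have e : Complex.exp z + Complex.exp (-z) - 2 - z ^ 2 =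
    (Complex.exp z - ∑ m ∈ Finset.range 3, z ^ m / m.factorial) +
    (Complex.exp (-z) - ∑ m ∈ Finset.range 3, (-z) ^ m / m.factorial) := by
    simp [Finset.sum_range_succ, Nat.factorial]
    ring
  rw [e]
  refine (norm_add_le _ _).trans ?_
  linarith

theorem pow_three_mul_exp_le {x : ℝ} (hx : 0 ≤ x) : x ^ 3 * Real.exp x ≤ Real.exp (4 * x) := by
  have h1 : x ≤ Real.exp x := by linarith [Real.add_one_le_exp x]
  calc x ^ 3 * Real.exp x ≤ Real.exp x ^ 3 * Real.exp x := by gcongr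
    _ = Real.exp (4 * x) := by rw [← Real.exp_nat_mul, ← Real.exp_add]; congr 1; push_cast; ring

theorem norm_tsum_second_diff_le {ι : Type*} {A x : ι → ℂ}
    (hA : Summable fun i => ‖A i‖ * Real.exp (4 * ‖x i‖)) {s : ℝ} (hs : 0 < s) (hs1 : s ≤ 1) :
    ‖(∑' i, A i * Complex.exp (s * x i)) + (∑' i, A i * Complex.exp (-s * x i))
      - 2 * (∑' i, A i) - s ^ 2 * ∑' i, A i * x i ^ 2‖
      ≤ 2 * s ^ 3 * ∑' i, ‖A i‖ * Real.exp (4 * ‖x i‖) := by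
  have hexp : ∀ c : ℂ, ‖c‖ ≤ 1 → Summable fun i => A i * Complex.exp (c * x i) := by
    intro c hc
    refine Summable.of_norm_bounded hA fun i => ?_
    rw [norm_mul]
    gcongr
    refine (Complex.norm_exp_le_exp_norm _).trans ?_
    rw [norm_mul, Real.exp_le_exp]
    nlinarith [norm_nonneg (x i)]
  have hs' : ‖(s : ℂ)‖ ≤ 1 := by
    rw [Complex.norm_real, Real.norm_of_nonneg hs.le]; exact hs1
  have a1 := hexp s hs'
  have a2 := hexp (-s) (by rwa [norm_neg])
  have a3 : Summable A := by simpa using hexp 0 (by simp)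
  have a4 : Summable fun i => A i * x i ^ 2 := by
    refine Summable.of_norm_bounded hA fun i => ?_
    rw [norm_mul, norm_pow]
    gcongr
    have h1 : ‖x i‖ ≤ Real.exp ‖x i‖ := by linarith [Real.add_one_le_exp ‖x i‖]
    calc ‖x i‖ ^ 2 ≤ Real.exp ‖x i‖ ^ 2 := by gcongr
      _ = Real.exp (2 * ‖x i‖) := by rw [← Real.exp_nat_mul]; simp
      _ ≤ _ := by rw [Real.exp_le_exp]; linarith [norm_nonneg (x i)]
  rw [← a1.tsum_add a2, ← tsum_mul_left, ← (a1.add a2).tsum_sub (a3.mul_left 2), ← tsum_mul_left,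
    ← ((a1.add a2).sub (a3.mul_left 2)).tsum_sub (a4.mul_left _), ← tsum_mul_left]
  refine tsum_of_norm_bounded (hA.mul_left (2 * s ^ 3)).hasSum fun i => ?_
  have e : A i * Complex.exp (s * x i) + A i * Complex.exp (-s * x i) - 2 * A i
      - s ^ 2 * (A i * x i ^ 2) = A i * (Complex.exp (s * x i) + Complex.exp (-(s * x i)) - 2
        - (s * x i) ^ 2) := by ring_nf
  rw [e, norm_mul]
  have h1 := norm_second_diff_le (s * x i)
  have hn : ‖(s : ℂ) * x i‖ = s * ‖x i‖ := by
    rw [norm_mul, Complex.norm_real, Real.norm_of_nonneg hs.le]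
  rw [hn] at h1
  have h2 : (s * ‖x i‖) ^ 3 * Real.exp (s * ‖x i‖) ≤ s ^ 3 * Real.exp (4 * ‖x i‖) := by
    have : Real.exp (s * ‖x i‖) ≤ Real.exp ‖x i‖ := by
      rw [Real.exp_le_exp]; nlinarith [norm_nonneg (x i)]
    calc _ ≤ (s * ‖x i‖) ^ 3 * Real.exp ‖x i‖ := by gcongr
      _ = s ^ 3 * (‖x i‖ ^ 3 * Real.exp ‖x i‖) := by ring
      _ ≤ _ := by gcongr; exact pow_three_mul_exp_le (norm_nonneg _)
  calc _ ≤ ‖A i‖ * (2 * (s ^ 3 * Real.exp (4 * ‖x i‖))) := by gcongr; linarith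
    _ = _ := by ring

/-- Comparing second order coefficients of two exponential series. -/
theorem tsum_mul_sq_eq {ι κ : Type*} {A x : ι → ℂ} {B y : κ → ℂ} {c : ℂ}
    (hA : Summable fun i => ‖A i‖ * Real.exp (4 * ‖x i‖))
    (hB : Summable fun i => ‖B i‖ * Real.exp (4 * ‖y i‖))
    (h : ∀ s : ℂ, ∑' i, A i * Complex.exp (s * x i) = c * ∑' i, B i * Complex.exp (s * y i)) :
    ∑' i, A i * x i ^ 2 = c * ∑' i, B i * y i ^ 2 := by
  set MA := ∑' i, ‖A i‖ * Real.exp (4 * ‖x i‖)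
  set MB := ∑' i, ‖B i‖ * Real.exp (4 * ‖y i‖)
  set X := ∑' i, A i * x i ^ 2 with hX
  set Y := ∑' i, B i * y i ^ 2 with hY
  have key : ∀ s : ℝ, 0 < s → s ≤ 1 → ‖X - c * Y‖ ≤ s * (2 * MA + ‖c‖ * (2 * MB)) := by
    intro s hs hs1
    have h1 := norm_tsum_second_diff_le hA hs hs1
    have h2 := norm_tsum_second_diff_le hB hs hs1
    have h0 : ∑' i, A i = c * ∑' i, B i := by simpa using h 0
    rw [h s, h (-s), h0, ← hX] at h1
    rw [← hY] at h2
    have e : (s : ℂ) ^ 2 * (X - c * Y) = c * ((∑' i, B i * Complex.exp (s * y i)) +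
        (∑' i, B i * Complex.exp (-s * y i)) - 2 * (∑' i, B i) - s ^ 2 * Y) -
        (c * (∑' i, B i * Complex.exp (s * y i)) +
        c * (∑' i, B i * Complex.exp (-s * y i)) - 2 * (c * ∑' i, B i) - s ^ 2 * X) := by ring
    have h3 := norm_sub_le (c * ((∑' i, B i * Complex.exp (s * y i)) +
        (∑' i, B i * Complex.exp (-s * y i)) - 2 * (∑' i, B i) - s ^ 2 * Y))
        (c * (∑' i, B i * Complex.exp (s * y i)) +
        c * (∑' i, B i * Complex.exp (-s * y i)) - 2 * (c * ∑' i, B i) - s ^ 2 * X)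
    rw [← e, norm_mul, norm_mul, norm_pow, Complex.norm_real, Real.norm_of_nonneg hs.le] at h3
    have h4 : s ^ 2 * ‖X - c * Y‖ ≤ s ^ 2 * (s * (2 * MA + ‖c‖ * (2 * MB))) := by
      refine h3.trans ?_
      have := mul_le_mul_of_nonneg_left h2 (norm_nonneg c)
      nlinarith
    exact le_of_mul_le_mul_left h4 (by positivity)
  have : ‖X - c * Y‖ ≤ 0 := by
    have ht : Filter.Tendsto (fun s : ℝ => s * (2 * MA + ‖c‖ * (2 * MB)))
        (nhdsWithin 0 (Set.Ioi 0)) (nhds 0) := by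
      have : Continuous fun s : ℝ => s * (2 * MA + ‖c‖ * (2 * MB)) := by fun_prop
      have h := this.tendsto 0
      simp only [zero_mul] at h
      exact h.mono_left nhdsWithin_le_nhds
    refine ge_of_tendsto ht ?_
    filter_upwards [Ioc_mem_nhdsGT (show (0 : ℝ) < 1 by norm_num)] with s hs
    exact key s hs.1 hs.2
  exact sub_eq_zero.mp (norm_le_zero_iff.mp this)

/-- The integral quadratic form attached to an integral matrix. -/
def qi {n : ℕ} (C : Matrix (Fin n) (Fin n) ℤ) (w : Fin n → ℤ) : ℤ := w ⬝ᵥ C *ᵥ w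

/-- The linear form on integral vectors attached to a complex vector. -/
noncomputable def lin {n : ℕ} (a : Fin n → ℂ) (w : Fin n → ℤ) : ℂ := ∑ i, a i * w i

/-- `B` is the Gram matrix of an even positive definite lattice of rank `2m`, level `p` and
determinant `p ^ (m + 2)`, and `C = p B⁻¹`. -/
structure IsLevel (p m : ℕ) (B C : Matrix (Fin (2 * m)) (Fin (2 * m)) ℤ) : Prop where
  prime : p.Prime
  symmB : B.IsSymm
  evenB : ∀ i, 2 ∣ B i i
  posB : (B.map (Int.cast : ℤ → ℝ)).PosDef
  det : B.det = (p : ℤ) ^ (m + 2)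
  mul : B * C = (p : ℤ) • (1 : Matrix (Fin (2 * m)) (Fin (2 * m)) ℤ)
  evenC : ∀ i, 2 ∣ C i i

theorem norm_lin_le {n : ℕ} (a : Fin n → ℂ) (w : Fin n → ℤ) :
    ‖lin a w‖ ≤ ‖a‖ * ∑ i, |(w i : ℝ)| := by
  rw [lin, Finset.mul_sum]
  refine (norm_sum_le _ _).trans (Finset.sum_le_sum fun i _ => ?_)
  rw [norm_mul, Complex.norm_intCast]
  gcongr
  exact norm_le_pi_norm a i

theorem qi_add {n : ℕ} {C : Matrix (Fin n) (Fin n) ℤ} (hC : C.IsSymm) (x y : Fin n → ℤ) :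
    qi C (x + y) = qi C x + 2 * (x ⬝ᵥ C *ᵥ y) + qi C y := by
  have : y ⬝ᵥ C *ᵥ x = x ⬝ᵥ C *ᵥ y := by
    rw [dotProduct_comm, ← Matrix.vecMul_transpose, hC.eq, ← dotProduct_mulVec]
  simp only [qi, mulVec_add, dotProduct_add, add_dotProduct, this]
  ring

theorem qi_smul {n : ℕ} (C : Matrix (Fin n) (Fin n) ℤ) (c : ℤ) (x : Fin n → ℤ) :
    qi C (c • x) = c ^ 2 * qi C x := by
  simp only [qi, mulVec_smul, dotProduct_smul, smul_dotProduct, smul_eq_mul]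
  ring

theorem qi_neg {n : ℕ} (C : Matrix (Fin n) (Fin n) ℤ) (x : Fin n → ℤ) :
    qi C (-x) = qi C x := by
  simp [qi, mulVec_neg]

theorem two_dvd_qi {n : ℕ} {C : Matrix (Fin n) (Fin n) ℤ} (hC : C.IsSymm) (he : ∀ i, 2 ∣ C i i)
    (x : Fin n → ℤ) : 2 ∣ qi C x := by
  have hx : x = ∑ i, Pi.single i (x i) := by
    rw [Finset.univ_sum_single]
  have : ∀ s : Finset (Fin n), 2 ∣ qi C (∑ i ∈ s, Pi.single i (x i)) := by
    intro s
    induction s using Finset.induction_on with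
    | empty => simp [qi]
    | insert i s hi ih =>
      rw [Finset.sum_insert hi, qi_add hC]
      refine dvd_add (dvd_add ?_ (dvd_mul_right _ _)) ih
      have : qi C (Pi.single i (x i)) = C i i * (x i * x i) := by
        simp [qi, mulVec_single]; ring
      rw [this]
      exact (he i).mul_right _
  rw [hx]
  exact this _

theorem qf_intCast {n : ℕ} (B : Matrix (Fin n) (Fin n) ℤ) (v : Fin n → ℤ) :
    qf (B.map (Int.cast : ℤ → ℝ)) (fun i => (v i : ℂ)) = (qi B v : ℂ) := by
  simp only [qf, qi, dotProduct, mulVec, Finset.mul_sum, Matrix.map_apply]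
  push_cast
  exact Finset.sum_congr rfl fun i _ => Finset.sum_congr rfl fun j _ => by ring

namespace IsLevel

variable {p m : ℕ} {B C : Matrix (Fin (2 * m)) (Fin (2 * m)) ℤ}

theorem p_pos (H : IsLevel p m B C) : 0 < p := H.prime.pos

theorem pC (H : IsLevel p m B C) : (p : ℂ) ≠ 0 := by exact_mod_cast H.p_pos.ne'

theorem pR (H : IsLevel p m B C) : (0 : ℝ) < p := by exact_mod_cast H.p_pos

theorem mulVec_mulVec (H : IsLevel p m B C) (w : Fin (2 * m) → ℤ) : B *ᵥ (C *ᵥ w) = (p : ℤ) • w := by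
  rw [Matrix.mulVec_mulVec, H.mul, smul_mulVec, one_mulVec]

theorem inv_eq (H : IsLevel p m B C) : (B.map (Int.cast : ℤ → ℝ))⁻¹ = (p : ℝ)⁻¹ • C.map (Int.cast : ℤ → ℝ) := by
  apply Matrix.inv_eq_right_inv
  have h := congrArg (fun M : Matrix (Fin (2 * m)) (Fin (2 * m)) ℤ => M.map (Int.castRingHom ℝ)) H.mul
  simp only [Matrix.map_mul] at h
  have h2 : ((p : ℤ) • (1 : Matrix (Fin (2 * m)) (Fin (2 * m)) ℤ)).map (Int.castRingHom ℝ) =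
      (p : ℝ) • 1 := by
    ext i j
    rw [Matrix.map_apply, Matrix.smul_apply, Matrix.smul_apply, Matrix.one_apply, Matrix.one_apply]
    split_ifs <;> simp
  rw [h2] at h
  have h3 : B.map (Int.cast : ℤ → ℝ) * C.map (Int.cast : ℤ → ℝ) = (p : ℝ) • 1 := h
  rw [mul_smul_comm, h3, smul_smul, inv_mul_cancel₀ H.pR.ne', one_smul]

theorem mul' (H : IsLevel p m B C) : C * B = (p : ℤ) • (1 : Matrix (Fin (2 * m)) (Fin (2 * m)) ℤ) := by
  have hinv : (B.map (Int.cast : ℤ → ℝ))⁻¹ * (B.map (Int.cast : ℤ → ℝ)) = 1 :=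
    Matrix.nonsing_inv_mul _ ((Matrix.isUnit_iff_isUnit_det _).mp H.posB.isUnit)
  rw [H.inv_eq, smul_mul_assoc] at hinv
  have h1 : C.map (Int.cast : ℤ → ℝ) * B.map (Int.cast : ℤ → ℝ) = (p : ℝ) • 1 := by
    rw [← hinv, smul_smul, mul_inv_cancel₀ H.pR.ne', one_smul]
  have h2 : (C * B).map (Int.castRingHom ℝ) = ((p : ℤ) • (1 : Matrix (Fin (2 * m)) (Fin (2 * m)) ℤ)).map
      (Int.castRingHom ℝ) := by
    rw [Matrix.map_mul]
    refine h1.trans ?_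
    ext i j
    rw [Matrix.map_apply, Matrix.smul_apply, Matrix.smul_apply, Matrix.one_apply, Matrix.one_apply]
    split_ifs <;> simp
  ext i j
  have := congrFun (congrFun h2 i) j
  rw [Matrix.map_apply, Matrix.map_apply] at this
  exact Int.cast_injective this

theorem mulVec_mulVec' (H : IsLevel p m B C) (w : Fin (2 * m) → ℤ) : C *ᵥ (B *ᵥ w) = (p : ℤ) • w := by
  rw [Matrix.mulVec_mulVec, H.mul', smul_mulVec, one_mulVec]

theorem posInv (H : IsLevel p m B C) : (B.map (Int.cast : ℤ → ℝ))⁻¹.PosDef := H.posB.inv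

theorem symmC (H : IsLevel p m B C) : C.IsSymm := by
  have h := isSymm_of_posDef H.posInv
  rw [H.inv_eq] at h
  ext i j
  have := congrFun (congrFun h i) j
  have hp := H.pR.ne'
  simpa [hp] using this

theorem qi_B_pos (H : IsLevel p m B C) {v : Fin (2 * m) → ℤ} (hv : v ≠ 0) : 0 < qi B v := by
  have h := H.posB.dotProduct_mulVec_pos (x := fun i => (v i : ℝ)) (by
    intro h; apply hv; funext i; have := congrFun h i; simpa using this)
  have e := qf_ofReal (B.map (Int.cast : ℤ → ℝ)) (fun i => (v i : ℝ))
  have e2 := qf_intCast B v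
  simp only [Complex.ofReal_intCast] at e
  rw [e2] at e
  have e3 := e
  rw [← Complex.ofReal_intCast, Complex.ofReal_inj] at e3
  simp only [star_trivial] at h
  rw [← e3] at h
  exact_mod_cast h

theorem mulVec_B_injective (H : IsLevel p m B C) : Function.Injective fun v : Fin (2 * m) → ℤ => B *ᵥ v := by
  intro v w h
  have h2 := congrArg (fun x => C *ᵥ x) h
  simp only [H.mulVec_mulVec'] at h2
  funext i
  have := congrFun h2 i
  have hp : p ≠ 0 := H.p_pos.ne'
  simpa [hp] using this

theorem mulVec_C_injective (H : IsLevel p m B C) : Function.Injective fun v : Fin (2 * m) → ℤ => C *ᵥ v := by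
  intro v w h
  have h2 := congrArg (fun x => B *ᵥ x) h
  simp only [H.mulVec_mulVec] at h2
  funext i
  have := congrFun h2 i
  have hp : p ≠ 0 := H.p_pos.ne'
  simpa [hp] using this

theorem qi_C_mulVec (H : IsLevel p m B C) (v : Fin (2 * m) → ℤ) : qi C (B *ᵥ v) = p * qi B v := by
  simp only [qi, H.mulVec_mulVec', dotProduct_smul, smul_eq_mul]
  rw [dotProduct_comm]

theorem qi_B_mulVec (H : IsLevel p m B C) (v : Fin (2 * m) → ℤ) : qi B (C *ᵥ v) = p * qi C v := by
  simp only [qi, H.mulVec_mulVec, dotProduct_smul, smul_eq_mul]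
  rw [dotProduct_comm]

theorem qi_C_pos (H : IsLevel p m B C) {v : Fin (2 * m) → ℤ} (hv : v ≠ 0) : 0 < qi C v := by
  have h1 : C *ᵥ v ≠ 0 := by
    intro h
    exact hv (H.mulVec_C_injective (by simpa using h))
  have h2 := H.qi_B_pos h1
  rw [H.qi_B_mulVec] at h2
  have hp : (0 : ℤ) < p := by exact_mod_cast H.p_pos
  exact (mul_pos_iff_of_pos_left hp).mp h2

theorem qi_C_add (H : IsLevel p m B C) (γ v : Fin (2 * m) → ℤ) :
    qi C (γ + B *ᵥ v) = qi C γ + p * (2 * (γ ⬝ᵥ v) + qi B v) := by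
  rw [qi_add H.symmC, H.qi_C_mulVec, H.mulVec_mulVec', dotProduct_smul, smul_eq_mul]
  ring

theorem exists_lower (H : IsLevel p m B C) : ∃ ε > 0, ∀ w : Fin (2 * m) → ℤ, ε * ∑ i, (w i : ℝ) ^ 2 ≤ (qi C w : ℝ) := by
  obtain ⟨ε, hε, h⟩ := H.posInv.exists_lower_bound
  refine ⟨p * ε, by have := H.pR; positivity, fun w => ?_⟩
  have h1 := h (fun i => (w i : ℝ))
  rw [H.inv_eq] at h1
  have e : (fun i => (w i : ℝ)) ⬝ᵥ ((p : ℝ)⁻¹ • C.map (Int.cast : ℤ → ℝ)) *ᵥ (fun i => (w i : ℝ)) =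
      (p : ℝ)⁻¹ * (qi C w : ℝ) := by
    rw [smul_mulVec, dotProduct_smul, smul_eq_mul]
    congr 1
    simp [qi, dotProduct, mulVec]
  rw [e] at h1
  have := mul_le_mul_of_nonneg_left h1 H.pR.le
  rw [← mul_assoc, ← mul_assoc, mul_inv_cancel₀ H.pR.ne', one_mul] at this
  exact this

theorem summable_C (H : IsLevel p m B C) {δ : ℝ} (hδ : 0 < δ) (c : ℝ) : Summable fun w : Fin (2 * m) → ℤ =>
    Real.exp (-δ * (qi C w : ℝ) + c * ∑ i, |(w i : ℝ)|) := by
  obtain ⟨ε, hε, h⟩ := H.exists_lower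
  refine Summable.of_nonneg_of_le (fun _ => (Real.exp_pos _).le) (fun w => ?_)
    (summable_gauss_vec (δ := δ * ε) (by positivity) c (2 * m))
  rw [Real.exp_le_exp]
  have := mul_le_mul_of_nonneg_left (h w) hδ.le
  nlinarith

end IsLevel

/-- A complex vector is isotropic for the bilinear form given by `B`. -/
def Isotropic {n : ℕ} (B : Matrix (Fin n) (Fin n) ℤ) (a : Fin n → ℂ) : Prop :=
  ∑ i, ∑ j, (B i j : ℂ) * a i * a j = 0

namespace IsLevel

variable {p m : ℕ} {B C : Matrix (Fin (2 * m)) (Fin (2 * m)) ℤ}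

theorem qf_shift (H : IsLevel p m B C) {a : Fin (2 * m) → ℂ} (ha : Isotropic B a)
    (γ v : Fin (2 * m) → ℤ) (s : ℂ) :
    qf (B.map (Int.cast : ℤ → ℝ)) (fun i => (v i : ℂ) + (((C *ᵥ γ) i : ℂ) / p + s * a i)) =
      (qi C (γ + B *ᵥ v) : ℂ) / p + 2 * s * lin a (γ + B *ᵥ v) := by
  have hpc := H.pC
  set u := γ + B *ᵥ v with hu
  have hCu : ∀ i, ((C *ᵥ u) i : ℂ) / p = (v i : ℂ) + ((C *ᵥ γ) i : ℂ) / p := by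
    intro i
    rw [hu, mulVec_add, H.mulVec_mulVec']
    simp only [Pi.add_apply, Pi.smul_apply, smul_eq_mul]
    push_cast
    field_simp
    ring
  have e : (fun i => (v i : ℂ) + (((C *ᵥ γ) i : ℂ) / p + s * a i)) =
      fun i => ((C *ᵥ u) i : ℂ) / p + s * a i := by
    funext i
    rw [hCu]; ring
  rw [e, qf_add_I_mul (isSymm_of_posDef H.posB)]
  have h1 : qf (B.map (Int.cast : ℤ → ℝ)) (fun i => ((C *ᵥ u) i : ℂ) / p) = (qi C u : ℂ) / p := by
    have h2 := qf_inv H.posInv (x := fun i => (u i : ℂ)) (y := fun i => ((C *ᵥ u) i : ℂ) / p) (by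
      intro i
      rw [H.inv_eq]
      simp only [Matrix.smul_apply, Matrix.map_apply, smul_eq_mul, mulVec, dotProduct]
      push_cast
      rw [Finset.sum_div]
      exact Finset.sum_congr rfl fun j _ => by field_simp)
    rw [Matrix.nonsing_inv_nonsing_inv _
      ((Matrix.isUnit_iff_isUnit_det _).mp H.posB.isUnit)] at h2
    rw [h2]
    simp only [qi, dotProduct]
    push_cast
    rw [Finset.sum_div]
    exact Finset.sum_congr rfl fun j _ => by ring
  have h3 : qf (B.map (Int.cast : ℤ → ℝ)) (fun i => s * a i) = 0 := by
    have : qf (B.map (Int.cast : ℤ → ℝ)) (fun i => s * a i) =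
        s ^ 2 * ∑ i, ∑ j, (B i j : ℂ) * a i * a j := by
      simp only [qf, Finset.mul_sum, Matrix.map_apply, Complex.ofReal_intCast]
      exact Finset.sum_congr rfl fun i _ => Finset.sum_congr rfl fun j _ => by ring
    rw [this, ha, mul_zero]
  have h4 : ∑ i, (∑ j, ((B.map (Int.cast : ℤ → ℝ) i j : ℝ) : ℂ) * (s * a j)) *
      (((C *ᵥ u) i : ℂ) / p) = s * lin a u := by
    simp only [Finset.sum_mul]
    rw [Finset.sum_comm, lin, Finset.mul_sum]
    refine Finset.sum_congr rfl fun j _ => ?_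
    have h5 := congrFun (H.mulVec_mulVec u) j
    simp only [mulVec, dotProduct, Pi.smul_apply, smul_eq_mul] at h5
    have h6 : ∑ i, (B j i : ℂ) * ((C *ᵥ u) i : ℂ) = p * u j := by
      have := congrArg (Int.cast : ℤ → ℂ) h5
      push_cast at this
      simp only [mulVec, dotProduct]
      push_cast
      exact this
    have h7 : ∀ i, ((B.map (Int.cast : ℤ → ℝ) i j : ℝ) : ℂ) * (s * a j) * (((C *ᵥ u) i : ℂ) / p) =
        (s * a j / p) * ((B j i : ℂ) * ((C *ᵥ u) i : ℂ)) := by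
      intro i
      rw [Matrix.map_apply, Complex.ofReal_intCast, H.symmB.apply j i]
      ring
    rw [Finset.sum_congr rfl fun i _ => h7 i, ← Finset.mul_sum, h6]
    field_simp
  rw [h1, h3, h4]
  ring

/-- The constant `√det B`. -/
noncomputable def rootDet (p m : ℕ) : ℝ := √((p : ℝ) ^ (m + 2))

theorem rootDet_pos (H : IsLevel p m B C) : 0 < rootDet p m :=
  Real.sqrt_pos.mpr (pow_pos H.pR _)

theorem det_real (H : IsLevel p m B C) : (B.map (Int.cast : ℤ → ℝ)).det = (p : ℝ) ^ (m + 2) := by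
  have h := (Int.castRingHom ℝ).map_det B
  rw [H.det] at h
  simp only [map_pow, eq_intCast, Int.cast_natCast] at h
  rw [h]; rfl

theorem inversion_param (H : IsLevel p m B C) {a : Fin (2 * m) → ℂ} (ha : Isotropic B a)
    (γ : Fin (2 * m) → ℤ) {τ : ℂ} (hτ : 0 < τ.im) (s : ℂ) :
    ∑' w : Fin (2 * m) → ℤ, Complex.exp (Real.pi * Complex.I * τ * qi C w / p
        - 2 * Real.pi * Complex.I * (γ ⬝ᵥ C *ᵥ w : ℤ) / p)
        * Complex.exp (s * (-2 * Real.pi * Complex.I * lin a w))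
    = (rootDet p m / (-Complex.I * τ) ^ m) * ∑' v : Fin (2 * m) → ℤ,
      Complex.exp (-Real.pi * Complex.I / τ * qi C (γ + B *ᵥ v) / p)
        * Complex.exp (s * (-2 * Real.pi * Complex.I * lin a (γ + B *ᵥ v) / τ)) := by
  have hpc := H.pC
  have hτ0 : τ ≠ 0 := by rintro rfl; simp at hτ
  have ht : 0 < (-Complex.I * τ).re := by simpa using hτ
  have key := theta_inversion H.posInv ht
    (fun i => -Complex.I * (((C *ᵥ γ) i : ℂ) / p + s * a i))
  rw [Matrix.nonsing_inv_nonsing_inv _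
      ((Matrix.isUnit_iff_isUnit_det _).mp H.posB.isUnit)] at key
  have hdet : (1 / (√(B.map (Int.cast : ℤ → ℝ))⁻¹.det : ℝ) : ℂ) = rootDet p m := by
    rw [Matrix.det_nonsing_inv, Ring.inverse_eq_inv', Real.sqrt_inv, H.det_real, rootDet]
    push_cast
    rw [one_div, inv_inv]
  have hpow : (1 / (-Complex.I * τ) ^ (1 / 2 : ℂ)) ^ (2 * m) = 1 / (-Complex.I * τ) ^ m := by
    rw [pow_mul, div_pow, one_pow]
    have : ((-Complex.I * τ) ^ (1 / 2 : ℂ)) ^ 2 = -Complex.I * τ := by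
      have := Complex.cpow_nat_inv_pow (-Complex.I * τ) (n := 2) (by norm_num)
      rwa [Nat.cast_ofNat, ← one_div] at this
    rw [this, div_pow, one_pow]
  rw [hdet, hpow] at key
  have hI : Complex.I * Complex.I = -1 := Complex.I_mul_I
  calc _ = ∑' v : Fin (2 * m) → ℤ, Complex.exp (-Real.pi * (-Complex.I * τ) *
        qf (B.map (Int.cast : ℤ → ℝ))⁻¹ (fun i => (v i : ℂ)) +
        2 * Real.pi * ∑ i, (-Complex.I * (((C *ᵥ γ) i : ℂ) / p + s * a i)) * v i) := by
        congr 1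
        funext w
        rw [← Complex.exp_add]
        congr 1
        have h1 : qf (B.map (Int.cast : ℤ → ℝ))⁻¹ (fun i => (w i : ℂ)) = qi C w / p := by
          rw [H.inv_eq, ← qf_intCast]
          simp only [qf, Matrix.smul_apply, smul_eq_mul]
          push_cast
          rw [Finset.sum_div]
          refine Finset.sum_congr rfl fun i _ => ?_
          rw [Finset.sum_div]
          exact Finset.sum_congr rfl fun j _ => by ring
        have h2 : ∑ i, (-Complex.I * (((C *ᵥ γ) i : ℂ) / p + s * a i)) * w i =
            -Complex.I * (((γ ⬝ᵥ C *ᵥ w : ℤ) : ℂ) / p + s * lin a w) := by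
          have : γ ⬝ᵥ C *ᵥ w = C *ᵥ γ ⬝ᵥ w := by
            rw [dotProduct_mulVec, ← Matrix.mulVec_transpose, H.symmC.eq]
          rw [this, lin, dotProduct]
          push_cast
          rw [Finset.sum_div, Finset.mul_sum, ← Finset.sum_add_distrib, Finset.mul_sum]
          exact Finset.sum_congr rfl fun i _ => by ring
        rw [h1, h2]
        ring
    _ = _ := key
    _ = _ := by
        rw [one_div, mul_comm _ (rootDet p m : ℂ), ← div_eq_mul_inv]
        congr 2
        funext v
        have e : (fun i => (v i : ℂ) + Complex.I * (-Complex.I * (((C *ᵥ γ) i : ℂ) / p + s * a i)))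
          = (fun i => (v i : ℂ) + (((C *ᵥ γ) i : ℂ) / p + s * a i)) := by
          funext i
          rw [← mul_assoc, mul_neg, hI, neg_neg, one_mul]
        rw [e, H.qf_shift ha, ← Complex.exp_add]
        congr 1
        have : -(Real.pi : ℂ) / (-Complex.I * τ) = -Real.pi * Complex.I / τ := by
          rw [div_eq_div_iff (by simp [hτ0]) hτ0]
          linear_combination (-Real.pi * τ : ℂ) * hI
        rw [this]
        field_simp
        try ring

theorem summable_C_weight (H : IsLevel p m B C) {τ : ℂ} (hτ : 0 < τ.im) (c : ℝ) :
    Summable fun w : Fin (2 * m) → ℤ => ‖Complex.exp (Real.pi * Complex.I * τ * qi C w / p)‖ *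
      Real.exp (c * ∑ i, |(w i : ℝ)|) := by
  have hp := H.pR
  refine (H.summable_C (δ := Real.pi * τ.im / p) (by positivity) c).congr fun w => ?_
  rw [Complex.norm_exp, ← Real.exp_add]
  congr 2
  have : (Real.pi : ℂ) * Complex.I * τ * qi C w / p = ((Real.pi * qi C w / p : ℝ) : ℂ) * (Complex.I * τ) := by
    push_cast; ring
  rw [this, Complex.re_ofReal_mul]
  simp
  ring

theorem neg_inv_im {τ : ℂ} (hτ : 0 < τ.im) : 0 < (-1 / τ).im := by
  have : 0 < Complex.normSq τ := Complex.normSq_pos.mpr (by rintro rfl; simp at hτ)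
  rw [neg_div, one_div, Complex.neg_im, Complex.inv_im, neg_div, neg_neg]
  positivity

theorem inversion (H : IsLevel p m B C) {a : Fin (2 * m) → ℂ} (ha : Isotropic B a)
    {k : ℕ} (hk : k = 0 ∨ k = 2) (γ : Fin (2 * m) → ℤ) {τ : ℂ} (hτ : 0 < τ.im) :
    ∑' w : Fin (2 * m) → ℤ, lin a w ^ k * Complex.exp (Real.pi * Complex.I * τ * qi C w / p
        - 2 * Real.pi * Complex.I * (γ ⬝ᵥ C *ᵥ w : ℤ) / p)
    = (rootDet p m / ((-Complex.I * τ) ^ m * τ ^ k)) * ∑' v : Fin (2 * m) → ℤ,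
      lin a (γ + B *ᵥ v) ^ k * Complex.exp (-Real.pi * Complex.I / τ * qi C (γ + B *ᵥ v) / p) := by
  have hτ0 : τ ≠ 0 := by rintro rfl; simp at hτ
  have hpi : (Real.pi : ℂ) ≠ 0 := by exact_mod_cast Real.pi_ne_zero
  rcases hk with rfl | rfl
  · simpa using H.inversion_param ha γ hτ 0
  · have hnorm : ∀ w : Fin (2 * m) → ℤ, ∀ x : ℝ,
        ‖Complex.exp (Real.pi * Complex.I * τ * qi C w / p
        - 2 * Real.pi * Complex.I * (γ ⬝ᵥ C *ᵥ w : ℤ) / p)‖ =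
        ‖Complex.exp (Real.pi * Complex.I * τ * qi C w / p)‖ := by
      intro w x
      rw [Complex.exp_sub, norm_div]
      have : (2 : ℂ) * Real.pi * Complex.I * (γ ⬝ᵥ C *ᵥ w : ℤ) / p =
        ((2 * Real.pi * (γ ⬝ᵥ C *ᵥ w : ℤ) / p : ℝ) : ℂ) * Complex.I := by push_cast; ring
      rw [this, Complex.norm_exp_ofReal_mul_I, div_one]
    have s1 : Summable fun w : Fin (2 * m) → ℤ =>
        ‖Complex.exp (Real.pi * Complex.I * τ * qi C w / p
        - 2 * Real.pi * Complex.I * (γ ⬝ᵥ C *ᵥ w : ℤ) / p)‖ *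
        Real.exp (4 * ‖-2 * Real.pi * Complex.I * lin a w‖) := by
      refine Summable.of_nonneg_of_le (fun _ => by positivity) (fun w => ?_)
        (H.summable_C_weight hτ (4 * (2 * Real.pi * ‖a‖)))
      rw [hnorm w 0]
      refine mul_le_mul_of_nonneg_left (Real.exp_le_exp.mpr ?_) (norm_nonneg _)
      have h1 : ‖-2 * Real.pi * Complex.I * lin a w‖ = 2 * Real.pi * ‖lin a w‖ := by
        simp [abs_of_pos Real.pi_pos]
      rw [h1, mul_assoc 4]
      have := norm_lin_le a w
      have hpp := Real.pi_pos
      calc 4 * (2 * Real.pi * ‖lin a w‖) ≤ 4 * (2 * Real.pi * (‖a‖ * ∑ i, |(w i : ℝ)|)) := by gcongr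
        _ = _ := by ring
    have s2 : Summable fun v : Fin (2 * m) → ℤ =>
        ‖Complex.exp (-Real.pi * Complex.I / τ * qi C (γ + B *ᵥ v) / p)‖ *
        Real.exp (4 * ‖-2 * Real.pi * Complex.I * lin a (γ + B *ᵥ v) / τ‖) := by
      have h0 : Summable fun w : Fin (2 * m) → ℤ =>
          ‖Complex.exp (-Real.pi * Complex.I / τ * qi C w / p)‖ *
          Real.exp (4 * ‖-2 * Real.pi * Complex.I * lin a w / τ‖) := by
        refine Summable.of_nonneg_of_le (fun _ => by positivity) (fun w => ?_)
          (H.summable_C_weight (neg_inv_im hτ) (4 * (2 * Real.pi * ‖a‖ / ‖τ‖)))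
        have e : Real.pi * Complex.I * (-1 / τ) * qi C w / p =
          -Real.pi * Complex.I / τ * qi C w / p := by ring
        rw [e]
        refine mul_le_mul_of_nonneg_left (Real.exp_le_exp.mpr ?_) (norm_nonneg _)
        have h1 : ‖-2 * Real.pi * Complex.I * lin a w / τ‖ = 2 * Real.pi * ‖lin a w‖ / ‖τ‖ := by
          simp [abs_of_pos Real.pi_pos]
        rw [h1, mul_assoc 4]
        have := norm_lin_le a w
        have hpp := Real.pi_pos
        calc 4 * (2 * Real.pi * ‖lin a w‖ / ‖τ‖) ≤
              4 * (2 * Real.pi * (‖a‖ * ∑ i, |(w i : ℝ)|) / ‖τ‖) := by gcongr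
          _ = _ := by ring
      refine h0.comp_injective (i := fun v => γ + B *ᵥ v) fun v w h => ?_
      exact H.mulVec_B_injective (add_left_cancel h)
    have key := tsum_mul_sq_eq s1 s2 (fun s => H.inversion_param ha γ hτ s)
    have c0 : (-2 * (Real.pi : ℂ) * Complex.I) ^ 2 ≠ 0 := by simp
    refine mul_left_cancel₀ c0 ?_
    rw [← tsum_mul_left, mul_left_comm, ← tsum_mul_left]
    rw [div_mul_eq_div_div, div_mul_eq_mul_div _ (τ ^ 2), mul_div_assoc, ← tsum_div_const]
    convert key using 1
    · exact tsum_congr fun w => by ring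
    · congr 1
      exact tsum_congr fun w => by field_simp

end IsLevel

/-- Theta series of the lattice with Gram matrix `B`, weighted by a power of a linear form. -/
noncomputable def thF {n : ℕ} (B : Matrix (Fin n) (Fin n) ℤ) (a : Fin n → ℂ) (k : ℕ) (τ : ℂ) : ℂ :=
  ∑' v : Fin n → ℤ, lin a (B *ᵥ v) ^ k * Complex.exp (Real.pi * Complex.I * τ * qi B v)

/-- Theta series of the dual lattice, where `C` is the Gram matrix of the dual rescaled by `p`. -/
noncomputable def thG (p : ℕ) {n : ℕ} (C : Matrix (Fin n) (Fin n) ℤ) (a : Fin n → ℂ) (k : ℕ)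
    (τ : ℂ) : ℂ :=
  ∑' w : Fin n → ℤ, lin a w ^ k * Complex.exp (Real.pi * Complex.I * τ * qi C w / p)

/-- The character `z ↦ exp (π i z / p)`. -/
noncomputable def ph (p : ℕ) (z : ℤ) : ℂ := Complex.exp (Real.pi * Complex.I * z / p)

theorem ph_add (p : ℕ) (x y : ℤ) : ph p (x + y) = ph p x * ph p y := by
  rw [ph, ph, ph, ← Complex.exp_add]
  congr 1
  push_cast
  ring

theorem ph_period {p : ℕ} (hp : p ≠ 0) (z : ℤ) : ph p (2 * p * z) = 1 := by
  have hpc : (p : ℂ) ≠ 0 := by exact_mod_cast hp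
  rw [ph]
  have : (Real.pi : ℂ) * Complex.I * ((2 * p * z : ℤ) : ℂ) / p = z * (2 * Real.pi * Complex.I) := by
    push_cast
    field_simp
  rw [this, Complex.exp_int_mul_two_pi_mul_I]

theorem ph_congr {p : ℕ} (hp : p ≠ 0) {x y : ℤ} (h : (2 * p : ℤ) ∣ x - y) : ph p x = ph p y := by
  obtain ⟨z, hz⟩ := h
  rw [show x = y + 2 * p * z by linarith, ph_add, ph_period hp, mul_one]

theorem norm_ph (p : ℕ) (z : ℤ) : ‖ph p z‖ = 1 := by
  rw [ph, show (Real.pi : ℂ) * Complex.I * z / p = ((Real.pi * z / p : ℝ) : ℂ) * Complex.I by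
    push_cast; ring, Complex.norm_exp_ofReal_mul_I]

/-- The image of a lattice inside its dual, in coordinates. -/
def imB {n : ℕ} (B : Matrix (Fin n) (Fin n) ℤ) : AddSubgroup (Fin n → ℤ) :=
  (Matrix.mulVecLin B).toAddMonoidHom.range

theorem mem_imB {n : ℕ} {B : Matrix (Fin n) (Fin n) ℤ} {w : Fin n → ℤ} :
    w ∈ imB B ↔ ∃ v, B *ᵥ v = w := Iff.rfl

namespace IsLevel

variable {p m : ℕ} {B C : Matrix (Fin (2 * m)) (Fin (2 * m)) ℤ}

theorem summable_G (H : IsLevel p m B C) (a : Fin (2 * m) → ℂ) (k : ℕ) {τ : ℂ} (hτ : 0 < τ.im) :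
    Summable fun w : Fin (2 * m) → ℤ =>
      lin a w ^ k * Complex.exp (Real.pi * Complex.I * τ * qi C w / p) := by
  refine Summable.of_norm_bounded (H.summable_C_weight hτ (k * ‖a‖)) fun w => ?_
  rw [norm_mul, norm_pow, mul_comm]
  refine mul_le_mul_of_nonneg_left ?_ (norm_nonneg _)
  have h1 := norm_lin_le a w
  have h2 : ‖lin a w‖ ≤ Real.exp ‖lin a w‖ := by linarith [Real.add_one_le_exp ‖lin a w‖]
  calc ‖lin a w‖ ^ k ≤ Real.exp ‖lin a w‖ ^ k := by gcongr
    _ = Real.exp (k * ‖lin a w‖) := by rw [← Real.exp_nat_mul]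
    _ ≤ Real.exp (k * (‖a‖ * ∑ i, |(w i : ℝ)|)) := by gcongr
    _ = _ := by rw [mul_assoc]

theorem thF_add_one (H : IsLevel p m B C) (a : Fin (2 * m) → ℂ) (k : ℕ) (τ : ℂ) :
    thF B a k (τ + 1) = thF B a k τ := by
  refine tsum_congr fun v => ?_
  congr 1
  obtain ⟨z, hz⟩ := two_dvd_qi H.symmB H.evenB v
  rw [hz]
  have : (Real.pi : ℂ) * Complex.I * (τ + 1) * ((2 * z : ℤ) : ℂ) =
    Real.pi * Complex.I * τ * ((2 * z : ℤ) : ℂ) + z * (2 * Real.pi * Complex.I) := by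
    push_cast; ring
  rw [this, Complex.exp_add, Complex.exp_int_mul_two_pi_mul_I, mul_one]

theorem thG_add_mul (p : ℕ) (C : Matrix (Fin (2 * m)) (Fin (2 * m)) ℤ) (a : Fin (2 * m) → ℂ) (k : ℕ) (τ : ℂ) (j : ℤ) :
    thG p C a k (τ + j) = ∑' w : Fin (2 * m) → ℤ, lin a w ^ k *
      (Complex.exp (Real.pi * Complex.I * τ * qi C w / p) * ph p (j * qi C w)) := by
  refine tsum_congr fun v => ?_
  congr 1
  rw [ph, ← Complex.exp_add]
  congr 1
  push_cast
  ring

theorem thG_add_congr (H : IsLevel p m B C) (a : Fin (2 * m) → ℂ) (k : ℕ) (τ : ℂ) {j l : ℤ}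
    (h : (p : ℤ) ∣ j - l) : thG p C a k (τ + j) = thG p C a k (τ + l) := by
  rw [thG_add_mul, thG_add_mul]
  refine tsum_congr fun v => ?_
  congr 2
  apply ph_congr H.p_pos.ne'
  rw [← sub_mul, mul_comm (2 : ℤ)]
  exact mul_dvd_mul h (two_dvd_qi H.symmC H.evenC v)

theorem thF_inv (H : IsLevel p m B C) {a : Fin (2 * m) → ℂ} (ha : Isotropic B a)
    {k : ℕ} (hk : k = 0 ∨ k = 2) {τ : ℂ} (hτ : 0 < τ.im) :
    thF B a k (-1 / τ) = ((-Complex.I) ^ m / rootDet p m) * τ ^ (m + k) * thG p C a k τ := by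
  have hτ0 : τ ≠ 0 := by rintro rfl; simp at hτ
  have hK : (rootDet p m : ℂ) ≠ 0 := by exact_mod_cast H.rootDet_pos.ne'
  have hpc := H.pC
  have key := H.inversion ha hk 0 hτ
  have e1 : ∑' w : Fin (2 * m) → ℤ, lin a w ^ k * Complex.exp (Real.pi * Complex.I * τ * qi C w / p
        - 2 * Real.pi * Complex.I * ((0 : Fin (2 * m) → ℤ) ⬝ᵥ C *ᵥ w : ℤ) / p) = thG p C a k τ := by
    refine tsum_congr fun w => ?_
    simp
  have e2 : ∑' v : Fin (2 * m) → ℤ, lin a (0 + B *ᵥ v) ^ k *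
      Complex.exp (-Real.pi * Complex.I / τ * qi C (0 + B *ᵥ v) / p) = thF B a k (-1 / τ) := by
    refine tsum_congr fun w => ?_
    rw [zero_add, H.qi_C_mulVec]
    congr 2
    push_cast
    field_simp
  rw [e1, e2] at key
  rw [key, mul_pow]
  have hI : (-Complex.I) ^ m ≠ 0 := by simp
  field_simp
  ring

theorem finite_quot (H : IsLevel p m B C) : Finite ((Fin (2 * m) → ℤ) ⧸ imB B) := by
  have : NeZero p := ⟨H.p_pos.ne'⟩
  refine Finite.of_surjective
    (fun γ : Fin (2 * m) → Fin p => (QuotientAddGroup.mk (fun i => ((γ i : ℕ) : ℤ)) :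
      (Fin (2 * m) → ℤ) ⧸ imB B)) fun x => ?_
  obtain ⟨w, rfl⟩ := QuotientAddGroup.mk_surjective x
  have hp : (0 : ℤ) < p := by exact_mod_cast H.p_pos
  refine ⟨fun i => ⟨(w i % p).toNat, ?_⟩, ?_⟩
  · have h1 := Int.emod_lt_of_pos (w i) hp
    have h2 := Int.emod_nonneg (w i) hp.ne'
    omega
  · rw [QuotientAddGroup.eq, mem_imB]
    refine ⟨C *ᵥ fun i => w i / p, ?_⟩
    rw [H.mulVec_mulVec]
    funext i
    have h2 := Int.emod_nonneg (w i) hp.ne'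
    have h3 := Int.emod_add_mul_ediv (w i) p
    simp only [Pi.smul_apply, smul_eq_mul, Pi.add_apply, Pi.neg_apply, Int.toNat_of_nonneg h2]
    linarith

theorem out_add_bijective (H : IsLevel p m B C) : Function.Bijective
    fun x : ((Fin (2 * m) → ℤ) ⧸ imB B) × (Fin (2 * m) → ℤ) => x.1.out + B *ᵥ x.2 := by
  constructor
  · rintro ⟨x, v⟩ ⟨y, w⟩ h
    simp only at h
    have hm : ∀ v, B *ᵥ v ∈ imB B := fun v => mem_imB.mpr ⟨v, rfl⟩
    have h1 := congrArg (QuotientAddGroup.mk : _ → (Fin (2 * m) → ℤ) ⧸ imB B) h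
    rw [QuotientAddGroup.mk_add, QuotientAddGroup.mk_add,
      (QuotientAddGroup.eq_zero_iff _).mpr (hm v), (QuotientAddGroup.eq_zero_iff _).mpr (hm w),
      add_zero, add_zero, QuotientAddGroup.out_eq', QuotientAddGroup.out_eq'] at h1
    subst h1
    rw [H.mulVec_B_injective (add_left_cancel h)]
  · intro w
    have : -(QuotientAddGroup.mk w : (Fin (2 * m) → ℤ) ⧸ imB B).out + w ∈ imB B := by
      rw [← QuotientAddGroup.eq, QuotientAddGroup.out_eq']
    obtain ⟨v, hv⟩ := mem_imB.mp this
    exact ⟨⟨QuotientAddGroup.mk w, v⟩, by simp [hv]⟩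

/-- A function on the dual lattice that only depends on classes modulo the lattice. -/
def Periodic (B : Matrix (Fin (2 * m)) (Fin (2 * m)) ℤ) (φ : (Fin (2 * m) → ℤ) → ℂ) : Prop :=
  ∀ w v, φ (w + B *ᵥ v) = φ w

theorem Periodic.out {φ : (Fin (2 * m) → ℤ) → ℂ} (h : Periodic B φ) (w : Fin (2 * m) → ℤ) :
    φ (QuotientAddGroup.mk w : (Fin (2 * m) → ℤ) ⧸ imB B).out = φ w := by
  have : -(QuotientAddGroup.mk w : (Fin (2 * m) → ℤ) ⧸ imB B).out + w ∈ imB B := by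
    rw [← QuotientAddGroup.eq, QuotientAddGroup.out_eq']
  obtain ⟨v, hv⟩ := mem_imB.mp this
  rw [← h _ v, hv]
  simp

/-- The sum of a function over representatives of the discriminant group. -/
noncomputable def discSum (B : Matrix (Fin (2 * m)) (Fin (2 * m)) ℤ)
    (φ : (Fin (2 * m) → ℤ) → ℂ) : ℂ :=
  ∑ᶠ x : (Fin (2 * m) → ℤ) ⧸ imB B, φ x.out

theorem discSum_shift {φ : (Fin (2 * m) → ℤ) → ℂ} (h : Periodic B φ) (w : Fin (2 * m) → ℤ) :
    discSum B (fun u => φ (u + w)) = discSum B φ := by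
  unfold discSum
  rw [← finsum_comp_equiv (Equiv.addRight (QuotientAddGroup.mk w : (Fin (2 * m) → ℤ) ⧸ imB B))
    (f := fun x => φ x.out)]
  refine finsum_congr fun x => ?_
  obtain ⟨u, rfl⟩ := QuotientAddGroup.mk_surjective x
  have hw : Periodic B fun u => φ (u + w) := by
    intro y v
    show φ (y + B *ᵥ v + w) = φ (y + w)
    rw [add_right_comm]
    exact h _ v
  refine (hw.out u).trans ?_
  simp only [Equiv.coe_addRight]
  rw [← QuotientAddGroup.mk_add, h.out]

/-- The Gauss sum of the discriminant form. -/
noncomputable def gs (p : ℕ) (B C : Matrix (Fin (2 * m)) (Fin (2 * m)) ℤ) (j : ℤ) : ℂ :=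
  discSum B fun u => ph p (j * qi C u)

theorem periodic_ph (H : IsLevel p m B C) (j : ℤ) : Periodic B fun u => ph p (j * qi C u) := by
  intro w v
  apply ph_congr H.p_pos.ne'
  rw [H.qi_C_add]
  obtain ⟨z, hz⟩ := two_dvd_qi H.symmB H.evenB v
  rw [hz]
  exact ⟨j * (w ⬝ᵥ v + z), by ring⟩

theorem complete_square (H : IsLevel p m B C) {j j' : ℤ} (hj : (p : ℤ) ∣ j * j' - 1)
    (w : Fin (2 * m) → ℤ) :
    discSum B (fun u => ph p (j * qi C u - 2 * (u ⬝ᵥ C *ᵥ w))) = ph p (-j' * qi C w) * gs p B C j := by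
  rw [gs, ← discSum_shift (H.periodic_ph j) (-j' • w), discSum, discSum, mul_finsum]
  refine finsum_congr fun x => ?_
  rw [← ph_add]
  apply ph_congr H.p_pos.ne'
  obtain ⟨l, hl⟩ := hj
  obtain ⟨z, hz⟩ := two_dvd_qi H.symmC H.evenC w
  rw [qi_add H.symmC, qi_smul, mulVec_smul, dotProduct_smul, smul_eq_mul, hz]
  refine ⟨l * (x.out ⬝ᵥ C *ᵥ w) - l * j' * z, ?_⟩
  linear_combination (2 * (x.out ⬝ᵥ C *ᵥ w) - 2 * j' * z) * hl

theorem thG_inv_add (H : IsLevel p m B C) {a : Fin (2 * m) → ℂ} (ha : Isotropic B a)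
    {k : ℕ} (hk : k = 0 ∨ k = 2) {τ : ℂ} (hτ : 0 < τ.im) {j j' : ℤ} (hj : (p : ℤ) ∣ j * j' - 1) :
    thG p C a k (-1 / τ + j) = ((-Complex.I) ^ m / rootDet p m) * gs p B C j * τ ^ (m + k)
      * thG p C a k (τ - j') := by
  have hτ0 : τ ≠ 0 := by rintro rfl; simp at hτ
  have hK : (rootDet p m : ℂ) ≠ 0 := by exact_mod_cast H.rootDet_pos.ne'
  have hI : (-Complex.I) ^ m ≠ 0 := by simp
  have hpc := H.pC
  have hfin := H.finite_quot
  have hτ' : 0 < (-1 / τ + j).im := by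
    have := neg_inv_im hτ
    simpa using this
  have := Fintype.ofFinite ((Fin (2 * m) → ℤ) ⧸ imB B)
  let E := Equiv.ofBijective _ H.out_add_bijective
  have hS := H.summable_G a k hτ'
  have hS' := E.summable_iff.mpr hS
  rw [thG, ← E.tsum_eq]
  refine (hS'.tsum_prod).trans ?_
  rw [tsum_fintype]
  simp only [Function.comp_apply]
  have key : ∀ x : (Fin (2 * m) → ℤ) ⧸ imB B, ∑' v, lin a (E (x, v)) ^ k *
      Complex.exp (Real.pi * Complex.I * (-1 / τ + j) * qi C (E (x, v)) / p) =
      (((-Complex.I) ^ m / rootDet p m) * τ ^ (m + k)) * ∑' w, lin a w ^ k *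
        Complex.exp (Real.pi * Complex.I * τ * qi C w / p) *
        ph p (j * qi C x.out - 2 * (x.out ⬝ᵥ C *ᵥ w)) := by
    intro x
    have h1 := H.inversion ha hk x.out hτ
    have h2 : ∀ v, lin a (E (x, v)) ^ k *
      Complex.exp (Real.pi * Complex.I * (-1 / τ + j) * qi C (E (x, v)) / p) =
      ph p (j * qi C x.out) * (lin a (x.out + B *ᵥ v) ^ k *
        Complex.exp (-Real.pi * Complex.I / τ * qi C (x.out + B *ᵥ v) / p)) := by
      intro v
      have h4 : ph p (j * qi C (x.out + B *ᵥ v)) = ph p (j * qi C x.out) := H.periodic_ph j x.out v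
      rw [← h4]
      show lin a (x.out + B *ᵥ v) ^ k * Complex.exp (Real.pi * Complex.I * (-1 / τ + j) *
        qi C (x.out + B *ᵥ v) / p) = _
      rw [mul_left_comm, ph, ← Complex.exp_add]
      congr 2
      push_cast
      field_simp
      ring
    rw [tsum_congr h2, tsum_mul_left]
    have h3 : ∑' w, lin a w ^ k * Complex.exp (Real.pi * Complex.I * τ * qi C w / p) *
        ph p (j * qi C x.out - 2 * (x.out ⬝ᵥ C *ᵥ w)) = ph p (j * qi C x.out) *
        ∑' w, lin a w ^ k * Complex.exp (Real.pi * Complex.I * τ * qi C w / p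
        - 2 * Real.pi * Complex.I * (x.out ⬝ᵥ C *ᵥ w : ℤ) / p) := by
      rw [← tsum_mul_left]
      refine tsum_congr fun w => ?_
      rw [mul_assoc, mul_left_comm (ph _ _)]
      congr 1
      rw [ph, ph, ← Complex.exp_add, ← Complex.exp_add]
      congr 1
      push_cast
      ring
    rw [h3, h1, mul_pow]
    field_simp
    ring
  have hsum : ∀ x : (Fin (2 * m) → ℤ) ⧸ imB B, Summable fun w : Fin (2 * m) → ℤ => lin a w ^ k *
        Complex.exp (Real.pi * Complex.I * τ * qi C w / p) *
        ph p (j * qi C x.out - 2 * (x.out ⬝ᵥ C *ᵥ w)) := by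
    intro x
    refine Summable.of_norm_bounded (H.summable_G a k hτ).norm fun w => ?_
    rw [norm_mul, norm_ph, mul_one]
  refine (Finset.sum_congr rfl fun x _ => key x).trans ?_
  rw [← Finset.mul_sum, ← Summable.tsum_finsetSum fun x _ => hsum x]
  have hsub : τ - j' = τ + ((-j' : ℤ) : ℂ) := by push_cast; ring
  rw [hsub, thG_add_mul, mul_right_comm _ (gs p B C j) (τ ^ (m + k)), mul_assoc _ (gs p B C j)]
  congr 1
  rw [← tsum_mul_left]
  refine tsum_congr fun w => ?_
  have := H.complete_square hj w
  rw [discSum, finsum_eq_sum_of_fintype] at this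
  rw [← Finset.mul_sum, this]
  ring

end IsLevel

theorem isotropic_zero {n : ℕ} (B : Matrix (Fin n) (Fin n) ℤ) : Isotropic B 0 := by
  simp [Isotropic]

theorem aeval_root_pow_eq_zero {n : ℕ} (hn : 0 < n) {ζ : ℂ} (hζ : IsPrimitiveRoot ζ n)
    {P : Polynomial ℤ} (hP : Polynomial.aeval ζ P = 0) {j : ℕ} (hj : j.Coprime n) :
    Polynomial.aeval (ζ ^ j) P = 0 := by
  have hint := hζ.isIntegral hn
  have h1 := (minpoly.isIntegrallyClosed_dvd_iff hint P).mp hP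
  rw [hζ.minpoly_eq_pow_coprime hj] at h1
  exact (minpoly.isIntegrallyClosed_dvd_iff (hint.pow j) P).mpr h1

namespace IsLevel

variable {p m : ℕ} {B C : Matrix (Fin (2 * m)) (Fin (2 * m)) ℤ}

theorem qi_C_nonneg (H : IsLevel p m B C) (w : Fin (2 * m) → ℤ) : 0 ≤ qi C w := by
  rcases eq_or_ne w 0 with rfl | h
  · simp [qi]
  · exact (H.qi_C_pos h).le

theorem exists_poly (H : IsLevel p m B C) : ∃ P : Polynomial ℤ, ∀ j : ℕ,
    gs p B C j = Polynomial.aeval (Complex.exp (2 * Real.pi * Complex.I / p) ^ j) P := by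
  have hfin := H.finite_quot
  have := Fintype.ofFinite ((Fin (2 * m) → ℤ) ⧸ imB B)
  refine ⟨∑ x : (Fin (2 * m) → ℤ) ⧸ imB B, Polynomial.X ^ (qi C x.out / 2).toNat, fun j => ?_⟩
  rw [gs, discSum, finsum_eq_sum_of_fintype, map_sum]
  refine Finset.sum_congr rfl fun x _ => ?_
  rw [map_pow, Polynomial.aeval_X, ← pow_mul, ← Complex.exp_nat_mul, ph]
  congr 1
  obtain ⟨z, hz⟩ := two_dvd_qi H.symmC H.evenC x.out
  have h0 := H.qi_C_nonneg x.out
  have hz0 : 0 ≤ z := by omega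
  have h1 : qi C x.out / 2 = z := by omega
  lift z to ℕ using hz0
  rw [h1, hz, Int.toNat_natCast]
  push_cast
  ring

theorem thG_I_ne_zero (H : IsLevel p m B C) : thG p C 0 0 Complex.I ≠ 0 := by
  have hs := H.summable_G 0 0 (τ := Complex.I) (by simp)
  have h1 : ∀ w : Fin (2 * m) → ℤ, lin 0 w ^ 0 *
      Complex.exp (Real.pi * Complex.I * Complex.I * qi C w / p) =
      ((Real.exp (-Real.pi * qi C w / p) : ℝ) : ℂ) := by
    intro w
    rw [pow_zero, one_mul, mul_assoc (Real.pi : ℂ), Complex.I_mul_I]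
    push_cast
    congr 1
    ring
  simp only [h1] at hs
  rw [thG, tsum_congr h1, ← Complex.ofReal_tsum]
  rw [Complex.summable_ofReal] at hs
  exact_mod_cast (hs.tsum_pos (fun i => (Real.exp_pos _).le) 0 (Real.exp_pos _)).ne'

theorem kappa_mul_gs_one (H : IsLevel p m B C) :
    ((-Complex.I) ^ m / rootDet p m) * gs p B C 1 = 1 := by
  have hK : (rootDet p m : ℂ) ≠ 0 := by exact_mod_cast H.rootDet_pos.ne'
  have hκ : (-Complex.I) ^ m / rootDet p m ≠ 0 := div_ne_zero (by simp) hK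
  set τ : ℂ := Complex.I + 1 with hτ
  have hτi : 0 < τ.im := by simp [hτ]
  have hτ0 : τ ≠ 0 := by intro h; rw [h] at hτi; simp at hτi
  have hI : (0 : ℝ) < Complex.I.im := by simp
  set σ : ℂ := -1 / τ + 1 with hσ
  have hσi : 0 < σ.im := by
    have := neg_inv_im hτi
    simpa [hσ] using this
  have hσe : σ = Complex.I / τ := by
    rw [hσ]; field_simp; rw [hτ]; ring
  have hσ0 : σ ≠ 0 := by intro h; rw [h] at hσi; simp at hσi
  have iso := isotropic_zero B
  have h1 := H.thG_inv_add iso (Or.inl rfl) hτi (j := 1) (j' := 1) (by simp)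
  have h2 := H.thF_inv iso (Or.inl rfl) hσi
  have h3 := H.thF_inv iso (Or.inl rfl) hI
  have h4 : -1 / Complex.I = -1 / σ + 1 := by
    rw [hσe]; field_simp; rw [hτ]; ring
  rw [h4, H.thF_add_one, h2] at h3
  rw [Int.cast_one, ← hσ, show τ - 1 = Complex.I by rw [hτ]; ring, add_zero] at h1
  rw [h1, add_zero, hσe, div_pow] at h3
  have hne := H.thG_I_ne_zero
  have hIm : Complex.I ^ m ≠ 0 := by simp
  have hτm : τ ^ m ≠ 0 := pow_ne_zero _ hτ0
  field_simp at h3 ⊢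
  rw [h3]

theorem gs_eq_gs {B' C' : Matrix (Fin (2 * m)) (Fin (2 * m)) ℤ} (H : IsLevel p m B C)
    (H' : IsLevel p m B' C') {j : ℕ} (hj : j.Coprime p) : gs p B C j = gs p B' C' j := by
  obtain ⟨P, hP⟩ := H.exists_poly
  obtain ⟨P', hP'⟩ := H'.exists_poly
  have h1 : gs p B C (1 : ℕ) = gs p B' C' (1 : ℕ) := by
    have hκ : (-Complex.I) ^ m / (rootDet p m : ℂ) ≠ 0 :=
      left_ne_zero_of_mul (H.kappa_mul_gs_one ▸ one_ne_zero)
    exact mul_left_cancel₀ hκ (H.kappa_mul_gs_one.trans H'.kappa_mul_gs_one.symm)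
  rw [hP, hP', pow_one, ← sub_eq_zero, ← map_sub] at h1
  have := aeval_root_pow_eq_zero H.p_pos (Complex.isPrimitiveRoot_exp p H.p_pos.ne') h1 hj
  rwa [map_sub, ← hP, ← hP', sub_eq_zero] at this

theorem gs_eq_of_intCast (H : IsLevel p m B C) {c : ℤ} (hc : gs p B C 1 = c) {j : ℕ}
    (hj : j.Coprime p) : gs p B C j = c := by
  obtain ⟨P, hP⟩ := H.exists_poly
  have h1 : gs p B C (1 : ℕ) = c := hc
  rw [hP, pow_one, ← sub_eq_zero] at h1
  have h2 : Polynomial.aeval (Complex.exp (2 * Real.pi * Complex.I / p)) (P - Polynomial.C c) = 0 := by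
    simpa using h1
  have := aeval_root_pow_eq_zero H.p_pos (Complex.isPrimitiveRoot_exp p H.p_pos.ne') h2 hj
  rw [map_sub, ← hP, sub_eq_zero] at this
  simpa using this

end IsLevel

section levelOne

open UpperHalfPlane ModularForm ModularFormClass MatrixGroups OnePoint Filter Asymptotics
open scoped Manifold

theorem denom_modular_T (z : ℍ) : denom ModularGroup.T z = 1 := by
  rw [ModularGroup.denom_apply]
  simp [ModularGroup.T]

theorem exists_quotient_form {H : ℂ → ℂ} (hol : DifferentiableOn ℂ H {z | 0 < z.im})
    (hT : ∀ τ : ℂ, 0 < τ.im → H (τ + 1) = H τ) {K N : ℕ}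
    (hS : ∀ τ : ℂ, 0 < τ.im → H (-1 / τ) = τ ^ K * H τ)
    {A : ℝ} (hA : ∀ τ : ℂ, 1 ≤ τ.im → ‖H τ‖ ≤ A * Real.exp (-2 * Real.pi * N * τ.im)) :
    ∃ f : ModularForm 𝒮ℒ ((K : ℤ) - 12 * N), ∀ z : ℍ, f z = H z / discriminant z ^ N := by
  set φ : ℍ → ℂ := fun z => H z / discriminant z ^ N with hφ
  have hdS : ∀ z : ℍ, discriminant (ModularGroup.S • z) = (z : ℂ) ^ 12 * discriminant z := by
    intro z
    have h := congrFun discriminant_S_invariant z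
    rw [SL_slash_apply, ModularGroup.denom_S] at h
    have hz : (z : ℂ) ≠ 0 := z.ne_zero
    rw [← h, mul_left_comm, _root_.zpow_neg, show ((12 : ℤ)) = ((12 : ℕ) : ℤ) from rfl, zpow_natCast,
      mul_inv_cancel₀ (pow_ne_zero _ hz), mul_one]
  have hdT : ∀ z : ℍ, discriminant (ModularGroup.T • z) = discriminant z := by
    intro z
    have h := congrFun discriminant_T_invariant z
    rw [SL_slash_apply, denom_modular_T, _root_.one_zpow, mul_one] at h
    exact h
  have hinv : ∀ γ : SL(2, ℤ), φ ∣[(K : ℤ) - 12 * N] γ = φ := by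
    apply SlashInvariantForm.slash_action_generators_SL2Z
    · funext z
      have hz : (z : ℂ) ≠ 0 := z.ne_zero
      have hd := discriminant_ne_zero z
      rw [SL_slash_apply, ModularGroup.denom_S, hφ]
      simp only [hdS]
      have : ((ModularGroup.S • z : ℍ) : ℂ) = -1 / z := by
        rw [modular_S_smul]
        simp [neg_div, ← inv_neg]
      have hw : (z : ℂ) ^ (-((K : ℤ) - 12 * N)) = ((z : ℂ) ^ 12) ^ N / (z : ℂ) ^ K := by
        rw [neg_sub, zpow_sub₀ hz, zpow_natCast, ← pow_mul, ← zpow_natCast _ (12 * N), Nat.cast_mul]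
        rfl
      rw [this, hS _ z.im_pos, mul_pow, hw]
      generalize discriminant z = D at hd
      generalize H z = h
      generalize (z : ℂ) = w at hz
      field_simp
    · funext z
      rw [SL_slash_apply, hφ]
      simp only [hdT]
      have : ((ModularGroup.T • z : ℍ) : ℂ) = z + 1 := by
        rw [modular_T_smul, coe_vadd, add_comm]
        simp
      rw [this, hT _ z.im_pos, denom_modular_T, _root_.one_zpow, mul_one]
  refine ⟨{ toFun := φ
            slash_action_eq' := fun _ ⟨γ, hγ⟩ => hγ ▸ hinv γ
            holo' := ?_
            bdd_at_cusps' := ?_ }, fun z => rfl⟩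
  · have h1 : MDiff fun z : ℍ => H z := by
      rw [UpperHalfPlane.mdifferentiable_iff]
      refine hol.congr fun z hz => ?_
      simp [ofComplex_apply_of_im_pos hz]
    exact h1.div (CuspForm.discriminant.holo'.pow N) fun z => pow_ne_zero _ (discriminant_ne_zero z)
  · intro c hc
    rw [Subgroup.IsArithmetic.isCusp_iff_isCusp_SL2Z] at hc
    rw [isBoundedAt_iff_forall_SL2Z hc]
    intro γ _
    rw [hinv γ, IsBoundedAtImInfty, BoundedAtFilter]
    refine (div_isBoundedUnder_of_isBigO ?_).isBigO_one ℝ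
    have h1 : (fun z : ℍ => H z) =O[atImInfty] fun z : ℍ => Real.exp (-2 * Real.pi * z.im) ^ N := by
      refine IsBigO.of_bound A ?_
      filter_upwards [atImInfty_basis.mem_of_mem (i := 1) trivial] with z hz
      refine (hA z hz).trans (le_of_eq ?_)
      rw [← Real.exp_nat_mul, Real.norm_of_nonneg (Real.exp_pos _).le]
      congr 2
      show -2 * Real.pi * N * z.im = _
      ring
    exact h1.trans (exp_isBigO_discriminant.pow N)

theorem levelOne_vanish {H : ℂ → ℂ} (hol : DifferentiableOn ℂ H {z | 0 < z.im})
    (hT : ∀ τ : ℂ, 0 < τ.im → H (τ + 1) = H τ) {K N : ℕ} {c : ℂ}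
    (hS : ∀ τ : ℂ, 0 < τ.im → H (-1 / τ) = c * τ ^ K * H τ)
    {A : ℝ} (hA : ∀ τ : ℂ, 1 ≤ τ.im → ‖H τ‖ ≤ A * Real.exp (-2 * Real.pi * N * τ.im))
    (hK : K < 12 * N ∨ K = 12 * N ∧ ∃ τ : ℂ, 0 < τ.im ∧ H τ = 0) :
    ∀ τ : ℂ, 0 < τ.im → H τ = 0 := by
  by_contra! hne
  obtain ⟨τ, hτ, hH⟩ := hne
  have hτ0 : τ ≠ 0 := by rintro rfl; simp at hτ
  have hτ' := IsLevel.neg_inv_im hτ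
  have hc : c ^ 2 * (-1) ^ K = 1 := by
    have h1 := hS _ hτ'
    rw [show -1 / (-1 / τ) = τ by field_simp, hS _ hτ] at h1
    have h2 : (-1 / τ) ^ K * τ ^ K = (-1) ^ K := by
      rw [← mul_pow]; congr 1; field_simp
    have h3 : H τ = (c ^ 2 * (-1) ^ K) * H τ := by
      rw [← h2]; linear_combination h1
    exact (mul_right_cancel₀ hH (by rw [one_mul]; exact h3)).symm
  have hc4 : c ^ 4 = 1 := by
    have h : ((-1 : ℂ) ^ K) ^ 2 = 1 := by rw [← pow_mul, mul_comm, pow_mul]; simp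
    have h2 := congrArg (fun x => x ^ 2) hc
    simp only [mul_pow, h] at h2
    ring_nf at h2
    exact h2
  obtain ⟨f, hf⟩ := exists_quotient_form (H := fun z => H z ^ 4) (hol.pow 4)
    (fun τ hτ => by simp only [hT τ hτ]) (K := K * 4) (N := N * 4)
    (fun τ hτ => by
      simp only [hS τ hτ, mul_pow, hc4]
      ring) (A := A ^ 4) (fun τ hτ => by
      rw [norm_pow]
      have := hA τ hτ
      calc ‖H τ‖ ^ 4 ≤ (A * Real.exp (-2 * Real.pi * N * τ.im)) ^ 4 := by gcongr
        _ = _ := by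
          rw [mul_pow, ← Real.exp_nat_mul]
          congr 2
          push_cast; ring)
  have hzero : ∀ z : ℍ, f z = 0 → H z = 0 := by
    intro z hz
    rw [hf, div_eq_zero_iff] at hz
    rcases hz with h | h
    · exact pow_eq_zero_iff (by norm_num) |>.mp h
    · exact absurd h (pow_ne_zero _ (discriminant_ne_zero z))
  rcases hK with hlt | ⟨heq, σ, hσ, hHσ⟩
  · have := ModularFormClass.levelOne_neg_weight_eq_zero (k := ((K * 4 : ℕ) : ℤ) - 12 * (N * 4 : ℕ))
      (by push_cast; omega) f
    exact hH (hzero ⟨τ, hτ⟩ (by rw [this]; rfl))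
  · have hw : ((K * 4 : ℕ) : ℤ) - 12 * (N * 4 : ℕ) = 0 := by push_cast; omega
    have hconst : ∃ d, ⇑f = Function.const ℍ d := by
      have key : ∀ (k : ℤ) (g : ModularForm 𝒮ℒ k), k = 0 → ∃ d, ⇑g = Function.const ℍ d := by
        rintro k g rfl
        exact ModularFormClass.levelOne_weight_zero_const g
      exact key _ f hw
    obtain ⟨d, hd⟩ := hconst
    have h1 := hf ⟨σ, hσ⟩
    have h2 : H ((⟨σ, hσ⟩ : ℍ) : ℂ) = 0 := hHσ
    rw [hd, h2] at h1
    have hd0 : d = 0 := by simpa using h1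
    exact hH (hzero ⟨τ, hτ⟩ (by rw [hd, hd0]; rfl))

end levelOne

theorem exists_factor_eq_zero {ι : Type*} (s : Finset ι) {F : ι → ℂ → ℂ}
    (hF : ∀ i ∈ s, DifferentiableOn ℂ (F i) {z | 0 < z.im})
    (h : ∀ τ : ℂ, 0 < τ.im → ∏ i ∈ s, F i τ = 0) :
    ∃ i ∈ s, ∀ τ : ℂ, 0 < τ.im → F i τ = 0 := by
  have hopen : IsOpen {z : ℂ | 0 < z.im} := isOpen_lt continuous_const Complex.continuous_im
  have hconn : IsPreconnected {z : ℂ | 0 < z.im} :=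
    (convex_halfSpace_im_gt 0).isPreconnected
  induction s using Finset.induction_on with
  | empty => simpa using h Complex.I (by simp)
  | insert i s hi ih =>
    have h1 := (hF i (by simp)).analyticOnNhd hopen
    have h2 : DifferentiableOn ℂ (fun τ => ∏ j ∈ s, F j τ) {z | 0 < z.im} :=
      DifferentiableOn.fun_finsetProd fun j hj => hF j (by simp [hj])
    have h3 := h2.analyticOnNhd hopen
    have h4 := h1.eq_zero_or_eq_zero_of_mul_eq_zero h3 (fun z hz => by
      have := h z hz
      rw [Finset.prod_insert hi] at this
      exact this) hconn
    rcases h4 with h4 | h4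
    · exact ⟨i, by simp, h4⟩
    · obtain ⟨j, hj, hj'⟩ := ih (fun j hj => hF j (by simp [hj])) h4
      exact ⟨j, by simp [hj], hj'⟩

/-- The transformation behaviour of the pair of theta series of a lattice of level `p` and its
dual. -/
structure ThetaPair (p k : ℕ) (κ : ℂ) (c : ℕ → ℂ) (f g : ℂ → ℂ) : Prop where
  holf : DifferentiableOn ℂ f {z | 0 < z.im}
  holg : DifferentiableOn ℂ g {z | 0 < z.im}
  perf : ∀ τ : ℂ, f (τ + 1) = f τ
  perg : ∀ (τ : ℂ) (j l : ℤ), (p : ℤ) ∣ j - l → g (τ + j) = g (τ + l)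
  inv : ∀ τ : ℂ, 0 < τ.im → f (-1 / τ) = κ * τ ^ k * g τ
  shift : ∀ τ : ℂ, 0 < τ.im → ∀ (j : ℕ) (j' : ℤ), (p : ℤ) ∣ j * j' - 1 →
    g (-1 / τ + j) = c j * τ ^ k * g (τ - j')

namespace ThetaPair

variable {p k : ℕ} {κ : ℂ} {c : ℕ → ℂ} {f g : ℂ → ℂ}

theorem prod_add_one [NeZero p] (h : ThetaPair p k κ c f g) (τ : ℂ) :
    f (τ + 1) * ∏ x : ZMod p, g (τ + 1 + x.val) = f τ * ∏ x : ZMod p, g (τ + x.val) := by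
  have e := Equiv.prod_comp (Equiv.addRight (1 : ZMod p)) fun x => g (τ + x.val)
  rw [h.perf, ← e]
  congr 1
  refine Finset.prod_congr rfl fun x _ => ?_
  have := h.perg τ (1 + x.val) ((x + 1).val) (by
    rw [← ZMod.intCast_eq_intCast_iff_dvd_sub]
    push_cast
    simp [add_comm])
  push_cast at this
  rw [add_assoc, this]
  rfl

theorem prod_inv [Fact p.Prime] (h : ThetaPair p k κ c f g) : ∃ d : ℂ, ∀ τ : ℂ,
    0 < τ.im → f (-1 / τ) * ∏ x : ZMod p, g (-1 / τ + x.val) =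
      d * τ ^ ((p + 1) * k) * (f τ * ∏ x : ZMod p, g (τ + x.val)) := by
  refine ⟨(-1) ^ k * ∏ x ∈ Finset.univ.erase (0 : ZMod p), c x.val, fun τ hτ => ?_⟩
  have hτ0 : τ ≠ 0 := by rintro rfl; simp at hτ
  have e : ∏ x : ZMod p, g (τ + x.val) = ∏ x : ZMod p, g (τ + (-x⁻¹).val) := by
    let e : ZMod p ≃ ZMod p :=
      ⟨fun x => -x⁻¹, fun x => -x⁻¹, fun x => by simp [inv_neg], fun x => by simp [inv_neg]⟩
    exact (e.prod_comp fun x => g (τ + x.val)).symm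
  have h0 : κ * g (-1 / τ) = (-1) ^ k * τ ^ k * f τ := by
    have h1 := h.inv _ (IsLevel.neg_inv_im hτ)
    rw [show -1 / (-1 / τ) = τ by field_simp, div_pow] at h1
    have h2 : ((-1 : ℂ) ^ k) * (-1) ^ k = 1 := by rw [← mul_pow]; simp
    have h3 : τ ^ k * (τ ^ k)⁻¹ = 1 := mul_inv_cancel₀ (pow_ne_zero _ hτ0)
    rw [h1, div_eq_mul_inv ((-1) ^ k)]
    generalize g (-1 / τ) = G
    linear_combination (-κ * G * (τ ^ k * (τ ^ k)⁻¹)) * h2 - κ * G * h3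
  have hx : ∀ x ∈ Finset.univ.erase (0 : ZMod p), g (-1 / τ + x.val) =
      c x.val * τ ^ k * g (τ + (-x⁻¹).val) := by
    intro x hx
    have hx0 : x ≠ 0 := by simpa using hx
    rw [h.shift τ hτ x.val (x⁻¹.val) (by
      rw [← ZMod.intCast_eq_intCast_iff_dvd_sub]
      push_cast
      simp [hx0])]
    congr 1
    have := h.perg τ (-(x⁻¹.val : ℤ)) ((-x⁻¹).val) (by
      rw [← ZMod.intCast_eq_intCast_iff_dvd_sub]
      push_cast
      simp)
    push_cast at this
    rw [sub_eq_add_neg, Int.cast_natCast, this]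
  rw [e, h.inv τ hτ, ← Finset.mul_prod_erase Finset.univ _ (Finset.mem_univ (0 : ZMod p)),
    ← Finset.mul_prod_erase Finset.univ (fun x : ZMod p => g (τ + (-x⁻¹).val)) (Finset.mem_univ 0),
    Finset.prod_congr rfl hx, Finset.prod_mul_distrib, Finset.prod_mul_distrib, Finset.prod_const,
    Finset.card_erase_of_mem (Finset.mem_univ _), Finset.card_univ, ZMod.card]
  simp only [ZMod.val_zero, Nat.cast_zero, add_zero, _root_.inv_zero, neg_zero]
  have hp : (p + 1) * k = k + k + k * (p - 1) := by
    have := (Fact.out : p.Prime).two_le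
    obtain ⟨q, rfl⟩ : ∃ q, p = q + 1 := ⟨p - 1, by omega⟩
    simp; ring
  rw [hp, pow_add, pow_add, pow_mul]
  linear_combination (τ ^ k * g τ * (∏ x ∈ Finset.univ.erase (0 : ZMod p), c x.val) *
    (τ ^ k) ^ (p - 1) * ∏ x ∈ Finset.univ.erase (0 : ZMod p), g (τ + (-x⁻¹).val)) * h0

theorem eq_zero (hp : p.Prime) (h : ThetaPair p k κ c f g) (hκ : κ ≠ 0) {a b : ℕ} {A : ℝ}
    (hf : ∀ τ : ℂ, 1 ≤ τ.im → ‖f τ‖ ≤ A * Real.exp (-2 * Real.pi * a * τ.im))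
    (hg : ∀ τ : ℂ, 1 ≤ τ.im → ‖g τ‖ ≤ A * Real.exp (-2 * Real.pi * b * τ.im / p))
    (hk : (p + 1) * k < 12 * (a + b) ∨
      (p + 1) * k = 12 * (a + b) ∧ ∃ τ : ℂ, 0 < τ.im ∧ g τ = 0) :
    ∀ τ : ℂ, 0 < τ.im → f τ = 0 ∧ g τ = 0 := by
  have : Fact p.Prime := ⟨hp⟩
  have hpR : (p : ℝ) ≠ 0 := by exact_mod_cast hp.pos.ne'
  have hgx : ∀ x : ZMod p, DifferentiableOn ℂ (fun τ => g (τ + x.val)) {z | 0 < z.im} := by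
    intro x
    refine h.holg.comp (by fun_prop) fun z hz => ?_
    show 0 < (z + x.val : ℂ).im
    rwa [Complex.add_im, Complex.natCast_im, add_zero]
  have hprod : DifferentiableOn ℂ (fun τ => ∏ x : ZMod p, g (τ + x.val)) {z | 0 < z.im} :=
    DifferentiableOn.fun_finsetProd fun x _ => hgx x
  obtain ⟨d, hd⟩ := h.prod_inv
  have hzero := levelOne_vanish (H := fun τ => f τ * ∏ x : ZMod p, g (τ + x.val))
    (h.holf.mul hprod) (fun τ _ => h.prod_add_one τ) (K := (p + 1) * k) (N := a + b) hd
    (A := A * A ^ p) (fun τ hτ => by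
      rw [norm_mul, norm_prod]
      have h1 : ∏ x : ZMod p, ‖g (τ + x.val)‖ ≤
          ∏ x : ZMod p, A * Real.exp (-2 * Real.pi * b * τ.im / p) := by
        refine Finset.prod_le_prod (fun _ _ => norm_nonneg _) fun x _ => ?_
        have him : (τ + x.val).im = τ.im := by rw [Complex.add_im, Complex.natCast_im, add_zero]
        have := hg (τ + x.val) (him ▸ hτ)
        rwa [him] at this
      rw [Finset.prod_const, Finset.card_univ, ZMod.card] at h1
      refine (mul_le_mul (hf τ hτ) h1 (Finset.prod_nonneg fun _ _ => norm_nonneg _)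
        ((norm_nonneg _).trans (hf τ hτ))).trans (le_of_eq ?_)
      rw [mul_pow, ← Real.exp_nat_mul, mul_mul_mul_comm, ← Real.exp_add]
      congr 2
      push_cast
      field_simp
      ring)
    (hk.imp_right fun ⟨h1, τ, hτ, h2⟩ => ⟨h1, τ, hτ, by
      refine mul_eq_zero_of_right _ (Finset.prod_eq_zero (Finset.mem_univ 0) ?_)
      simpa using h2⟩)
  have hfg : (∀ τ : ℂ, 0 < τ.im → f τ = 0) ∨ ∀ τ : ℂ, 0 < τ.im → g τ = 0 := by
    obtain ⟨i, -, hi⟩ := exists_factor_eq_zero (Finset.univ : Finset (Option (ZMod p)))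
      (F := fun o τ => o.elim (f τ) fun x => g (τ + x.val)) (by
        rintro (_ | x) -
        · exact h.holf
        · exact hgx x) (fun τ hτ => by
        rw [Fintype.prod_option]
        exact hzero τ hτ)
    rcases i with _ | x
    · exact Or.inl hi
    · refine Or.inr fun τ hτ => ?_
      have := hi (τ - x.val) (by rwa [Complex.sub_im, Complex.natCast_im, sub_zero])
      simpa using this
  intro τ hτ
  have hτ0 : τ ≠ 0 := by rintro rfl; simp at hτ
  rcases hfg with h1 | h1
  · refine ⟨h1 τ hτ, ?_⟩
    have := h.inv τ hτ
    rw [h1 _ (IsLevel.neg_inv_im hτ)] at this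
    simpa [hκ, hτ0] using this.symm
  · refine ⟨?_, h1 τ hτ⟩
    have := h.inv _ (IsLevel.neg_inv_im hτ)
    rw [show -1 / (-1 / τ) = τ by field_simp, h1 _ (IsLevel.neg_inv_im hτ), mul_zero] at this
    exact this

end ThetaPair

/-- The exponential series with coefficients `A` and exponents `l`. -/
noncomputable def ser {ι : Type*} (A : ι → ℂ) (l : ι → ℝ) (τ : ℂ) : ℂ :=
  ∑' i, A i * Complex.exp (Real.pi * Complex.I * τ * l i)

/-- Convergence of the exponential series on the upper half plane. -/
structure Tame {ι : Type*} (A : ι → ℂ) (l : ι → ℝ) : Prop where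
  nonneg : ∀ i, 0 ≤ l i
  summable : ∀ ε > 0, Summable fun i => ‖A i‖ * Real.exp (-ε * l i)

namespace Tame

variable {ι : Type*} {A A' : ι → ℂ} {l : ι → ℝ}

theorem norm_term (A : ι → ℂ) (l : ι → ℝ) (i : ι) (τ : ℂ) :
    ‖A i * Complex.exp (Real.pi * Complex.I * τ * l i)‖ =
      ‖A i‖ * Real.exp (-(Real.pi * τ.im) * l i) := by
  rw [norm_mul, Complex.norm_exp]
  congr 2
  simp

theorem mono (h : Tame A l) (hA : ∀ i, ‖A' i‖ ≤ ‖A i‖) : Tame A' l :=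
  ⟨h.nonneg, fun ε hε => Summable.of_nonneg_of_le (fun i => by positivity)
    (fun i => mul_le_mul_of_nonneg_right (hA i) (Real.exp_pos _).le) (h.summable ε hε)⟩

theorem summable_term (h : Tame A l) {τ : ℂ} (hτ : 0 < τ.im) :
    Summable fun i => A i * Complex.exp (Real.pi * Complex.I * τ * l i) := by
  refine Summable.of_norm ?_
  simp only [norm_term]
  exact h.summable _ (by positivity)

theorem differentiableOn (h : Tame A l) : DifferentiableOn ℂ (ser A l) {z | 0 < z.im} := by
  intro τ hτ
  have hτ' : 0 < τ.im := hτ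
  have hopen : IsOpen {z : ℂ | τ.im / 2 < z.im} := isOpen_lt continuous_const Complex.continuous_im
  have h1 : DifferentiableOn ℂ (ser A l) {z | τ.im / 2 < z.im} := by
    refine Complex.differentiableOn_tsum_of_summable_norm
      (h.summable (Real.pi * (τ.im / 2)) (by positivity)) (fun i => by fun_prop) hopen
      fun i z hz => ?_
    rw [norm_term]
    have hz' : τ.im / 2 < z.im := hz
    have := h.nonneg i
    refine mul_le_mul_of_nonneg_left (Real.exp_le_exp.mpr ?_) (norm_nonneg _)
    refine mul_le_mul_of_nonneg_right ?_ this
    have := Real.pi_pos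
    nlinarith
  have h2 : τ ∈ {z : ℂ | τ.im / 2 < z.im} := by
    show τ.im / 2 < τ.im
    linarith
  exact ((h1 τ h2).differentiableAt (hopen.mem_nhds h2)).differentiableWithinAt

theorem exists_bound (h : Tame A l) {t : ℝ} (ht : ∀ i, A i ≠ 0 → t ≤ l i) :
    ∃ K : ℝ, 0 ≤ K ∧ ∀ τ : ℂ, 1 ≤ τ.im → ‖ser A l τ‖ ≤ K * Real.exp (-Real.pi * t * τ.im) := by
  refine ⟨(∑' i, ‖A i‖ * Real.exp (-Real.pi * l i)) * Real.exp (Real.pi * t),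
    mul_nonneg (tsum_nonneg fun i => by positivity) (Real.exp_pos _).le, fun τ hτ => ?_⟩
  have hs := (h.summable Real.pi Real.pi_pos)
  rw [mul_assoc, ← Real.exp_add, ← tsum_mul_right]
  refine tsum_of_norm_bounded (hs.mul_right _).hasSum fun i => ?_
  rw [norm_term, mul_assoc, ← Real.exp_add]
  rcases eq_or_ne (A i) 0 with h0 | h0
  · simp [h0]
  · have h1 := ht i h0
    refine mul_le_mul_of_nonneg_left (Real.exp_le_exp.mpr ?_) (norm_nonneg _)
    have h2 : 0 ≤ Real.pi * ((τ.im - 1) * (l i - t)) :=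
      mul_nonneg Real.pi_pos.le (mul_nonneg (by linarith) (by linarith))
    nlinarith

theorem tendsto_leading (h : Tame A l) {t : ℝ} (ht : ∀ i, A i ≠ 0 → t ≤ l i) :
    Filter.Tendsto (fun y : ℝ => Complex.exp (Real.pi * t * y) * ser A l (y * Complex.I))
      Filter.atTop (nhds (∑' i, if l i = t then A i else 0)) := by
  have e : ∀ y : ℝ, Complex.exp (Real.pi * t * y) * ser A l (y * Complex.I) =
      ∑' i, A i * ((Real.exp (-(Real.pi * (l i - t)) * y) : ℝ) : ℂ) := by
    intro y
    rw [ser, ← tsum_mul_left]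
    refine tsum_congr fun i => ?_
    rw [mul_left_comm, ← Complex.exp_add]
    push_cast
    congr 2
    linear_combination (Real.pi * y * l i : ℂ) * Complex.I_mul_I
  simp only [e]
  have hs := (h.summable Real.pi Real.pi_pos).mul_right (Real.exp (Real.pi * t))
  refine tendsto_tsum_of_dominated_convergence hs (fun i => ?_) ?_
  · split_ifs with hi
    · simp [hi]
    · rcases eq_or_ne (A i) 0 with h0 | h0
      · simp [h0]
      · have h1 : t < l i := lt_of_le_of_ne (ht i h0) (Ne.symm hi)
        have h2 : Filter.Tendsto (fun y : ℝ => Real.exp (-(Real.pi * (l i - t)) * y))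
            Filter.atTop (nhds 0) := by
          refine Real.tendsto_exp_atBot.comp ?_
          refine Filter.Tendsto.const_mul_atTop_of_neg ?_ Filter.tendsto_id
          have := mul_pos Real.pi_pos (sub_pos.mpr h1)
          linarith
        have h3 := (Complex.continuous_ofReal.tendsto 0).comp h2
        have h4 := h3.const_mul (A i)
        simpa using h4
  · filter_upwards [Filter.eventually_ge_atTop 1] with y hy i
    rw [norm_mul, Complex.norm_real, Real.norm_of_nonneg (Real.exp_pos _).le, mul_assoc,
      ← Real.exp_add]
    rcases eq_or_ne (A i) 0 with h0 | h0
    · simp [h0]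
    · have h1 := ht i h0
      refine mul_le_mul_of_nonneg_left (Real.exp_le_exp.mpr ?_) (norm_nonneg _)
      have h2 : 0 ≤ Real.pi * ((y - 1) * (l i - t)) :=
        mul_nonneg Real.pi_pos.le (mul_nonneg (by linarith) (by linarith))
      nlinarith

end Tame

namespace IsLevel

variable {p m : ℕ} {B C : Matrix (Fin (2 * m)) (Fin (2 * m)) ℤ}

theorem thF_eq_ser (B : Matrix (Fin (2 * m)) (Fin (2 * m)) ℤ) (a : Fin (2 * m) → ℂ) (k : ℕ) :
    thF B a k = ser (fun v => lin a (B *ᵥ v) ^ k) fun v => (qi B v : ℝ) := by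
  funext τ
  simp [thF, ser]

theorem thG_eq_ser (p : ℕ) (C : Matrix (Fin (2 * m)) (Fin (2 * m)) ℤ) (a : Fin (2 * m) → ℂ)
    (k : ℕ) : thG p C a k = ser (fun w => lin a w ^ k) fun w => (qi C w : ℝ) / p := by
  funext τ
  refine tsum_congr fun w => ?_
  push_cast
  rw [mul_div_assoc]

theorem tame_G (H : IsLevel p m B C) (a : Fin (2 * m) → ℂ) (k : ℕ) :
    Tame (fun w : Fin (2 * m) → ℤ => lin a w ^ k) fun w => (qi C w : ℝ) / p := by
  refine ⟨fun w => div_nonneg (by exact_mod_cast H.qi_C_nonneg w) H.pR.le, fun ε hε => ?_⟩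
  have h1 := (H.summable_G a k (τ := (ε / Real.pi : ℝ) * Complex.I) (by
    simp only [Complex.mul_im, Complex.I_im, Complex.ofReal_re]
    simp; positivity)).norm
  refine h1.congr fun w => ?_
  rw [norm_mul, Complex.norm_exp]
  congr 2
  have hpi : (Real.pi : ℂ) ≠ 0 := by exact_mod_cast Real.pi_ne_zero
  have : (Real.pi : ℂ) * Complex.I * ((ε / Real.pi : ℝ) * Complex.I) * qi C w / p =
      ((-ε * (qi C w / p) : ℝ) : ℂ) := by
    push_cast
    field_simp
    linear_combination ((ε : ℂ) * qi C w / p) * Complex.I_sq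
  rw [this, Complex.ofReal_re]

theorem tame_F (H : IsLevel p m B C) (a : Fin (2 * m) → ℂ) (k : ℕ) :
    Tame (fun v : Fin (2 * m) → ℤ => lin a (B *ᵥ v) ^ k) fun v => (qi B v : ℝ) := by
  have hv : ∀ v, (qi C (B *ᵥ v) : ℝ) / p = qi B v := by
    intro v
    rw [H.qi_C_mulVec]
    push_cast
    have := H.pR
    field_simp
  have hG := H.tame_G a k
  refine ⟨fun v => hv v ▸ hG.nonneg (B *ᵥ v), fun ε hε => ?_⟩
  refine ((hG.summable ε hε).comp_injective H.mulVec_B_injective).congr fun v => ?_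
  simp only [Function.comp_apply, hv]

theorem thetaPair (H : IsLevel p m B C) {a : Fin (2 * m) → ℂ} (ha : Isotropic B a)
    {k : ℕ} (hk : k = 0 ∨ k = 2) :
    ThetaPair p (m + k) ((-Complex.I) ^ m / rootDet p m)
      (fun j => ((-Complex.I) ^ m / rootDet p m) * gs p B C j) (thF B a k) (thG p C a k) where
  holf := by
    rw [thF_eq_ser]
    exact (H.tame_F a k).differentiableOn
  holg := by
    rw [thG_eq_ser]
    exact (H.tame_G a k).differentiableOn
  perf := H.thF_add_one a k
  perg := fun τ _ _ h => H.thG_add_congr a k τ h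
  inv := fun _ hτ => H.thF_inv ha hk hτ
  shift := fun τ hτ j j' hj => by
    have := H.thG_inv_add ha hk hτ (j := j) hj
    rwa [Int.cast_natCast] at this

end IsLevel

/-- The vectors of norm `n` of the quadratic form `C`, provided that there are finitely many. -/
noncomputable def shell {n : ℕ} (C : Matrix (Fin n) (Fin n) ℤ) (t : ℤ) : Finset (Fin n → ℤ) :=
  if h : {w | qi C w = t}.Finite then h.toFinset else ∅

theorem ThetaPair.sub {p k : ℕ} (hp : p.Prime) {κ : ℂ} {c c' : ℕ → ℂ} {f g f' g' : ℂ → ℂ}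
    (h : ThetaPair p k κ c f g) (h' : ThetaPair p k κ c' f' g')
    (hc : ∀ j : ℕ, j.Coprime p → c j = c' j) :
    ThetaPair p k κ c (fun τ => f τ - f' τ) fun τ => g τ - g' τ where
  holf := h.holf.sub h'.holf
  holg := h.holg.sub h'.holg
  perf := fun τ => by rw [h.perf, h'.perf]
  perg := fun τ j l hjl => by rw [h.perg τ j l hjl, h'.perg τ j l hjl]
  inv := fun τ hτ => by rw [h.inv τ hτ, h'.inv τ hτ]; ring
  shift := fun τ hτ j j' hj => by
    have hcop : j.Coprime p := by
      rw [Nat.coprime_comm, hp.coprime_iff_not_dvd]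
      intro hd
      have h1 : (p : ℤ) ∣ j * j' := (Int.natCast_dvd_natCast.mpr hd).mul_right _
      have h2 : (p : ℤ) ∣ 1 := by
        have := dvd_sub h1 hj
        simpa using this
      have h3 := Int.le_of_dvd one_pos h2
      have := hp.two_le
      omega
    rw [h.shift τ hτ j j' hj, h'.shift τ hτ j j' hj, hc j hcop]
    ring

namespace IsLevel

variable {p m : ℕ} {B C B' C' : Matrix (Fin (2 * m)) (Fin (2 * m)) ℤ}

theorem finite_shell_C (H : IsLevel p m B C) (t : ℤ) : {w | qi C w = t}.Finite := by
  have hs := ((H.tame_G 0 0).summable 1 one_pos).tendsto_cofinite_zero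
  have h1 := hs.eventually (gt_mem_nhds (Real.exp_pos (-1 * ((t : ℝ) / p))))
  rw [Filter.eventually_cofinite] at h1
  refine h1.subset fun w hw => ?_
  have hw' : qi C w = t := hw
  simp [hw']

theorem mem_shell_C (H : IsLevel p m B C) {t : ℤ} {w : Fin (2 * m) → ℤ} :
    w ∈ shell C t ↔ qi C w = t := by
  simp [shell, H.finite_shell_C t]

theorem finite_shell_B (H : IsLevel p m B C) (t : ℤ) : {w | qi B w = t}.Finite := by
  refine ((H.finite_shell_C (p * t)).preimage (f := fun v => B *ᵥ v)
    H.mulVec_B_injective.injOn).subset fun v hv => ?_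
  have hv' : qi B v = t := hv
  show qi C (B *ᵥ v) = p * t
  rw [H.qi_C_mulVec, hv']

theorem mem_shell_B (H : IsLevel p m B C) {t : ℤ} {w : Fin (2 * m) → ℤ} :
    w ∈ shell B t ↔ qi B w = t := by
  simp [shell, H.finite_shell_B t]

theorem tsum_shell_C (H : IsLevel p m B C) (A : (Fin (2 * m) → ℤ) → ℂ) (t : ℤ) :
    (∑' w, if (qi C w : ℝ) / p = (t : ℝ) / p then A w else 0) = ∑ w ∈ shell C t, A w := by
  have hp := H.pR.ne'
  have e : ∀ w, ((qi C w : ℝ) / p = (t : ℝ) / p) ↔ w ∈ shell C t := by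
    intro w
    rw [H.mem_shell_C, div_left_inj' hp, Int.cast_inj]
  simp only [e]
  rw [tsum_eq_sum (s := shell C t) fun w hw => by simp [hw]]
  exact Finset.sum_congr rfl fun w hw => by simp [hw]

theorem tsum_shell_B (H : IsLevel p m B C) (A : (Fin (2 * m) → ℤ) → ℂ) (t : ℤ) :
    (∑' w, if (qi B w : ℝ) = (t : ℝ) then A w else 0) = ∑ w ∈ shell B t, A w := by
  simp only [Int.cast_inj, ← H.mem_shell_B]
  rw [tsum_eq_sum (s := shell B t) fun w hw => by simp [hw]]
  exact Finset.sum_congr rfl fun w hw => by simp [hw]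

theorem two_le_qi_C (H : IsLevel p m B C) {w : Fin (2 * m) → ℤ} (hw : w ≠ 0) : 2 ≤ qi C w := by
  have h1 := H.qi_C_pos hw
  obtain ⟨z, hz⟩ := two_dvd_qi H.symmC H.evenC w
  omega

theorem two_div_le (H : IsLevel p m B C) {w : Fin (2 * m) → ℤ} (hw : w ≠ 0) :
    ((2 : ℤ) : ℝ) / p ≤ (qi C w : ℝ) / p :=
  div_le_div_of_nonneg_right (by exact_mod_cast H.two_le_qi_C hw) H.pR.le

theorem kappa_ne_zero (H : IsLevel p m B C) : (-Complex.I) ^ m / (rootDet p m : ℂ) ≠ 0 :=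
  left_ne_zero_of_mul (H.kappa_mul_gs_one ▸ one_ne_zero)

theorem harmonic_sums (H : IsLevel p m B C) {s : ℕ}
    (hmin : ∀ v : Fin (2 * m) → ℤ, v ≠ 0 → (2 * s : ℤ) ≤ qi B v)
    {a : Fin (2 * m) → ℂ} (ha : Isotropic B a)
    (hk : (p + 1) * (m + 2) < 12 * (s + 1) ∨ (p + 1) * (m + 2) = 12 * (s + 1) ∧
      ∃ τ : ℂ, 0 < τ.im ∧ thG p C a 2 τ = 0) :
    ∑ w ∈ shell C 2, lin a w ^ 2 = 0 ∧ ∑ v ∈ shell B (2 * s), lin a (B *ᵥ v) ^ 2 = 0 := by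
  have hlin0 : lin a 0 = 0 := by simp [lin]
  have hF := H.tame_F a 2
  have hG := H.tame_G a 2
  have tF : ∀ v : Fin (2 * m) → ℤ, lin a (B *ᵥ v) ^ 2 ≠ 0 → ((2 * s : ℤ) : ℝ) ≤ qi B v := by
    intro v hv
    have : v ≠ 0 := by rintro rfl; simp [hlin0] at hv
    exact_mod_cast hmin v this
  have tG : ∀ w : Fin (2 * m) → ℤ, lin a w ^ 2 ≠ 0 → ((2 : ℤ) : ℝ) / p ≤ (qi C w : ℝ) / p := by
    intro w hw
    have : w ≠ 0 := by rintro rfl; simp [hlin0] at hw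
    exact H.two_div_le this
  obtain ⟨K1, hK1, b1⟩ := hF.exists_bound tF
  obtain ⟨K2, hK2, b2⟩ := hG.exists_bound tG
  have hzero := (H.thetaPair ha (Or.inr rfl)).eq_zero H.prime H.kappa_ne_zero (a := s) (b := 1)
    (A := K1 + K2) (fun τ hτ => by
      rw [thF_eq_ser]
      refine (b1 τ hτ).trans ?_
      rw [show -Real.pi * ((2 * s : ℤ) : ℝ) * τ.im = -2 * Real.pi * s * τ.im by push_cast; ring]
      gcongr
      linarith) (fun τ hτ => by
      rw [thG_eq_ser]
      refine (b2 τ hτ).trans ?_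
      rw [show -Real.pi * (((2 : ℤ) : ℝ) / p) * τ.im = -2 * Real.pi * (1 : ℕ) * τ.im / p by
        push_cast; ring]
      gcongr
      linarith) hk
  constructor
  · have h1 := hG.tendsto_leading tG
    rw [H.tsum_shell_C] at h1
    refine tendsto_nhds_unique (h1.congr' ?_) tendsto_const_nhds
    filter_upwards [Filter.eventually_gt_atTop 0] with y hy
    rw [← thG_eq_ser, (hzero _ (by simpa using hy)).2, mul_zero]
  · have h1 := hF.tendsto_leading tF
    rw [H.tsum_shell_B] at h1
    refine tendsto_nhds_unique (h1.congr' ?_) tendsto_const_nhds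
    filter_upwards [Filter.eventually_gt_atTop 0] with y hy
    rw [← thF_eq_ser, (hzero _ (by simpa using hy)).1, mul_zero]

theorem exists_zero_thG {B C : Matrix (Fin (2 * 4)) (Fin (2 * 4)) ℤ} (H : IsLevel 5 4 B C) {a : Fin (2 * 4) → ℂ} (ha : Isotropic B a) :
    ∃ τ : ℂ, 0 < τ.im ∧ thG 5 C a 2 τ = 0 := by
  have hI : (0 : ℝ) < Complex.I.im := by simp
  refine ⟨Complex.I + (3 : ℤ), by simp, ?_⟩
  have hK : (rootDet 5 4 : ℂ) = 125 := by
    have : rootDet 5 4 = 125 := by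
      rw [rootDet, Real.sqrt_eq_iff_mul_self_eq_of_pos] <;> norm_num
    rw [this]; norm_num
  have hκ : (-Complex.I) ^ 4 / (rootDet 5 4 : ℂ) = 1 / 125 := by
    rw [hK, neg_pow, Complex.I_pow_four]; norm_num
  have h1 := H.kappa_mul_gs_one
  rw [hκ] at h1
  have h2 : gs 5 B C 1 = ((125 : ℤ) : ℂ) := by push_cast; linear_combination 125 * h1
  have h3 := H.gs_eq_of_intCast h2 (j := 3) (by norm_num)
  have h4 := H.thG_inv_add ha (Or.inr rfl) hI (j := 3) (j' := 2) (by norm_num)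
  have h5 : gs 5 B C 3 = ((125 : ℤ) : ℂ) := h3
  have h6 := H.thG_add_congr a 2 Complex.I (j := 3) (l := -2) (by norm_num)
  rw [hκ, h5, show -1 / Complex.I = Complex.I by rw [div_eq_iff Complex.I_ne_zero]; simp,
    show Complex.I - ((2 : ℤ) : ℂ) = Complex.I + ((-2 : ℤ) : ℂ) by push_cast; ring, ← h6,
    show Complex.I ^ (4 + 2) = -1 by rw [pow_add, Complex.I_pow_four, Complex.I_sq]; ring] at h4
  push_cast at h4 ⊢
  linear_combination (1 / 2 : ℂ) * h4

theorem ser_split {ι : Type*} [DecidableEq ι] {l : ι → ℝ} (h : Tame (fun _ => 1) l) {i₀ : ι} (h0 : l i₀ = 0)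
    {τ : ℂ} (hτ : 0 < τ.im) :
    ser (fun _ => 1) l τ = 1 + ser (fun i => if i = i₀ then 0 else 1) l τ := by
  rw [ser, (h.summable_term hτ).tsum_eq_add_tsum_ite i₀, ser]
  simp [h0]

theorem exists_constant_term (H : IsLevel p m B C) {s : ℕ}
    (hmin : ∀ v : Fin (2 * m) → ℤ, v ≠ 0 → (2 * s : ℤ) ≤ qi B v) (hs : 0 < s) :
    ∃ f g : ℂ → ℂ, ∃ K : ℝ, 0 ≤ K ∧
        (∀ τ : ℂ, 0 < τ.im → thF B 0 0 τ = 1 + f τ ∧ thG p C 0 0 τ = 1 + g τ) ∧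
        (∀ τ : ℂ, 1 ≤ τ.im → ‖f τ‖ ≤ K * Real.exp (-2 * Real.pi * s * τ.im)) ∧
        (∀ τ : ℂ, 1 ≤ τ.im → ‖g τ‖ ≤ K * Real.exp (-2 * Real.pi * (1 : ℕ) * τ.im / p)) ∧
        Filter.Tendsto (fun y : ℝ => Complex.exp (Real.pi * ((2 * s : ℤ) : ℝ) * y) *
          f (y * Complex.I)) Filter.atTop (nhds (shell B (2 * s)).card) ∧
        Filter.Tendsto (fun y : ℝ => Complex.exp (Real.pi * (((2 : ℤ) : ℝ) / p : ℝ) * y) *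
          g (y * Complex.I)) Filter.atTop (nhds (shell C 2).card) := by
  have hF := H.tame_F 0 0
  have hG := H.tame_G 0 0
  simp only [pow_zero] at hF hG
  have hF' : Tame (fun v : Fin (2 * m) → ℤ => if v = 0 then 0 else 1) fun v => (qi B v : ℝ) :=
    hF.mono fun v => by split_ifs <;> simp
  have hG' : Tame (fun v : Fin (2 * m) → ℤ => if v = 0 then 0 else 1)
      fun w => (qi C w : ℝ) / p :=
    hG.mono fun v => by split_ifs <;> simp
  have tF : ∀ v : Fin (2 * m) → ℤ, (if v = 0 then (0 : ℂ) else 1) ≠ 0 →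
      ((2 * s : ℤ) : ℝ) ≤ qi B v := by
    intro v hv
    have : v ≠ 0 := by rintro rfl; simp at hv
    exact_mod_cast hmin v this
  have tG : ∀ w : Fin (2 * m) → ℤ, (if w = 0 then (0 : ℂ) else 1) ≠ 0 →
      ((2 : ℤ) : ℝ) / p ≤ (qi C w : ℝ) / p := by
    intro w hw
    have : w ≠ 0 := by rintro rfl; simp at hw
    exact H.two_div_le this
  obtain ⟨K1, hK1, b1⟩ := hF'.exists_bound tF
  obtain ⟨K2, hK2, b2⟩ := hG'.exists_bound tG
  refine ⟨ser (fun v : Fin (2 * m) → ℤ => if v = 0 then 0 else 1) (fun v => (qi B v : ℝ)),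
    ser (fun v : Fin (2 * m) → ℤ => if v = 0 then 0 else 1) (fun v => (qi C v : ℝ) / p),
    K1 + K2, add_nonneg hK1 hK2, fun τ hτ => ⟨?_, ?_⟩, fun τ hτ => ?_, fun τ hτ => ?_, ?_, ?_⟩
  · rw [thF_eq_ser]
    simp only [pow_zero]
    exact ser_split hF (i₀ := 0) (by simp [qi]) hτ
  · rw [thG_eq_ser]
    simp only [pow_zero]
    exact ser_split hG (i₀ := 0) (by simp [qi]) hτ
  · refine (b1 τ hτ).trans ?_
    rw [show -Real.pi * ((2 * s : ℤ) : ℝ) * τ.im = -2 * Real.pi * s * τ.im by push_cast; ring]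
    gcongr
    linarith
  · refine (b2 τ hτ).trans ?_
    rw [show -Real.pi * (((2 : ℤ) : ℝ) / p) * τ.im = -2 * Real.pi * (1 : ℕ) * τ.im / p by
      push_cast; ring]
    gcongr
    linarith
  · have h1 := hF'.tendsto_leading tF
    rw [H.tsum_shell_B] at h1
    convert h1 using 2
    rw [Finset.card_eq_sum_ones, Nat.cast_sum]
    refine Finset.sum_congr rfl fun v hv => ?_
    rw [H.mem_shell_B] at hv
    have : v ≠ 0 := by rintro rfl; simp [qi] at hv; omega
    simp [this]
  · have h1 := hG'.tendsto_leading tG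
    rw [H.tsum_shell_C] at h1
    convert h1 using 2
    rw [Finset.card_eq_sum_ones, Nat.cast_sum]
    refine Finset.sum_congr rfl fun v hv => ?_
    rw [H.mem_shell_C] at hv
    have : v ≠ 0 := by rintro rfl; simp [qi] at hv
    simp [this]

theorem shell_card_eq (H : IsLevel p m B C) (H' : IsLevel p m B' C') {s : ℕ}
    (hmin : ∀ v : Fin (2 * m) → ℤ, v ≠ 0 → (2 * s : ℤ) ≤ qi B v)
    (hmin' : ∀ v : Fin (2 * m) → ℤ, v ≠ 0 → (2 * s : ℤ) ≤ qi B' v)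
    (hs : 0 < s) (hk : (p + 1) * m < 12 * (s + 1)) :
    (shell C 2).card = (shell C' 2).card ∧
      (shell B (2 * s)).card = (shell B' (2 * s)).card := by
  obtain ⟨f, g, K, hK, e, bf, bg, lf, lg⟩ := H.exists_constant_term hmin hs
  obtain ⟨f', g', K', hK', e', bf', bg', lf', lg'⟩ := H'.exists_constant_term hmin' hs
  have pair := (H.thetaPair (isotropic_zero B) (Or.inl rfl)).sub H.prime
    (H'.thetaPair (isotropic_zero B') (Or.inl rfl)) fun j hj => by
      simp only [H.gs_eq_gs H' hj]
  have hzero := pair.eq_zero H.prime H.kappa_ne_zero (a := s) (b := 1) (A := K + K')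
    (fun τ hτ => by
      rw [(e τ (by linarith)).1, (e' τ (by linarith)).1, add_sub_add_left_eq_sub, add_mul]
      exact (norm_sub_le _ _).trans (add_le_add (bf τ hτ) (bf' τ hτ)))
    (fun τ hτ => by
      rw [(e τ (by linarith)).2, (e' τ (by linarith)).2, add_sub_add_left_eq_sub, add_mul]
      exact (norm_sub_le _ _).trans (add_le_add (bg τ hτ) (bg' τ hτ)))
    (Or.inl hk)
  have hfg : ∀ y : ℝ, 0 < y → f (y * Complex.I) = f' (y * Complex.I) ∧
      g (y * Complex.I) = g' (y * Complex.I) := by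
    intro y hy
    have hy' : 0 < (y * Complex.I).im := by simpa using hy
    have h1 := hzero _ hy'
    rw [(e _ hy').1, (e' _ hy').1, (e _ hy').2, (e' _ hy').2] at h1
    exact ⟨by linear_combination h1.1, by linear_combination h1.2⟩
  constructor
  · have := tendsto_nhds_unique (lg.congr' (by
      filter_upwards [Filter.eventually_gt_atTop 0] with y hy
      rw [(hfg y hy).2])) lg'
    exact_mod_cast this
  · have := tendsto_nhds_unique (lf.congr' (by
      filter_upwards [Filter.eventually_gt_atTop 0] with y hy
      rw [(hfg y hy).1])) lf'
    exact_mod_cast this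

end IsLevel

section Design

variable {n : ℕ}

theorem bilin_comm {R : Type*} [CommRing R] {S : Matrix (Fin n) (Fin n) R} (hS : S.IsSymm)
    (x y : Fin n → R) : x ⬝ᵥ S *ᵥ y = y ⬝ᵥ S *ᵥ x := by
  rw [dotProduct_mulVec, ← mulVec_transpose, hS.eq, dotProduct_comm]

/-- A quadratic form which vanishes on the complex isotropic vectors of a definite form is
proportional to it. -/
theorem proportional_of_isotropic {A S : Matrix (Fin n) (Fin n) ℝ} (hA : A.PosDef)
    (hS : S.IsSymm)
    (h : ∀ x y : Fin n → ℝ, x ⬝ᵥ A *ᵥ y = 0 → x ⬝ᵥ A *ᵥ x = y ⬝ᵥ A *ᵥ y →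
      x ⬝ᵥ S *ᵥ y = 0 ∧ x ⬝ᵥ S *ᵥ x = y ⬝ᵥ S *ᵥ y) :
    ∃ ρ : ℝ, S = ρ • A := by
  have hAs : A.IsSymm := isSymm_of_posDef hA
  have pos : ∀ x : Fin n → ℝ, x ≠ 0 → 0 < x ⬝ᵥ A *ᵥ x := fun x hx => by
    simpa using hA.dotProduct_mulVec_pos hx
  have key : ∃ ρ : ℝ, ∀ y : Fin n → ℝ, y ⬝ᵥ S *ᵥ y = ρ * (y ⬝ᵥ A *ᵥ y) := by
    by_cases hn : ∃ x : Fin n → ℝ, x ≠ 0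
    · obtain ⟨x, hx⟩ := hn
      have hq := pos x hx
      refine ⟨(x ⬝ᵥ S *ᵥ x) / (x ⬝ᵥ A *ᵥ x), fun y => ?_⟩
      set α : ℝ := (x ⬝ᵥ A *ᵥ y) / (x ⬝ᵥ A *ᵥ x) with hα
      obtain ⟨z, hz⟩ : ∃ z : Fin n → ℝ, y = α • x + z := ⟨y - α • x, by abel⟩
      have hxz : x ⬝ᵥ A *ᵥ z = 0 := by
        have e : z = y - α • x := by rw [hz]; abel
        rw [e, mulVec_sub, dotProduct_sub, mulVec_smul, dotProduct_smul, hα, smul_eq_mul,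
          div_mul_cancel₀ _ hq.ne', sub_self]
      have hzx : z ⬝ᵥ A *ᵥ x = 0 := by rw [bilin_comm hAs, hxz]
      have hz0 : 0 ≤ z ⬝ᵥ A *ᵥ z := by
        by_cases h0 : z = 0
        · simp [h0]
        · exact (pos z h0).le
      set t : ℝ := Real.sqrt ((z ⬝ᵥ A *ᵥ z) / (x ⬝ᵥ A *ᵥ x)) with ht
      have ht2 : t ^ 2 * (x ⬝ᵥ A *ᵥ x) = z ⬝ᵥ A *ᵥ z := by
        rw [ht, Real.sq_sqrt (div_nonneg hz0 hq.le), div_mul_cancel₀ _ hq.ne']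
      have hS' := h (t • x) z (by simp [hxz]) (by simp [mulVec_smul, ← ht2]; ring)
      have h1 : t ^ 2 * (x ⬝ᵥ S *ᵥ x) = z ⬝ᵥ S *ᵥ z := by
        rw [← hS'.2]; simp [mulVec_smul]; ring
      have h2 : x ⬝ᵥ S *ᵥ z = 0 := by
        by_cases h0 : z = 0
        · simp [h0]
        · have : t ≠ 0 := by
            intro h3
            have := pos z h0
            rw [← ht2, h3] at this
            simp at this
          have h4 := hS'.1
          rw [smul_dotProduct, smul_eq_mul] at h4
          exact (mul_eq_zero.mp h4).resolve_left this
      have h3 : z ⬝ᵥ S *ᵥ x = 0 := by rw [bilin_comm hS, h2]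
      have eS : y ⬝ᵥ S *ᵥ y = (α ^ 2 + t ^ 2) * (x ⬝ᵥ S *ᵥ x) := by
        rw [hz]
        simp only [mulVec_add, mulVec_smul, dotProduct_add, add_dotProduct, smul_dotProduct,
          dotProduct_smul, smul_eq_mul, h2, h3, ← h1]
        ring
      have eA : y ⬝ᵥ A *ᵥ y = (α ^ 2 + t ^ 2) * (x ⬝ᵥ A *ᵥ x) := by
        rw [hz]
        simp only [mulVec_add, mulVec_smul, dotProduct_add, add_dotProduct, smul_dotProduct,
          dotProduct_smul, smul_eq_mul, hxz, hzx, ← ht2]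
        ring
      rw [eS, eA]
      field_simp
    · push Not at hn
      exact ⟨0, fun y => by simp [hn y]⟩
  obtain ⟨ρ, hρ⟩ := key
  refine ⟨ρ, ?_⟩
  have pol : ∀ x y : Fin n → ℝ, x ⬝ᵥ S *ᵥ y = ρ * (x ⬝ᵥ A *ᵥ y) := by
    intro x y
    have h1 := hρ (x + y)
    simp only [mulVec_add, dotProduct_add, add_dotProduct] at h1
    linear_combination (1 / 2 : ℝ) * h1 - (1 / 2 : ℝ) * hρ x - (1 / 2 : ℝ) * hρ y +
      (1 / 2 : ℝ) * bilin_comm hS x y - ρ * (1 / 2 : ℝ) * bilin_comm hAs x y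
  ext i j
  have := pol (Pi.single i 1) (Pi.single j 1)
  simpa using this

end Design

namespace IsLevel

variable {p m : ℕ} {B C : Matrix (Fin (2 * m)) (Fin (2 * m)) ℤ}

/-- A finite set of vectors on which all degree two harmonic polynomials of `B` have average zero
is a design. -/
theorem design (H : IsLevel p m B C) (X : Finset (Fin (2 * m) → ℤ))
    (hX : ∀ a, Isotropic B a → ∑ w ∈ X, lin a w ^ 2 = 0) {ρ : ℤ}
    (hρ : ∑ w ∈ X, qi C w = ρ * (p * (2 * m : ℕ))) (hm : m ≠ 0) (x y : Fin (2 * m) → ℤ) :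
    ∑ w ∈ X, (x ⬝ᵥ w) * (y ⬝ᵥ w) = ρ * (x ⬝ᵥ B *ᵥ y) := by
  set S : Matrix (Fin (2 * m)) (Fin (2 * m)) ℝ :=
    Matrix.of fun i j => ∑ w ∈ X, (w i : ℝ) * w j with hSdef
  set A : Matrix (Fin (2 * m)) (Fin (2 * m)) ℝ := B.map (Int.cast : ℤ → ℝ) with hA
  have hS : S.IsSymm := by
    ext i j
    simp [hSdef, mul_comm]
  have sval : ∀ x y : Fin (2 * m) → ℝ, x ⬝ᵥ S *ᵥ y =
      ∑ w ∈ X, (∑ i, x i * w i) * (∑ i, y i * w i) := by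
    intro x y
    simp only [dotProduct, mulVec, hSdef, of_apply, Finset.mul_sum, Finset.sum_mul]
    rw [Finset.sum_congr rfl fun i _ => Finset.sum_comm, Finset.sum_comm]
    refine Finset.sum_congr rfl fun w _ => ?_
    rw [Finset.sum_comm]
    exact Finset.sum_congr rfl fun i _ => Finset.sum_congr rfl fun j _ => by ring
  have hAs : A.IsSymm := isSymm_of_posDef H.posB
  obtain ⟨σ, hσ⟩ := proportional_of_isotropic (A := A) (S := S) H.posB hS (by
    intro x y hxy hxx
    have hiso : Isotropic B fun i => (x i : ℂ) + y i * Complex.I := by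
      have e : ∀ x y : Fin (2 * m) → ℝ, ((x ⬝ᵥ A *ᵥ y : ℝ) : ℂ) =
          ∑ i, ∑ j, (B i j : ℂ) * x i * y j := by
        intro x y
        simp only [dotProduct, mulVec, hA, Finset.mul_sum, map_apply]
        push_cast
        exact Finset.sum_congr rfl fun i _ => Finset.sum_congr rfl fun j _ => by ring
      have e1 := e x x
      have e2 := e y y
      have e3 := e x y
      have e4 := e y x
      rw [bilin_comm hAs y x] at e4
      rw [hxy] at e3 e4
      rw [hxx] at e1
      rw [Isotropic]
      have : ∀ i j, (B i j : ℂ) * (x i + y i * Complex.I) * (x j + y j * Complex.I) =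
          (B i j : ℂ) * x i * x j + Complex.I * ((B i j : ℂ) * x i * y j) +
          Complex.I * ((B i j : ℂ) * y i * x j) - (B i j : ℂ) * y i * y j := by
        intro i j
        linear_combination (B i j : ℂ) * y i * y j * Complex.I_sq
      simp only [this, Finset.sum_add_distrib, Finset.sum_sub_distrib, ← Finset.mul_sum]
      rw [← e1, ← e2, ← e3, ← e4]
      simp
    have h1 := hX _ hiso
    have e : ∀ w : Fin (2 * m) → ℤ, lin (fun i => (x i : ℂ) + y i * Complex.I) w ^ 2 =
        (((∑ i, x i * w i) * (∑ i, x i * w i) - (∑ i, y i * w i) * (∑ i, y i * w i) : ℝ) : ℂ) +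
        ((2 * ((∑ i, x i * w i) * (∑ i, y i * w i)) : ℝ) : ℂ) * Complex.I := by
      intro w
      have : lin (fun i => (x i : ℂ) + y i * Complex.I) w =
          ((∑ i, x i * w i : ℝ) : ℂ) + ((∑ i, y i * w i : ℝ) : ℂ) * Complex.I := by
        simp only [lin, add_mul, Finset.sum_add_distrib]
        push_cast
        rw [Finset.sum_mul]
        exact congrArg _ (Finset.sum_congr rfl fun i _ => by ring)
      rw [this]
      push_cast
      linear_combination (∑ i, (y i : ℂ) * w i) ^ 2 * Complex.I_sq
    simp only [e, Finset.sum_add_distrib, ← Finset.sum_mul, ← Complex.ofReal_sum] at h1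
    have hre := congrArg Complex.re h1
    have him := congrArg Complex.im h1
    simp only [Complex.add_re, Complex.add_im, Complex.re_ofReal_mul, Complex.im_ofReal_mul,
      Complex.I_re, Complex.I_im, Complex.ofReal_re, Complex.ofReal_im, Complex.zero_re,
      Complex.zero_im, mul_zero, add_zero, mul_one, zero_add, Finset.sum_sub_distrib,
      ← Finset.mul_sum, ← sval] at hre him
    exact ⟨by linarith, by linarith⟩)
  have hBC : A * C.map (Int.cast : ℤ → ℝ) = (p : ℝ) • 1 := by
    have := congrArg (fun M => M.map (Int.castRingHom ℝ)) H.mul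
    simp only [Matrix.map_mul] at this
    rw [show (A * C.map (Int.cast : ℤ → ℝ)) =
      B.map (Int.castRingHom ℝ) * C.map (Int.castRingHom ℝ) from rfl, this]
    ext i j
    simp only [map_apply, Matrix.smul_apply, Matrix.one_apply]
    split_ifs <;> simp
  have htr : ((∑ w ∈ X, qi C w : ℤ) : ℝ) = Matrix.trace (S * C.map (Int.cast : ℤ → ℝ)) := by
    simp only [Matrix.trace, diag_apply, Matrix.mul_apply, hSdef, of_apply, map_apply, qi,
      dotProduct, mulVec, Finset.mul_sum, Finset.sum_mul]
    push_cast
    rw [Finset.sum_comm]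
    refine Finset.sum_congr rfl fun i _ => ?_
    rw [Finset.sum_comm]
    refine Finset.sum_congr rfl fun j _ => Finset.sum_congr rfl fun w _ => ?_
    have : C i j = C j i := H.symmC.apply j i
    rw [this]
    ring
  have hσρ : σ = ρ := by
    rw [hρ, hσ, smul_mul, hBC, trace_smul, trace_smul, trace_one, Fintype.card_fin] at htr
    have hp := H.pR.ne'
    have hm' : ((2 * m : ℕ) : ℝ) ≠ 0 := by positivity
    push_cast at htr hm'
    simp only [smul_eq_mul] at htr
    have h2 : (p : ℝ) * (2 * m) ≠ 0 := mul_ne_zero hp hm'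
    exact (mul_right_cancel₀ h2 (by linarith)).symm
  have := sval (fun i => x i) (fun i => y i)
  rw [hσ, hσρ, smul_mulVec, dotProduct_smul, smul_eq_mul] at this
  have e : ((fun i => (x i : ℝ)) ⬝ᵥ A *ᵥ (fun i => (y i : ℝ))) = ((x ⬝ᵥ B *ᵥ y : ℤ) : ℝ) := by
    simp [dotProduct, mulVec, hA]
  rw [e] at this
  simp only [dotProduct] at this ⊢
  exact_mod_cast this.symm

end IsLevel

section Blocks

variable {V : Type*} [AddCommGroup V] {f : V → V → ℤ} {X : Finset V}

theorem exists_orthogonal_family {V : Type*} {f : V → V → ℤ} {X : Finset V}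
    (hsymm : ∀ x y, f x y = f y x) {D : ℕ} (hD : 0 < D)
    (hcard : ∀ v ∈ X, (X.filter fun u => f v u ≠ 0).card ≤ D) (r : ℕ) (hr : D * r ≤ X.card) :
    ∃ v : Fin r → V, (∀ i, v i ∈ X) ∧ ∀ i j, i ≠ j → f (v i) (v j) = 0 := by
  induction r with
  | zero => exact ⟨fun i => i.elim0, fun i => i.elim0, fun i => i.elim0⟩
  | succ r ih =>
    obtain ⟨v, hv, ho⟩ := ih (le_trans (by gcongr; omega) hr)
    have hex : ∃ u ∈ X, u ∉ Finset.univ.biUnion fun i => X.filter fun u => f (v i) u ≠ 0 := by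
      by_contra! hcon
      have h1 := Finset.card_le_card hcon
      have h2 := Finset.card_biUnion_le_card_mul Finset.univ
        (fun i => X.filter fun u => f (v i) u ≠ 0) D fun i _ => hcard _ (hv i)
      rw [Finset.card_univ, Fintype.card_fin] at h2
      nlinarith
    obtain ⟨u, huX, hu⟩ := hex
    have hu' : ∀ i, f (v i) u = 0 := by
      intro i
      by_contra h
      exact hu (Finset.mem_biUnion.mpr ⟨i, Finset.mem_univ _, Finset.mem_filter.mpr ⟨huX, h⟩⟩)
    refine ⟨Fin.cons u v, ?_, ?_⟩
    · intro i
      refine Fin.cases ?_ (fun i => ?_) i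
      · simpa using huX
      · simpa using hv i
    · intro i j
      refine Fin.cases ?_ (fun i => ?_) i <;> refine Fin.cases ?_ (fun j => ?_) j
      · intro h; exact absurd rfl h
      · intro _; simp [hsymm u, hu']
      · intro _; simp [hu']
      · intro h; simpa using ho i j fun e => h (by rw [e])

/-- A tight set of vectors of norm `p - 1`, closed under negation. -/
structure TightShell (p : ℕ) (f : V → V → ℤ) (X : Finset V) : Prop where
  symm : ∀ x y, f x y = f y x
  neg : ∀ x y, f (-x) y = -f x y
  neg_mem : ∀ x ∈ X, -x ∈ X
  norm : ∀ x ∈ X, f x x = p - 1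
  tight : ∀ x ∈ X, ∀ y ∈ X, ∑ u ∈ X, f x u * f y u = 2 * p * f x y

namespace TightShell

variable {p : ℕ}

theorem neg_right (h : TightShell p f X) (x y : V) : f x (-y) = -f x y := by
  rw [h.symm, h.neg, h.symm]

theorem sum_other (h : TightShell p f X) (hp : 2 ≤ p) {v w : V} (hv : v ∈ X) (hw : w ∈ X)
    (h1 : w ≠ v) (h2 : w ≠ -v) {ε : ℤ} (hε : ε ^ 2 = 1) :
    ∑ u ∈ X \ {v, -v, w, -w}, (f v u + ε * f w u) ^ 2 =
      4 * ((p : ℤ) - 1) - 4 * (f v w) ^ 2 - 4 * ε * (p - 2) * f v w := by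
  have hsub : ({v, -v, w, -w} : Finset V) ⊆ X := by
    intro x hx
    simp only [Finset.mem_insert, Finset.mem_singleton] at hx
    rcases hx with rfl | rfl | rfl | rfl
    exacts [hv, h.neg_mem _ hv, hw, h.neg_mem _ hw]
  have ne : ∀ x ∈ X, x ≠ -x := by
    intro x hx he
    have h3 := h.norm x hx
    have h4 := h.neg x x
    rw [← he] at h4
    have : (2 : ℤ) ≤ p := by exact_mod_cast hp
    linarith
  have nv := h.norm v hv
  have nw := h.norm w hw
  have total : ∑ u ∈ X, (f v u + ε * f w u) ^ 2 =
      4 * p * (p - 1) + 4 * ε * p * f v w := by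
    have e1 := h.tight v hv v hv
    have e2 := h.tight v hv w hw
    have e3 := h.tight w hw w hw
    rw [nv] at e1
    rw [nw] at e3
    have : ∀ u, (f v u + ε * f w u) ^ 2 =
        f v u * f v u + 2 * ε * (f v u * f w u) + f w u * f w u := fun u => by
      linear_combination (f w u) ^ 2 * hε
    simp only [this, Finset.sum_add_distrib, ← Finset.mul_sum]
    rw [e1, e2, e3]
    ring
  have part : ∑ u ∈ ({v, -v, w, -w} : Finset V), (f v u + ε * f w u) ^ 2 =
      2 * ((p : ℤ) - 1 + ε * f v w) ^ 2 + 2 * (f v w + ε * (p - 1)) ^ 2 := by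
    have h3 : w ≠ -v := h2
    have h4 : -v ≠ -w := fun e => h1 (neg_injective e).symm
    have h5 : v ≠ -w := fun e => h2 (by rw [e, neg_neg])
    rw [Finset.sum_insert, Finset.sum_insert, Finset.sum_insert, Finset.sum_singleton]
    · simp only [h.neg_right, nv, nw, h.symm w v]
      ring
    · simpa using ne w hw
    · simp only [Finset.mem_insert, Finset.mem_singleton]
      exact fun e => e.elim (fun e => h2 e.symm) h4
    · simp only [Finset.mem_insert, Finset.mem_singleton]
      exact fun e => e.elim (ne v hv) fun e => e.elim (fun e => h1 e.symm) h5
  have := Finset.sum_sdiff hsub (f := fun u => (f v u + ε * f w u) ^ 2)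
  rw [part, total] at this
  linear_combination this - 2 * (f v w) ^ 2 * hε - 2 * ((p : ℤ) - 1) ^ 2 * hε

theorem sq_le_one (h : TightShell p f X) (hp : 2 ≤ p) {v w : V} (hv : v ∈ X) (hw : w ∈ X)
    (h1 : w ≠ v) (h2 : w ≠ -v) : -1 ≤ f v w ∧ f v w ≤ 1 := by
  have a := h.sum_other hp hv hw h1 h2 (ε := 1) (by norm_num)
  have b := h.sum_other hp hv hw h1 h2 (ε := -1) (by norm_num)
  have a0 : 0 ≤ ∑ u ∈ X \ {v, -v, w, -w}, (f v u + 1 * f w u) ^ 2 :=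
    Finset.sum_nonneg fun u _ => sq_nonneg _
  have b0 : 0 ≤ ∑ u ∈ X \ {v, -v, w, -w}, (f v u + -1 * f w u) ^ 2 :=
    Finset.sum_nonneg fun u _ => sq_nonneg _
  rw [a] at a0
  rw [b] at b0
  have hp' : (2 : ℤ) ≤ p := by exact_mod_cast hp
  constructor
  · by_contra! hc
    nlinarith
  · by_contra! hc
    nlinarith

theorem eq_of_other (h : TightShell p f X) (hp : 2 ≤ p) {v w u : V} (hv : v ∈ X) (hw : w ∈ X)
    (hu : u ∈ X) (h1 : w ≠ v) (h2 : w ≠ -v) (hc : f v w = -1) (h3 : u ≠ v) (h4 : u ≠ -v)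
    (h5 : u ≠ w) (h6 : u ≠ -w) : f w u = f v u := by
  have b := h.sum_other hp hv hw h1 h2 (ε := -1) (by norm_num)
  rw [hc, show 4 * ((p : ℤ) - 1) - 4 * (-1) ^ 2 - 4 * -1 * (p - 2) * -1 = 0 by ring,
    Finset.sum_eq_zero_iff_of_nonneg fun u _ => sq_nonneg _] at b
  have := b u (by simp [hu, h3, h4, h5, h6])
  have := pow_eq_zero_iff two_ne_zero |>.mp this
  linarith

/-- The members of `X` having inner product `-1` with `v`. -/
noncomputable def adj (f : V → V → ℤ) (X : Finset V) (v : V) : Finset V :=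
  X.filter fun u => f v u = -1

theorem mem_adj {V : Type*} {f : V → V → ℤ} {X : Finset V} {v u : V} :
    u ∈ adj f X v ↔ u ∈ X ∧ f v u = -1 := Finset.mem_filter

theorem ne_of_val (h : TightShell p f X) (hp : 3 ≤ p) {v u : V} (hv : v ∈ X)
    (hc : -1 ≤ f v u ∧ f v u ≤ 1) : u ≠ v ∧ u ≠ -v := by
  have hp' : (3 : ℤ) ≤ p := by exact_mod_cast hp
  have nv := h.norm v hv
  constructor
  · rintro rfl
    rw [nv] at hc
    linarith [hc.2]
  · rintro rfl
    rw [h.neg_right, nv] at hc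
    linarith [hc.1]

theorem card_adj_pos (h : TightShell p f X) (v : V) :
    (X.filter fun u => f v u = 1).card = (adj f X v).card := by
  refine Finset.card_bij' (fun u _ => -u) (fun u _ => -u) ?_ ?_ ?_ ?_
  · intro u hu
    rw [Finset.mem_filter] at hu
    exact mem_adj.mpr ⟨h.neg_mem _ hu.1, by rw [h.neg_right, hu.2]⟩
  · intro u hu
    rw [mem_adj] at hu
    exact Finset.mem_filter.mpr ⟨h.neg_mem _ hu.1, by rw [h.neg_right, hu.2, neg_neg]⟩
  · simp
  · simp

theorem card_adj (h : TightShell p f X) (hp : 3 ≤ p) {v : V} (hv : v ∈ X) :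
    (adj f X v).card = p - 1 := by
  have hp' : (3 : ℤ) ≤ p := by exact_mod_cast hp
  have nv := h.norm v hv
  have key : ∀ u ∈ X, f v u * f v u = (((if u = v then ((p : ℤ) - 1) ^ 2 else 0) +
      (if u = -v then ((p : ℤ) - 1) ^ 2 else 0)) + (if f v u = -1 then 1 else 0)) +
      if f v u = 1 then 1 else 0 := by
    intro u hu
    have hne : v ≠ -v := fun e => by
      have := h.neg v v
      rw [← e] at this
      linarith
    by_cases h1 : u = v
    · subst h1
      rw [if_pos rfl, if_neg hne, if_neg (by rw [nv]; linarith), if_neg (by rw [nv]; linarith), nv]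
      ring
    · by_cases h2 : u = -v
      · subst h2
        rw [if_neg h1, if_pos rfl, h.neg_right, nv, if_neg (by linarith), if_neg (by linarith)]
        ring
      · rw [if_neg h1, if_neg h2]
        have := h.sq_le_one (by omega) hv hu h1 h2
        have h3 : f v u = -1 ∨ f v u = 0 ∨ f v u = 1 := by omega
        rcases h3 with h3 | h3 | h3 <;> simp [h3]
  have tot := h.tight v hv v hv
  rw [Finset.sum_congr rfl key] at tot
  simp only [Finset.sum_add_distrib, Finset.sum_ite_eq', hv, h.neg_mem v hv, if_true,
    ← Finset.sum_filter] at tot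
  rw [nv] at tot
  have e1 : ∑ u ∈ X with f v u = -1, (1 : ℤ) = (adj f X v).card := by simp [adj]
  have e2 : ∑ u ∈ X with f v u = 1, (1 : ℤ) = (adj f X v).card := by
    rw [← h.card_adj_pos v]; simp
  rw [e1, e2] at tot
  have : ((adj f X v).card : ℤ) = p - 1 := by nlinarith
  omega

theorem card_nonorth_le (h : TightShell p f X) (hp : 3 ≤ p) {v : V} (hv : v ∈ X) :
    (X.filter fun u => f v u ≠ 0).card ≤ 2 * p := by
  have hsub : (X.filter fun u => f v u ≠ 0) ⊆
      {v, -v} ∪ (adj f X v ∪ X.filter fun u => f v u = 1) := by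
    intro u hu
    rw [Finset.mem_filter] at hu
    simp only [Finset.mem_union, Finset.mem_insert, Finset.mem_singleton, mem_adj,
      Finset.mem_filter]
    by_cases h1 : u = v
    · exact Or.inl (Or.inl h1)
    · by_cases h2 : u = -v
      · exact Or.inl (Or.inr h2)
      · have := h.sq_le_one (by omega) hv hu.1 h1 h2
        have h3 : f v u = -1 ∨ f v u = 1 := by omega
        exact Or.inr (h3.imp (fun h3 => ⟨hu.1, h3⟩) fun h3 => ⟨hu.1, h3⟩)
  refine (Finset.card_le_card hsub).trans ?_
  have h1 := Finset.card_union_le ({v, -v} : Finset V)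
    (adj f X v ∪ X.filter fun u => f v u = 1)
  have h2 := Finset.card_union_le (adj f X v) (X.filter fun u => f v u = 1)
  have h3 : ({v, -v} : Finset V).card ≤ 2 := Finset.card_le_two
  rw [h.card_adj_pos v, h.card_adj hp hv] at h2
  omega

theorem orth_adj (h : TightShell p f X) (hp : 3 ≤ p) {v w u : V} (hv : v ∈ X) (hw : w ∈ X)
    (hu : u ∈ adj f X v) (hvw : f v w = 0) : f u w = 0 := by
  rw [mem_adj] at hu
  obtain ⟨a1, a2⟩ := h.ne_of_val hp hv (u := u) (by rw [hu.2]; norm_num)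
  obtain ⟨b1, b2⟩ := h.ne_of_val hp hv (u := w) (by rw [hvw]; norm_num)
  rw [h.eq_of_other (by omega) hv hu.1 hw a1 a2 hu.2 b1 b2, hvw]
  · rintro rfl
    rw [hu.2] at hvw
    norm_num at hvw
  · rintro rfl
    rw [h.neg_right, hu.2] at hvw
    norm_num at hvw

/-- A tight shell of norm `p - 1` contains an orthogonal sum of root systems of type `A` scaled. -/
theorem exists_blocks (h : TightShell p f X) (hp : 3 ≤ p) {q r : ℕ} (hq : p = q + 1)
    (hr : 2 * p * r ≤ X.card) :
    ∃ x : Fin r → Fin q → V, (∀ i k, x i k ∈ X) ∧ ∀ i k j l, f (x i k) (x j l) =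
      if i = j then (if k = l then (q : ℤ) else -1) else 0 := by
  obtain ⟨v, hv, ho⟩ := exists_orthogonal_family h.symm (D := 2 * p) (by omega)
    (fun v hv => h.card_nonorth_le hp hv) r hr
  have hcard : ∀ i, (adj f X (v i)).card = q := fun i => by
    rw [h.card_adj hp (hv i)]; omega
  set e : ∀ i, adj f X (v i) ≃ Fin q := fun i => Finset.equivFinOfCardEq (hcard i)
  have hmem : ∀ i k, ((e i).symm k : V) ∈ X ∧ f (v i) ((e i).symm k : V) = -1 :=
    fun i k => mem_adj.mp ((e i).symm k).2
  refine ⟨fun i k => (e i).symm k, fun i k => (hmem i k).1, fun i k j l => ?_⟩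
  split_ifs with hij hkl
  · subst hij hkl
    rw [h.norm _ (hmem i k).1, hq]
    push_cast
    ring
  · subst hij
    have hne : ((e i).symm l : V) ≠ (e i).symm k := fun he =>
      hkl ((e i).symm.injective (Subtype.ext he)).symm
    obtain ⟨a1, a2⟩ := h.ne_of_val hp (hv i) (u := (e i).symm k) (by rw [(hmem i k).2]; norm_num)
    obtain ⟨b1, b2⟩ := h.ne_of_val hp (hv i) (u := (e i).symm l) (by rw [(hmem i l).2]; norm_num)
    rw [h.eq_of_other (by omega) (hv i) (hmem i k).1 (hmem i l).1 a1 a2 (hmem i k).2 b1 b2 hne,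
      (hmem i l).2]
    intro he
    have := (hmem i l).2
    rw [he, h.neg_right, (hmem i k).2] at this
    norm_num at this
  · refine h.orth_adj hp (hv i) (hmem j l).1 ((e i).symm k).2 ?_
    rw [h.symm]
    refine h.orth_adj hp (hv j) (hv i) ((e j).symm l).2 ?_
    exact ho j i (Ne.symm hij)

end TightShell

end Blocks

section GlueModel

variable {q r d : ℕ} (e : Fin r × Fin q ≃ Fin d)

/-- The block diagonal matrix with all-one blocks. -/
def onesGram : Matrix (Fin d) (Fin d) ℤ :=
  Matrix.of fun a b => if (e.symm a).1 = (e.symm b).1 then 1 else 0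

/-- The Gram matrix of `√p A_q'` to the power `r`, where `p = q + 1`. -/
def weightGram : Matrix (Fin d) (Fin d) ℤ := ((q : ℤ) + 1) • 1 - onesGram e

/-- The Gram matrix of `A_q` to the power `r`. -/
def rootGram : Matrix (Fin d) (Fin d) ℤ := 1 + onesGram e

theorem onesGram_isSymm : (onesGram e).IsSymm := by
  ext a b
  simp [onesGram, eq_comm]

theorem weightGram_isSymm : (weightGram e).IsSymm :=
  (Matrix.isSymm_one.smul _).sub (onesGram_isSymm e)

theorem sum_blocks {M : Type*} [AddCommMonoid M] (g : Fin d → M) :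
    ∑ a, g a = ∑ i, ∑ k, g (e (i, k)) := by
  rw [← e.sum_comp, Fintype.sum_prod_type]

theorem onesGram_mulVec (t : Fin d → ℤ) (i : Fin r) (k : Fin q) :
    (onesGram e *ᵥ t) (e (i, k)) = ∑ l, t (e (i, l)) := by
  rw [mulVec, dotProduct, sum_blocks e, Finset.sum_eq_single i]
  · simp [onesGram]
  · intro j _ hj
    simp [onesGram, hj.symm]
  · simp

theorem onesGram_mul_self : onesGram e * onesGram e = (q : ℤ) • onesGram e := by
  ext a b
  obtain ⟨⟨i, k⟩, rfl⟩ := e.surjective a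
  have := onesGram_mulVec e (fun c => onesGram e c b) i k
  rw [mulVec, dotProduct] at this
  rw [Matrix.mul_apply, this]
  simp [onesGram]

theorem weightGram_mul_rootGram : weightGram e * rootGram e = ((q : ℤ) + 1) • 1 := by
  simp only [weightGram, rootGram, sub_mul, mul_add, add_mul, Matrix.smul_mul,
    Matrix.one_mul, Matrix.mul_one, onesGram_mul_self, add_smul, one_smul]
  abel

/-- The norm of `√p A_q'`. -/
def blockNorm (t : Fin q → ℤ) : ℤ := (q + 1) * ∑ k, t k ^ 2 - (∑ k, t k) ^ 2

theorem weightGram_bilin (t u : Fin d → ℤ) : t ⬝ᵥ weightGram e *ᵥ u =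
    ∑ i, ((q + 1) * ∑ k, t (e (i, k)) * u (e (i, k)) -
      (∑ k, t (e (i, k))) * ∑ k, u (e (i, k))) := by
  rw [weightGram, sub_mulVec, smul_mulVec, one_mulVec, dotProduct_sub, dotProduct_smul,
    Finset.sum_sub_distrib, ← Finset.mul_sum, dotProduct, dotProduct, sum_blocks e, sum_blocks e,
    smul_eq_mul]
  simp only [onesGram_mulVec, ← Finset.sum_mul]

theorem qi_weightGram (t : Fin d → ℤ) :
    qi (weightGram e) t = ∑ i, blockNorm fun k => t (e (i, k)) := by
  rw [qi, weightGram_bilin]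
  simp only [blockNorm, sq]

theorem det_weightGram (hq : 0 < q) : (weightGram e).det = ((q : ℤ) + 1) ^ ((q - 1) * r) := by
  have hblock : ((((q : ℤ) + 1) • 1 - Matrix.of fun _ _ => 1 : Matrix (Fin q) (Fin q) ℤ)).det =
      ((q : ℤ) + 1) ^ (q - 1) := by
    have hq0 : ((q : ℚ) + 1) ≠ 0 := by positivity
    have h1 : ((((q : ℤ) + 1) • 1 - Matrix.of fun _ _ => 1 :
        Matrix (Fin q) (Fin q) ℤ)).map (Int.castRingHom ℚ) =
        ((q : ℚ) + 1) • (1 + replicateCol Unit (fun _ : Fin q => -((q : ℚ) + 1)⁻¹) *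
          replicateRow Unit (fun _ : Fin q => (1 : ℚ))) := by
      ext i j
      simp only [map_apply, Matrix.sub_apply, Matrix.smul_apply, Matrix.one_apply, of_apply,
        Matrix.add_apply, Matrix.mul_apply, replicateCol_apply, replicateRow_apply]
      split_ifs <;> simp <;> field_simp
      ring
    have h2 := congrArg Matrix.det h1
    rw [det_smul, det_one_add_replicateCol_mul_replicateRow, Fintype.card_fin] at h2
    have h3 := (RingHom.map_det (Int.castRingHom ℚ)
      (((q : ℤ) + 1) • 1 - Matrix.of fun _ _ => 1 : Matrix (Fin q) (Fin q) ℤ))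
    rw [show (Int.castRingHom ℚ).mapMatrix (((q : ℤ) + 1) • 1 - Matrix.of fun _ _ => 1 :
      Matrix (Fin q) (Fin q) ℤ) = (((q : ℤ) + 1) • 1 - Matrix.of fun _ _ => 1 :
        Matrix (Fin q) (Fin q) ℤ).map (Int.castRingHom ℚ) from rfl, h2] at h3
    have h4 : ((q : ℚ) + 1) ^ q * (1 + (fun _ : Fin q => (1 : ℚ)) ⬝ᵥ
        fun _ => -((q : ℚ) + 1)⁻¹) = ((q : ℚ) + 1) ^ (q - 1) := by
      obtain ⟨n, rfl⟩ : ∃ n, q = n + 1 := ⟨q - 1, by omega⟩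
      simp only [dotProduct, Finset.sum_const, Finset.card_univ, Fintype.card_fin, nsmul_eq_mul,
        Nat.add_sub_cancel]
      push_cast at hq0 ⊢
      field_simp
      ring
    rw [h4] at h3
    rw [eq_intCast] at h3
    exact_mod_cast h3
  have hform : weightGram e = (blockDiagonal fun _ : Fin r =>
      (((q : ℤ) + 1) • 1 - Matrix.of fun _ _ => 1 : Matrix (Fin q) (Fin q) ℤ)).submatrix
      (e.symm.trans (Equiv.prodComm _ _)) (e.symm.trans (Equiv.prodComm _ _)) := by
    ext a b
    obtain ⟨⟨i, k⟩, rfl⟩ := e.surjective a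
    obtain ⟨⟨j, l⟩, rfl⟩ := e.surjective b
    simp only [weightGram, onesGram, submatrix_apply, blockDiagonal_apply, Matrix.sub_apply,
      Matrix.smul_apply, Matrix.one_apply, of_apply, Equiv.trans_apply, Equiv.symm_apply_apply,
      Equiv.prodComm_apply, Prod.swap_prod_mk, e.apply_eq_iff_eq, Prod.mk.injEq]
    by_cases hij : i = j <;> simp [hij]
  rw [hform, det_submatrix_equiv_self, det_blockDiagonal, Finset.prod_const, hblock,
    Finset.card_univ, Fintype.card_fin, ← pow_mul]

/-- The vector of `A_q'` to the power `r` with given coordinates in the basis of weights. -/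
def glueVec (t : Fin d → ℤ) : GVec (q + 1) r := fun i =>
  Fin.lastCases (-((∑ k, t (e (i, k)) : ℤ) : ℚ) / (q + 1)) fun k =>
    (t (e (i, k)) : ℚ) - ((∑ k, t (e (i, k)) : ℤ) : ℚ) / (q + 1)

theorem glueVec_castSucc (t : Fin d → ℤ) (i : Fin r) (k : Fin q) : glueVec e t i k.castSucc =
    (t (e (i, k)) : ℚ) - ((∑ k, t (e (i, k)) : ℤ) : ℚ) / (q + 1) := by
  simp [glueVec]

theorem glueVec_last (t : Fin d → ℤ) (i : Fin r) : glueVec e t i (Fin.last q) =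
    -((∑ k, t (e (i, k)) : ℤ) : ℚ) / (q + 1) := by
  simp [glueVec]

theorem exists_glueVec_eq (t : Fin d → ℤ) (i : Fin r) (k : Fin (q + 1)) : ∃ z : ℤ,
    glueVec e t i k = z - ((∑ k, t (e (i, k)) : ℤ) : ℚ) / (q + 1) := by
  refine Fin.lastCases ⟨0, ?_⟩ (fun k => ⟨t (e (i, k)), glueVec_castSucc e t i k⟩) k
  rw [glueVec_last, Int.cast_zero, zero_sub, neg_div]

theorem blN_glueVec (t u : Fin d → ℤ) :
    blN (q + 1) r (glueVec e t) (glueVec e u) = ((t ⬝ᵥ weightGram e *ᵥ u : ℤ) : ℚ) := by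
  have hq0 : ((q : ℚ) + 1) ≠ 0 := by positivity
  rw [weightGram_bilin, blN, Finset.mul_sum, Int.cast_sum]
  refine Finset.sum_congr rfl fun i _ => ?_
  rw [Fin.sum_univ_castSucc]
  simp only [glueVec_castSucc, glueVec_last, sub_mul, mul_sub, Finset.sum_sub_distrib,
    ← Finset.mul_sum, ← Finset.sum_mul, Finset.sum_const, Finset.card_univ, Fintype.card_fin,
    nsmul_eq_mul]
  push_cast
  field_simp
  ring

theorem nrmN_eq_blN (p r : ℕ) (x : GVec p r) : nrmN p r x = blN p r x x := by
  simp only [nrmN, blN, sq]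

theorem nrmN_glueVec (t : Fin d → ℤ) :
    nrmN (q + 1) r (glueVec e t) = (qi (weightGram e) t : ℚ) := by
  rw [nrmN_eq_blN, blN_glueVec, qi]

theorem glueVec_sum {n : ℕ} (T : Matrix (Fin d) (Fin n) ℤ) (c : Fin n → ℤ) :
    glueVec e (T *ᵥ c) = ∑ j, (c j : ℚ) • glueVec e (T.col j) := by
  have hT : ∀ a, (((T *ᵥ c) a : ℤ) : ℚ) = ∑ j, (c j : ℚ) * T a j := fun a => by
    rw [mulVec, dotProduct]
    push_cast
    exact Finset.sum_congr rfl fun j _ => mul_comm _ _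
  have hS : ∀ i, ((∑ k, (T *ᵥ c) (e (i, k)) : ℤ) : ℚ) =
      ∑ j, (c j : ℚ) * ((∑ k, T (e (i, k)) j : ℤ) : ℚ) := fun i => by
    push_cast
    simp only [hT, Finset.mul_sum]
    exact Finset.sum_comm
  funext i k
  simp only [Finset.sum_apply, Pi.smul_apply, smul_eq_mul]
  refine Fin.lastCases ?_ (fun k => ?_) k
  · simp only [glueVec_last, hS, col_apply]
    rw [neg_div, Finset.sum_div, ← Finset.sum_neg_distrib]
    exact Finset.sum_congr rfl fun j _ => by ring
  · simp only [glueVec_castSucc, hS, hT, col_apply]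
    rw [Finset.sum_div, ← Finset.sum_sub_distrib]
    exact Finset.sum_congr rfl fun j _ => by ring

/-- The classes of the components of a glue vector form a word of the glue code. -/
def InCode [NeZero (q + 1)] (t : Fin d → ℤ) : Prop :=
  (fun i => ((∑ k, t (e (i, k)) : ℤ) : ZMod (q + 1))) ∈ glueCode (q + 1) r

theorem clsOf_glueVec [NeZero (q + 1)] (t : Fin d → ℤ) (i : Fin r) :
    clsOf (q + 1) (glueVec e t i) = ((∑ k, t (e (i, k)) : ℤ) : ZMod (q + 1)) := by
  have hq0 : ((q : ℚ) + 1) ≠ 0 := by positivity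
  obtain ⟨z, hz⟩ := exists_glueVec_eq e t i 0
  have : -(((q + 1 : ℕ) : ℚ) * glueVec e t i 0) =
      ((∑ k, t (e (i, k)) - ((q + 1 : ℕ) : ℤ) * z : ℤ) : ℚ) := by
    rw [hz]
    push_cast
    field_simp
    ring
  rw [clsOf, this, Rat.num_intCast]
  push_cast
  have h0 : ((q : ZMod (q + 1)) + 1) = 0 := by exact_mod_cast ZMod.natCast_self (q + 1)
  rw [h0, zero_mul, sub_zero]

theorem memAqDual_glueVec (t : Fin d → ℤ) (i : Fin r) : MemAqDual (q + 1) (glueVec e t i) := by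
  have hq0 : ((q : ℚ) + 1) ≠ 0 := by positivity
  refine ⟨?_, fun k l => ?_, fun k => ?_⟩
  · rw [Fin.sum_univ_castSucc]
    simp only [glueVec_castSucc, glueVec_last, Finset.sum_sub_distrib, Finset.sum_const,
      Finset.card_univ, Fintype.card_fin, nsmul_eq_mul]
    push_cast
    field_simp
    ring
  · obtain ⟨z, hz⟩ := exists_glueVec_eq e t i k
    obtain ⟨y, hy⟩ := exists_glueVec_eq e t i l
    exact ⟨z - y, by rw [hz, hy]; push_cast; ring⟩
  · obtain ⟨z, hz⟩ := exists_glueVec_eq e t i k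
    refine ⟨(q + 1) * z - ∑ k, t (e (i, k)), ?_⟩
    rw [hz]
    push_cast
    field_simp

theorem memGlue_iff [NeZero (q + 1)] (x : GVec (q + 1) r) :
    MemGlue (q + 1) r x ↔ ∃ t, x = glueVec e t ∧ InCode e t := by
  constructor
  · rintro ⟨h1, h2⟩
    choose z hz using fun i (k : Fin q) => (h1 i).2.1 k.castSucc (Fin.last q)
    have hx : x = glueVec e fun a => z (e.symm a).1 (e.symm a).2 := by
      have hq0 : ((q : ℚ) + 1) ≠ 0 := by positivity
      funext i
      have hs := (h1 i).1
      rw [Fin.sum_univ_castSucc] at hs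
      have hS : ((∑ k, z i k : ℤ) : ℚ) = -((q : ℚ) + 1) * x i (Fin.last q) := by
        push_cast
        simp only [hz, Finset.sum_sub_distrib, Finset.sum_const, Finset.card_univ,
          Fintype.card_fin, nsmul_eq_mul]
        linear_combination hs
      have hl : x i (Fin.last q) = -((∑ k, z i k : ℤ) : ℚ) / (q + 1) := by
        rw [hS]
        field_simp
      funext k
      refine Fin.lastCases ?_ (fun k => ?_) k
      · rw [glueVec_last]
        simpa using hl
      · rw [glueVec_castSucc]
        simp only [Equiv.symm_apply_apply]
        rw [hz, sub_eq_add_neg, sub_eq_add_neg, add_assoc, ← neg_div, ← hl]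
        ring
    refine ⟨_, hx, ?_⟩
    rw [hx] at h2
    simpa only [InCode, clsOf_glueVec] using h2
  · rintro ⟨t, rfl, ht⟩
    exact ⟨memAqDual_glueVec e t, by simpa only [InCode, ← clsOf_glueVec] using ht⟩

theorem col_bilin {n : ℕ} (T : Matrix (Fin d) (Fin n) ℤ) (A : Matrix (Fin d) (Fin d) ℤ)
    (i j : Fin n) : T.col i ⬝ᵥ A *ᵥ T.col j = (Tᵀ * A * T) i j := by
  rw [Matrix.mul_assoc, Matrix.mul_apply_eq_vecMul]
  simp [Matrix.mul_apply, dotProduct, mulVec, vecMul]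

/-- A basis of the glue lattice from a basis of the lattice of its coordinates. -/
theorem exists_glue_basis [NeZero (q + 1)] {n : ℕ} {T : Matrix (Fin d) (Fin n) ℤ}
    {B : Matrix (Fin n) (Fin n) ℤ} (hB : Tᵀ * weightGram e * T = B)
    (hT : ∀ t, InCode e t ↔ ∃ c, t = T *ᵥ c) :
    ∃ b : Fin n → GVec (q + 1) r, (∀ i, MemGlue (q + 1) r (b i)) ∧
      (∀ x, MemGlue (q + 1) r x → ∃ c : Fin n → ℤ, x = ∑ i, (c i : ℚ) • b i) ∧
      ∀ i j, blN (q + 1) r (b i) (b j) = (B i j : ℚ) := by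
  refine ⟨fun j => glueVec e (T.col j), fun j => ?_, fun x hx => ?_, fun i j => ?_⟩
  · refine (memGlue_iff e _).mpr ⟨_, rfl, (hT _).mpr ⟨Pi.single j 1, ?_⟩⟩
    simp
  · obtain ⟨t, rfl, ht⟩ := (memGlue_iff e x).mp hx
    obtain ⟨c, rfl⟩ := (hT t).mp ht
    exact ⟨c, glueVec_sum e T c⟩
  · rw [blN_glueVec, col_bilin, hB]

end GlueModel

section BlockCount

variable {q : ℕ}

/-- The norm of the root lattice `A_q`. -/
def rootNorm (t : Fin q → ℤ) : ℤ := ∑ k, t k ^ 2 + (∑ k, t k) ^ 2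

theorem qi_rootGram {r d : ℕ} (e : Fin r × Fin q ≃ Fin d) (t : Fin d → ℤ) :
    qi (rootGram e) t = ∑ i, rootNorm fun k => t (e (i, k)) := by
  rw [qi, rootGram, add_mulVec, one_mulVec, dotProduct_add, dotProduct, dotProduct, sum_blocks e,
    sum_blocks e]
  simp only [onesGram_mulVec, ← Finset.sum_mul, rootNorm, Finset.sum_add_distrib, sq]

theorem blockNorm_lower (t : Fin q → ℤ) (k : Fin q) :
    ((q : ℤ) + 1) * t k ^ 2 ≤ 2 * blockNorm t := by
  have h1 : ∑ l, t l = t k + ∑ l ∈ Finset.univ.erase k, t l :=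
    (Finset.add_sum_erase _ _ (Finset.mem_univ k)).symm
  have h2 : ∑ l, t l ^ 2 = t k ^ 2 + ∑ l ∈ Finset.univ.erase k, t l ^ 2 :=
    (Finset.add_sum_erase _ _ (Finset.mem_univ k)).symm
  have h3 := sq_sum_le_card_mul_sum_sq (s := Finset.univ.erase k) (f := t)
  rw [Finset.card_erase_of_mem (Finset.mem_univ k), Finset.card_univ, Fintype.card_fin] at h3
  have hq : 0 < q := k.pos
  rw [blockNorm, h1, h2]
  set s := ∑ l ∈ Finset.univ.erase k, t l
  set z := ∑ l ∈ Finset.univ.erase k, t l ^ 2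
  have hz : 0 ≤ z := Finset.sum_nonneg fun l _ => sq_nonneg _
  obtain ⟨n, rfl⟩ : ∃ n, q = n + 1 := ⟨q - 1, by omega⟩
  simp only [Nat.add_sub_cancel] at h3
  push_cast
  rcases Nat.eq_zero_or_pos n with rfl | hn
  · have hs : s = 0 := by
      have : s ^ 2 ≤ 0 := by simpa using h3
      exact pow_eq_zero_iff two_ne_zero |>.mp (le_antisymm this (sq_nonneg s))
    rw [hs]
    push_cast
    nlinarith
  · have hn' : (0 : ℤ) < n := by exact_mod_cast hn
    have key : 0 ≤ (n : ℤ) * (2 * (((n : ℤ) + 1 + 1) * (t k ^ 2 + z) - (t k + s) ^ 2) -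
        ((n : ℤ) + 1 + 1) * t k ^ 2) := by
      nlinarith [sq_nonneg ((n : ℤ) * t k - 2 * s)]
    have := nonneg_of_mul_nonneg_right key hn'
    linarith

theorem abs_le_one_of_sq_lt {a : ℤ} (h : a ^ 2 < 4) : -1 ≤ a ∧ a ≤ 1 := by
  constructor <;> nlinarith

theorem blockNorm_small {t : Fin q → ℤ} (h : blockNorm t ≤ q) (k : Fin q) :
    -1 ≤ t k ∧ t k ≤ 1 := by
  refine abs_le_one_of_sq_lt ?_
  have := blockNorm_lower t k
  nlinarith

theorem rootNorm_small {t : Fin q → ℤ} (h : rootNorm t ≤ 2) (k : Fin q) :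
    -1 ≤ t k ∧ t k ≤ 1 := by
  refine abs_le_one_of_sq_lt ?_
  have h1 : t k ^ 2 ≤ ∑ l, t l ^ 2 :=
    Finset.single_le_sum (f := fun l => t l ^ 2) (fun l _ => sq_nonneg _) (Finset.mem_univ k)
  rw [rootNorm] at h
  nlinarith [sq_nonneg (∑ l, t l)]

/-- The vector with entries in `{-1, 0, 1}` encoded by a ternary word. -/
def ternary (u : Fin q → Fin 3) (k : Fin q) : ℤ := (u k : ℤ) - 1

theorem ternary_injective : Function.Injective (ternary (q := q)) := by
  intro u v h
  funext k
  have := congrFun h k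
  simp only [ternary] at this
  exact Fin.ext (by omega)

theorem exists_ternary {t : Fin q → ℤ} (h : ∀ k, -1 ≤ t k ∧ t k ≤ 1) : ∃ u, ternary u = t := by
  refine ⟨fun k => ⟨(t k + 1).toNat, by have := h k; omega⟩, ?_⟩
  funext k
  have := h k
  simp only [ternary]
  omega

/-- The minimal vectors of `g`, together with the minimum. -/
structure MinShell (g : (Fin q → ℤ) → ℤ) (μ : ℤ) (n : ℕ) : Prop where
  zero : g 0 = 0
  pos : 0 < μ
  le : ∀ t, t ≠ 0 → μ ≤ g t
  shell : ∃ S : Finset (Fin q → ℤ), (∀ t, t ∈ S ↔ g t = μ) ∧ S.card = n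

theorem MinShell.of_ternary {g : (Fin q → ℤ) → ℤ} {μ : ℤ} {n : ℕ} (h0 : g 0 = 0) (hμ : 0 < μ)
    (hb : ∀ t, g t ≤ μ → ∀ k, -1 ≤ t k ∧ t k ≤ 1)
    (hmin : ∀ u : Fin q → Fin 3, g (ternary u) < μ → u = fun _ => 1)
    (hcount : (Finset.univ.filter fun u : Fin q → Fin 3 => g (ternary u) = μ).card = n) :
    MinShell g μ n where
  zero := h0
  pos := hμ
  le := by
    intro t ht
    by_contra! hlt
    obtain ⟨u, rfl⟩ := exists_ternary (hb t hlt.le)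
    refine ht ?_
    rw [hmin u hlt]
    funext k
    simp [ternary]
  shell := by
    refine ⟨(Finset.univ.filter fun u : Fin q → Fin 3 => g (ternary u) = μ).image ternary,
      fun t => ?_, ?_⟩
    · simp only [Finset.mem_image, Finset.mem_filter, Finset.mem_univ, true_and]
      constructor
      · rintro ⟨u, hu, rfl⟩
        exact hu
      · intro ht
        obtain ⟨u, rfl⟩ := exists_ternary (hb t ht.le)
        exact ⟨u, ht, rfl⟩
    · rw [Finset.card_image_of_injective _ ternary_injective, ← hcount]

theorem minShell_blockNorm_two : MinShell (blockNorm (q := 2)) 2 6 :=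
  .of_ternary (by decide) (by norm_num) (fun t h => blockNorm_small (by exact_mod_cast h))
    (by decide +kernel) (by decide +kernel)

theorem minShell_blockNorm_four : MinShell (blockNorm (q := 4)) 4 10 :=
  .of_ternary (by decide) (by norm_num) (fun t h => blockNorm_small (by exact_mod_cast h))
    (by decide +kernel) (by decide +kernel)

theorem minShell_blockNorm_six : MinShell (blockNorm (q := 6)) 6 14 :=
  .of_ternary (by decide) (by norm_num) (fun t h => blockNorm_small (by exact_mod_cast h))
    (by decide +kernel) (by decide +kernel)

theorem minShell_rootNorm_one : MinShell (rootNorm (q := 1)) 2 2 :=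
  .of_ternary (by decide) (by norm_num) (fun _ h => rootNorm_small h)
    (by decide +kernel) (by decide +kernel)

theorem minShell_rootNorm_two : MinShell (rootNorm (q := 2)) 2 6 :=
  .of_ternary (by decide) (by norm_num) (fun _ h => rootNorm_small h)
    (by decide +kernel) (by decide +kernel)

namespace MinShell

variable {g : (Fin q → ℤ) → ℤ} {μ : ℤ} {n r d : ℕ}

theorem nonneg (h : MinShell g μ n) (t : Fin q → ℤ) : 0 ≤ g t := by
  by_cases ht : t = 0
  · rw [ht, h.zero]
  · exact h.pos.le.trans (h.le t ht)

/-- The minimal vectors of an orthogonal sum of `r` copies of a lattice. -/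
theorem card_eq (h : MinShell g μ n) (e : Fin r × Fin q ≃ Fin d) {F : Finset (Fin d → ℤ)}
    (hF : ∀ t, t ∈ F ↔ ∑ i, g (fun k => t (e (i, k))) = μ) : F.card = r * n := by
  obtain ⟨S, hS, rfl⟩ := h.shell
  set ι : Fin r × (Fin q → ℤ) → Fin d → ℤ := fun x a =>
    if (e.symm a).1 = x.1 then x.2 (e.symm a).2 else 0 with hι
  have hblock : ∀ x i, (fun k => ι x (e (i, k))) = if i = x.1 then x.2 else 0 := by
    intro x i
    funext k
    by_cases hi : i = x.1 <;> simp [hι, hi]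
  have hne : ∀ t ∈ S, t ≠ 0 := by
    rintro t ht rfl
    rw [hS, h.zero] at ht
    exact h.pos.ne ht
  have himg : F = (Finset.univ ×ˢ S).image ι := by
    ext t
    rw [hF]
    simp only [Finset.mem_image, Finset.mem_product, Finset.mem_univ, true_and, Prod.exists]
    constructor
    · intro ht
      obtain ⟨i, hi⟩ : ∃ i, (fun k => t (e (i, k))) ≠ 0 := by
        by_contra! hcon
        simp only [hcon, h.zero, Finset.sum_const_zero] at ht
        exact h.pos.ne ht
      have hsplit := Finset.add_sum_erase Finset.univ (fun i => g fun k => t (e (i, k)))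
        (Finset.mem_univ i)
      rw [ht] at hsplit
      have hle := h.le _ hi
      have hrest : 0 ≤ ∑ j ∈ Finset.univ.erase i, g fun k => t (e (j, k)) :=
        Finset.sum_nonneg fun j _ => h.nonneg _
      have hrest0 : ∑ j ∈ Finset.univ.erase i, g (fun k => t (e (j, k))) = 0 := by linarith
      have hj : ∀ j, j ≠ i → (fun k => t (e (j, k))) = 0 := by
        intro j hji
        by_contra hj0
        have h1 := (Finset.sum_eq_zero_iff_of_nonneg fun j _ => h.nonneg _).mp hrest0 j
          (by simp [hji])
        have h2 := h.le _ hj0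
        have := h.pos
        linarith
      refine ⟨i, fun k => t (e (i, k)), (hS _).mpr (by linarith), ?_⟩
      funext a
      obtain ⟨⟨j, k⟩, rfl⟩ := e.surjective a
      have := congrFun (hblock (i, fun k => t (e (i, k))) j) k
      simp only at this
      rw [this]
      by_cases hji : j = i
      · simp [hji]
      · rw [if_neg hji]
        exact (congrFun (hj j hji) k).symm
    · rintro ⟨i, s, hs, rfl⟩
      simp only [hblock]
      rw [Finset.sum_eq_single i]
      · rw [if_pos rfl, (hS s).mp hs]
      · intro j _ hj
        rw [if_neg hj, h.zero]
      · simp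
  rw [himg, Finset.card_image_of_injOn, Finset.card_product, Finset.card_univ, Fintype.card_fin]
  rintro ⟨i, s⟩ hx ⟨j, t⟩ hy hxy
  simp only [Finset.coe_product, Set.mem_prod, Finset.mem_coe] at hx hy
  have hii := hblock (i, s) i
  rw [hxy, hblock, if_pos rfl] at hii
  by_cases hij : i = j
  · rw [if_pos hij] at hii
    exact Prod.ext hij hii.symm
  · rw [if_neg hij] at hii
    exact absurd hii.symm (hne s hx.2)

end MinShell

end BlockCount

section RationalPositivity

theorem star_dotProduct_mulVec_ratCast {n : ℕ} (B : Matrix (Fin n) (Fin n) ℤ) (y : Fin n → ℚ) :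
    ((star y ⬝ᵥ B.map (Int.cast : ℤ → ℚ) *ᵥ y : ℚ) : ℝ) =
      star (fun i => (y i : ℝ)) ⬝ᵥ B.map (Int.cast : ℤ → ℝ) *ᵥ fun i => (y i : ℝ) := by
  simp [dotProduct, mulVec]

theorem posSemidef_real_of_rat {n : ℕ} {B : Matrix (Fin n) (Fin n) ℤ}
    (hB : (B.map (Int.cast : ℤ → ℚ)).PosDef) : (B.map (Int.cast : ℤ → ℝ)).PosSemidef := by
  have hherm : (B.map (Int.cast : ℤ → ℝ)).IsHermitian := by
    have h := hB.1
    ext i j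
    have := congrFun (congrFun h i) j
    simp only [conjTranspose_apply, map_apply, star_trivial] at this ⊢
    exact_mod_cast this
  refine Matrix.PosSemidef.of_dotProduct_mulVec_nonneg hherm fun x => ?_
  have hd : DenseRange (fun (y : Fin n → ℚ) i => (y i : ℝ)) :=
    DenseRange.piMap fun _ => Rat.denseRange_cast
  have hc : Continuous fun x : Fin n → ℝ => star x ⬝ᵥ B.map (Int.cast : ℤ → ℝ) *ᵥ x := by
    simp only [dotProduct, mulVec, star_trivial]
    fun_prop
  have hcl : IsClosed {x : Fin n → ℝ | 0 ≤ star x ⬝ᵥ B.map (Int.cast : ℤ → ℝ) *ᵥ x} :=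
    isClosed_le continuous_const hc
  refine hd.induction_on (p := fun x : Fin n → ℝ =>
    0 ≤ star x ⬝ᵥ B.map (Int.cast : ℤ → ℝ) *ᵥ x) x hcl fun y => ?_
  have h := hB.posSemidef.dotProduct_mulVec_nonneg y
  rw [← star_dotProduct_mulVec_ratCast]
  exact Rat.cast_nonneg.mpr h

theorem posDef_real_of_rat {n : ℕ} {B : Matrix (Fin n) (Fin n) ℤ}
    (hB : (B.map (Int.cast : ℤ → ℚ)).PosDef) : (B.map (Int.cast : ℤ → ℝ)).PosDef := by
  refine (posSemidef_real_of_rat hB).posDef_iff_det_ne_zero.mpr ?_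
  have h1 : (B.map (Int.cast : ℤ → ℚ)).det = (B.det : ℚ) :=
    ((Int.castRingHom ℚ).map_det B).symm
  have h2 : (B.map (Int.cast : ℤ → ℝ)).det = (B.det : ℝ) :=
    ((Int.castRingHom ℝ).map_det B).symm
  have h3 : (B.map (Int.cast : ℤ → ℚ)).det ≠ 0 := fun h0 => by
    obtain ⟨v, hv, hv0⟩ := Matrix.exists_mulVec_eq_zero_iff.mpr h0
    have := hB.dotProduct_mulVec_pos hv
    rw [hv0, dotProduct_zero] at this
    exact this.false
  rw [h2]
  rw [h1] at h3
  exact_mod_cast h3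

theorem posDef_rat_of_real {n : ℕ} {B : Matrix (Fin n) (Fin n) ℤ}
    (hB : (B.map (Int.cast : ℤ → ℝ)).PosDef) : (B.map (Int.cast : ℤ → ℚ)).PosDef := by
  have hherm : (B.map (Int.cast : ℤ → ℚ)).IsHermitian := by
    have h := hB.1
    ext i j
    have := congrFun (congrFun h i) j
    simp only [conjTranspose_apply, map_apply, star_trivial] at this ⊢
    exact_mod_cast this
  refine Matrix.PosDef.of_dotProduct_mulVec_pos hherm fun y hy => ?_
  have h := hB.dotProduct_mulVec_pos (x := fun i => (y i : ℝ)) fun h0 => hy <| by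
    funext i
    simpa using congrFun h0 i
  rw [← star_dotProduct_mulVec_ratCast] at h
  exact Rat.cast_pos.mp h

theorem posDef_real_of_qi_pos {n : ℕ} {B : Matrix (Fin n) (Fin n) ℤ} (hs : B.IsSymm)
    (hpos : ∀ v, v ≠ 0 → 0 < qi B v) : (B.map (Int.cast : ℤ → ℝ)).PosDef := by
  refine posDef_real_of_rat ?_
  have hherm : (B.map (Int.cast : ℤ → ℚ)).IsHermitian := by
    ext i j
    simpa using hs.apply i j
  refine Matrix.PosDef.of_dotProduct_mulVec_pos hherm fun y hy => ?_
  set D : ℕ := ∏ i, (y i).den with hD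
  have hD0 : 0 < D := Finset.prod_pos fun i _ => (y i).den_pos
  have hint : ∀ i, ∃ z : ℤ, (z : ℚ) = D * y i := fun i => by
    obtain ⟨k, hk⟩ := Finset.dvd_prod_of_mem (fun i => (y i).den) (Finset.mem_univ i)
    refine ⟨k * (y i).num, ?_⟩
    rw [hD, hk]
    push_cast
    rw [mul_comm ((y i).den : ℚ) k, mul_assoc, Rat.den_mul_eq_num]
  choose z hz using hint
  have hz0 : z ≠ 0 := fun h => hy <| by
    funext i
    have := hz i
    rw [h] at this
    simp only [Pi.zero_apply, Int.cast_zero] at this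
    exact (mul_eq_zero.mp this.symm).resolve_left (by positivity)
  have h1 := hpos z hz0
  have h2 : ((qi B z : ℤ) : ℚ) = D ^ 2 * (star y ⬝ᵥ B.map (Int.cast : ℤ → ℚ) *ᵥ y) := by
    simp only [qi, dotProduct, mulVec, star_trivial, map_apply, Finset.mul_sum]
    push_cast
    simp only [hz]
    refine Finset.sum_congr rfl fun i _ => Finset.sum_congr rfl fun j _ => by ring
  have h3 : (0 : ℚ) < (qi B z : ℤ) := by exact_mod_cast h1
  rw [h2] at h3
  exact pos_of_mul_pos_right h3 (by positivity)

end RationalPositivity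

section GlueLevel

variable {q r m : ℕ} (e : Fin r × Fin q ≃ Fin (2 * m))

theorem blockNorm_nonneg_lower (t : Fin q → ℤ) : ∑ k, t k ^ 2 ≤ blockNorm t := by
  have h := sq_sum_le_card_mul_sum_sq (s := Finset.univ) (f := t)
  rw [Finset.card_univ, Fintype.card_fin] at h
  rw [blockNorm]
  linarith

theorem qi_weightGram_pos {d : ℕ} (e : Fin r × Fin q ≃ Fin d) {t : Fin d → ℤ} (ht : t ≠ 0) :
    0 < qi (weightGram e) t := by
  have h1 : ∑ a, t a ^ 2 ≤ qi (weightGram e) t := by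
    rw [qi_weightGram, sum_blocks e]
    exact Finset.sum_le_sum fun i _ => blockNorm_nonneg_lower _
  obtain ⟨a, ha⟩ := Function.ne_iff.mp ht
  refine lt_of_lt_of_le ?_ h1
  exact Finset.sum_pos' (fun _ _ => sq_nonneg _) ⟨a, Finset.mem_univ a, by
    have : t a ≠ 0 := ha
    positivity⟩

theorem mulVec_injective_of_mul_eq {n : ℕ} {T P : Matrix (Fin n) (Fin n) ℤ} {k : ℤ} (hk : k ≠ 0)
    (h : T * P = k • 1) : Function.Injective T.mulVec := by
  have hdet : T.det ≠ 0 := fun h0 => by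
    have := congrArg Matrix.det h
    rw [det_mul, h0, zero_mul, det_smul, det_one, mul_one] at this
    exact pow_ne_zero _ hk this.symm
  intro x y hxy
  exact sub_eq_zero.mp (eq_zero_of_mulVec_eq_zero hdet (by rw [mulVec_sub, sub_eq_zero]; exact hxy))

theorem mul_comm_of_mul_eq {n : ℕ} {T P : Matrix (Fin n) (Fin n) ℤ} {k : ℤ} (hk : k ≠ 0)
    (h : T * P = k • 1) : P * T = k • 1 := by
  have hinj := mulVec_injective_of_mul_eq hk h
  have h2 : T * (P * T) = T * (k • 1) := by
    rw [← Matrix.mul_assoc, h, Matrix.smul_mul, Matrix.mul_smul, Matrix.one_mul, Matrix.mul_one]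
  ext i j
  have h3 : T *ᵥ ((P * T) *ᵥ Pi.single j 1) = T *ᵥ ((k • 1 : Matrix _ _ ℤ) *ᵥ Pi.single j 1) := by
    rw [mulVec_mulVec, h2, mulVec_mulVec]
  have h4 := congrFun (hinj h3) i
  simpa only [mulVec_single_one, col_apply] using h4

theorem qi_mulVec {n k : ℕ} (A : Matrix (Fin n) (Fin n) ℤ) (T : Matrix (Fin n) (Fin k) ℤ)
    (c : Fin k → ℤ) : qi (Tᵀ * A * T) c = qi A (T *ᵥ c) := by
  rw [qi, qi, ← mulVec_mulVec, ← mulVec_mulVec, mulVec_transpose, dotProduct_comm,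
    ← dotProduct_mulVec, dotProduct_comm]

/-- The lattice with coordinates in the image of `T` has level `p`. -/
theorem isLevel_of_glue (hprime : (q + 1).Prime)
    {T P C B : Matrix (Fin (2 * m)) (Fin (2 * m)) ℤ}
    (hTP : T * P = ((q : ℤ) + 1) • 1) (hB : Tᵀ * weightGram e * T = B)
    (hC : P * rootGram e * Pᵀ = (((q : ℤ) + 1) ^ 2) • C) (hevB : ∀ i, 2 ∣ B i i)
    (hevC : ∀ i, 2 ∣ C i i)
    (hdet : T.det ^ 2 * ((q : ℤ) + 1) ^ ((q - 1) * r) = ((q : ℤ) + 1) ^ (m + 2)) :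
    IsLevel (q + 1) m B C where
  prime := hprime
  symmB := by
    rw [← hB, Matrix.IsSymm, transpose_mul, transpose_mul, transpose_transpose,
      (weightGram_isSymm e), Matrix.mul_assoc]
  evenB := hevB
  posB := by
    refine posDef_real_of_qi_pos ?_ fun v hv => ?_
    · rw [← hB, Matrix.IsSymm, transpose_mul, transpose_mul, transpose_transpose,
        (weightGram_isSymm e), Matrix.mul_assoc]
    · rw [← hB, qi_mulVec]
      refine qi_weightGram_pos e fun h0 => hv ?_
      have hk : ((q : ℤ) + 1) ≠ 0 := by positivity
      exact mulVec_injective_of_mul_eq hk hTP (by rw [h0, mulVec_zero])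
  det := by
    have hq : 0 < q := by have := hprime.two_le; omega
    rw [← hB, det_mul, det_mul, det_transpose, det_weightGram e hq]
    push_cast
    rw [← hdet]
    ring
  mul := by
    have hk : ((q : ℤ) + 1) ≠ 0 := by positivity
    have hPT := mul_comm_of_mul_eq hk hTP
    have h1 : (((q : ℤ) + 1) ^ 2) • (B * C) = (((q : ℤ) + 1) ^ 2) • (((q : ℤ) + 1) • 1) := by
      rw [← Matrix.mul_smul, ← hC, ← hB]
      calc Tᵀ * weightGram e * T * (P * rootGram e * Pᵀ)
          = Tᵀ * weightGram e * (T * P) * rootGram e * Pᵀ := by simp only [Matrix.mul_assoc]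
        _ = ((q : ℤ) + 1) • (Tᵀ * (weightGram e * rootGram e) * Pᵀ) := by
            rw [hTP]
            simp only [Matrix.mul_smul, Matrix.smul_mul, Matrix.mul_one, Matrix.mul_assoc]
        _ = ((q : ℤ) + 1) • ((q : ℤ) + 1) • (P * T)ᵀ := by
            rw [weightGram_mul_rootGram, transpose_mul]
            simp only [Matrix.mul_smul, Matrix.smul_mul, Matrix.mul_one]
        _ = _ := by
            rw [hPT, transpose_smul, transpose_one, smul_smul, ← sq]
    have h2 := smul_right_injective _ (pow_ne_zero 2 hk) h1
    push_cast
    exact h2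
  evenC := hevC

end GlueLevel

section GlueModelStructure

variable {q r m : ℕ}

/-- A Gram matrix `B` of the glue lattice, in the basis given by the columns of `T`, when the
glue lattice has level `p` and minimal norm `2 * s`. -/
structure GlueModel [NeZero (q + 1)] (e : Fin r × Fin q ≃ Fin (2 * m)) (s : ℕ)
    (T B C : Matrix (Fin (2 * m)) (Fin (2 * m)) ℤ) : Prop where
  level : IsLevel (q + 1) m B C
  gram : Tᵀ * weightGram e * T = B
  code : ∀ t, InCode e t ↔ ∃ c, t = T *ᵥ c
  min : ∀ v : Fin (2 * m) → ℤ, v ≠ 0 → (2 * s : ℤ) ≤ qi B v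
  attained : ∃ v : Fin (2 * m) → ℤ, qi B v = 2 * s

theorem exists_smul_of_dvd {n : ℕ} {k : ℤ} {u : Fin n → ℤ} (h : ∀ a, k ∣ u a) :
    ∃ c, u = k • c := by
  choose c hc using h
  exact ⟨c, funext hc⟩

theorem dvd_mulVec_of_left {n l : ℕ} {A : Matrix (Fin l) (Fin n) ℤ} {k : ℤ} {i : Fin l}
    (h : ∀ j, k ∣ A i j) (t : Fin n → ℤ) : k ∣ (A *ᵥ t) i :=
  show k ∣ ∑ j, A i j * t j from Finset.dvd_sum fun j _ => Dvd.dvd.mul_right (h j) _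

theorem dvd_mulVec_of_right {n l : ℕ} (A : Matrix (Fin l) (Fin n) ℤ) {k : ℤ} (i : Fin l)
    {t : Fin n → ℤ} (h : ∀ j, k ∣ t j) : k ∣ (A *ᵥ t) i :=
  show k ∣ ∑ j, A i j * t j from Finset.dvd_sum fun j _ => Dvd.dvd.mul_left (h j) _

/-- The image of `T` is cut out by the congruences of a check matrix `H`. -/
theorem exists_mulVec_iff_dvd {n l : ℕ} {T P : Matrix (Fin n) (Fin n) ℤ}
    {M : Matrix (Fin n) (Fin l) ℤ} {H : Matrix (Fin l) (Fin n) ℤ} {k : ℤ} (hk : k ≠ 0)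
    (hTP : T * P = k • 1) (hHT : ∀ i j, k ∣ (H * T) i j) (hP : ∀ i j, k ∣ P i j - (M * H) i j)
    (t : Fin n → ℤ) : (∀ i, k ∣ (H *ᵥ t) i) ↔ ∃ c, t = T *ᵥ c := by
  constructor
  · intro ht
    have hd : ∀ a, k ∣ (P *ᵥ t) a := fun a => by
      have h1 : P *ᵥ t = (P - M * H) *ᵥ t + M *ᵥ (H *ᵥ t) := by
        rw [sub_mulVec, mulVec_mulVec, sub_add_cancel]
      rw [h1, Pi.add_apply]
      exact dvd_add (dvd_mulVec_of_left (hP a) t) (dvd_mulVec_of_right M a ht)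
    obtain ⟨c, hc⟩ := exists_smul_of_dvd hd
    refine ⟨c, smul_right_injective _ hk ?_⟩
    simp only
    rw [← mulVec_smul, ← hc, mulVec_mulVec, hTP, smul_mulVec, one_mulVec]
  · rintro ⟨c, rfl⟩ i
    rw [mulVec_mulVec]
    exact dvd_mulVec_of_left (hHT i) c

/-- Counting the minimal vectors of the dual lattice. -/
theorem shell_card_of_glue {e : Fin r × Fin q ≃ Fin (2 * m)}
    {T P B C : Matrix (Fin (2 * m)) (Fin (2 * m)) ℤ} (hL : IsLevel (q + 1) m B C)
    (hTP : T * P = ((q : ℤ) + 1) • 1)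
    (hC : P * rootGram e * Pᵀ = (((q : ℤ) + 1) ^ 2) • C)
    (hdvd : ∀ w, qi (rootGram e) (Pᵀ *ᵥ w) = 2 * ((q : ℤ) + 1) ^ 2 →
      ∀ a, ((q : ℤ) + 1) ∣ (Pᵀ *ᵥ w) a) {n : ℕ} (hS : MinShell (rootNorm (q := q)) 2 n) :
    (shell C 2).card = r * n := by
  have hk : ((q : ℤ) + 1) ≠ 0 := by positivity
  have hPT := mul_comm_of_mul_eq hk hTP
  have hnorm : ∀ w, qi (rootGram e) (Pᵀ *ᵥ w) = ((q : ℤ) + 1) ^ 2 * qi C w := fun w => by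
    rw [← qi_mulVec, transpose_transpose, hC, qi, smul_mulVec, dotProduct_smul, smul_eq_mul, qi]
  have hinv : ∀ w, Tᵀ *ᵥ (Pᵀ *ᵥ w) = ((q : ℤ) + 1) • w := fun w => by
    rw [mulVec_mulVec, ← transpose_mul, hPT, transpose_smul, transpose_one, smul_mulVec,
      one_mulVec]
  have hinv' : ∀ t, Pᵀ *ᵥ (Tᵀ *ᵥ t) = ((q : ℤ) + 1) • t := fun t => by
    rw [mulVec_mulVec, ← transpose_mul, hTP, transpose_smul, transpose_one, smul_mulVec,
      one_mulVec]
  have hsmul : ∀ t, qi (rootGram e) (((q : ℤ) + 1) • t) = ((q : ℤ) + 1) ^ 2 * qi (rootGram e) t :=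
    fun t => qi_smul _ _ _
  have hk2 : ((q : ℤ) + 1) ^ 2 ≠ 0 := pow_ne_zero _ hk
  have hmem : ∀ t, Tᵀ *ᵥ t ∈ shell C 2 ↔ qi (rootGram e) t = 2 := fun t => by
    rw [hL.mem_shell_C]
    have h1 := hnorm (Tᵀ *ᵥ t)
    rw [hinv', hsmul] at h1
    rw [mul_left_cancel₀ hk2 h1]
  have hinj : Function.Injective fun t => Tᵀ *ᵥ t := fun t u htu => by
    have := congrArg (Pᵀ *ᵥ ·) htu
    simp only [hinv'] at this
    exact smul_right_injective _ hk this
  set F : Finset (Fin (2 * m) → ℤ) := (shell C 2).preimage _ hinj.injOn with hF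
  have hcard : (shell C 2).card = F.card := by
    rw [← Finset.card_image_of_injective F hinj]
    congr 1
    ext w
    simp only [hF, Finset.mem_image, Finset.mem_preimage]
    constructor
    · intro hw
      have h2 := hL.mem_shell_C.mp hw
      obtain ⟨t, ht⟩ := exists_smul_of_dvd (hdvd w (by rw [hnorm, h2]; ring))
      have htw : Tᵀ *ᵥ t = w := smul_right_injective _ hk <| by
        simp only
        rw [← hinv w, ht, mulVec_smul]
      exact ⟨t, htw ▸ hw, htw⟩
    · rintro ⟨t, ht, rfl⟩
      exact ht
  rw [hcard]
  refine hS.card_eq e fun t => ?_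
  rw [hF, Finset.mem_preimage, hmem, qi_rootGram]

theorem MinShell.le_sum {g : (Fin q → ℤ) → ℤ} {μ : ℤ} {n d : ℕ} (h : MinShell g μ n)
    (e : Fin r × Fin q ≃ Fin d) {t : Fin d → ℤ} (ht : t ≠ 0) :
    μ ≤ ∑ i, g fun k => t (e (i, k)) := by
  obtain ⟨a, ha⟩ := Function.ne_iff.mp ht
  obtain ⟨⟨i, k⟩, rfl⟩ := e.surjective a
  refine (h.le _ (show (fun k => t (e (i, k))) ≠ 0 from Function.ne_iff.mpr ⟨k, ha⟩)).trans ?_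
  exact Finset.single_le_sum (f := fun i => g fun k => t (e (i, k))) (fun j _ => h.nonneg _)
    (Finset.mem_univ i)

theorem weightGram_diag {d : ℕ} (e : Fin r × Fin q ≃ Fin d) (a : Fin d) :
    weightGram e a a = q := by
  rw [weightGram, Matrix.sub_apply, Matrix.smul_apply, Matrix.one_apply_eq]
  simp [onesGram]

theorem rootGram_diag {d : ℕ} (e : Fin r × Fin q ≃ Fin d) (a : Fin d) : rootGram e a a = 2 := by
  simp [rootGram, onesGram]

theorem inCode_of_ge [NeZero (q + 1)] (hq : 3 ≤ q) {d : ℕ} (e : Fin r × Fin q ≃ Fin d)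
    (t : Fin d → ℤ) : InCode e t := by
  have h2 : q + 1 ≠ 2 := by omega
  have h3 : q + 1 ≠ 3 := by omega
  rw [InCode, glueCode, Finset.mem_filter]
  simp only [h2, h3, if_false, Finset.mem_univ, and_self]

/-- The glue lattice for `p = 5, 7`, with its number of minimal vectors. -/
theorem glueModel_of_ge [NeZero (q + 1)] (hq : 3 ≤ q) (hprime : (q + 1).Prime)
    (e : Fin r × Fin q ≃ Fin (2 * m)) {s n : ℕ} (hs : q = 2 * s) (hexp : (q - 1) * r = m + 2)
    (hr : 0 < r) (hS : MinShell (blockNorm (q := q)) q n) :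
    GlueModel e s 1 (weightGram e) (rootGram e) ∧ (shell (weightGram e) (2 * s)).card = r * n := by
  have hs' : (q : ℤ) = 2 * s := by exact_mod_cast hs
  have hL : IsLevel (q + 1) m (weightGram e) (rootGram e) :=
    isLevel_of_glue e hprime (T := 1) (P := ((q : ℤ) + 1) • 1) (by rw [Matrix.one_mul]) (by simp)
      (by
        rw [transpose_smul, transpose_one, Matrix.mul_smul, Matrix.mul_one, Matrix.smul_mul,
          Matrix.one_mul, smul_smul, sq])
      (fun i => by rw [weightGram_diag, hs']; exact dvd_mul_right _ _)
      (fun i => by rw [rootGram_diag]) (by rw [det_one, one_pow, one_mul, hexp])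
  refine ⟨⟨hL, by simp, fun t => ?_, fun v hv => ?_, ?_⟩, ?_⟩
  · exact iff_of_true (inCode_of_ge hq e t) ⟨t, by rw [one_mulVec]⟩
  · rw [qi_weightGram, ← hs']
    exact hS.le_sum e hv
  · refine ⟨Pi.single (e (⟨0, hr⟩, ⟨0, by omega⟩)) 1, ?_⟩
    rw [qi, mulVec_single_one, single_one_dotProduct, col_apply, weightGram_diag, hs']
  · refine hS.card_eq e fun t => ?_
    rw [hL.mem_shell_B, qi_weightGram, hs']

end GlueModelStructure

section Ternary

/-- The numbering of the coordinates of six blocks of size two. -/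
def ternaryIndex : Fin 6 × Fin 2 ≃ Fin (2 * 6) := finProdFinEquiv

/-- A basis of the coordinate vectors of the glue lattice for `p = 3`. -/
def ternaryBasis : Matrix (Fin (2 * 6)) (Fin (2 * 6)) ℤ :=
  Matrix.of fun a b => if a = 0 then (if b = 0 then 3 else -1) else if a = b then 1 else 0

/-- Three times the inverse of `ternaryBasis`. -/
def ternaryCobasis : Matrix (Fin (2 * 6)) (Fin (2 * 6)) ℤ :=
  Matrix.of fun a b => if a = 0 then 1 else if a = b then 3 else 0

/-- The Gram matrix of the rescaled dual lattice for `p = 3`. -/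
def ternaryDualGram : Matrix (Fin (2 * 6)) (Fin (2 * 6)) ℤ :=
  Matrix.of fun i j =>
    (ternaryCobasis * rootGram ternaryIndex * ternaryCobasisᵀ) i j / 9

theorem ternaryBasis_mul : ternaryBasis * ternaryCobasis = (((2 : ℕ) : ℤ) + 1) • 1 := by
  ext i j
  rw [Matrix.smul_apply]
  revert i j
  decide +kernel

theorem ternaryDualGram_smul : ternaryCobasis * rootGram ternaryIndex * ternaryCobasisᵀ =
    ((((2 : ℕ) : ℤ) + 1) ^ 2) • ternaryDualGram := by
  have h : ∀ i j, (9 : ℤ) ∣ (ternaryCobasis * rootGram ternaryIndex * ternaryCobasisᵀ) i j := by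
    decide +kernel
  ext i j
  rw [Matrix.smul_apply, ternaryDualGram, Matrix.of_apply, smul_eq_mul]
  norm_num
  exact (Int.mul_ediv_cancel' (h i j)).symm

theorem isLevel_ternary : IsLevel (2 + 1) 6
    (ternaryBasisᵀ * weightGram ternaryIndex * ternaryBasis) ternaryDualGram := by
  refine isLevel_of_glue ternaryIndex (by norm_num) ternaryBasis_mul rfl ternaryDualGram_smul
    (by decide +kernel) (by decide +kernel) ?_
  have h : ternaryBasis.det = 3 := by
    have htri : ∀ i j : Fin (2 * 6), j < i → 1 * ternaryBasis i j = 0 := by decide +kernel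
    rw [Matrix.det_of_isUpperTriangular fun i j hij => by simpa using htri i j hij]
    decide +kernel
  rw [h]
  norm_num

theorem inCode_ternary_iff (t : Fin (2 * 6) → ℤ) :
    InCode ternaryIndex t ↔ (3 : ℤ) ∣ ∑ a, t a := by
  rw [InCode, glueCode, Finset.mem_filter, sum_blocks ternaryIndex t]
  simp only [Finset.mem_univ, true_and, Nat.reduceAdd, if_true, Nat.reduceEqDiff, if_false]
  rw [← Int.cast_sum, ZMod.intCast_zmod_eq_zero_iff_dvd]
  rfl

theorem inCode_ternary (t : Fin (2 * 6) → ℤ) :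
    InCode ternaryIndex t ↔ ∃ c, t = ternaryBasis *ᵥ c := by
  rw [inCode_ternary_iff, ← exists_mulVec_iff_dvd (l := 1) (by norm_num) ternaryBasis_mul
    (H := Matrix.of fun _ _ => 1)
    (M := Matrix.of fun a _ => if a.1 = 0 then 1 else 0) (by decide +kernel) (by decide +kernel)]
  simp [mulVec, dotProduct]

theorem blockNorm_two_dvd (t : Fin 2 → ℤ) : 2 ∣ blockNorm t := by
  refine ⟨t 0 ^ 2 - t 0 * t 1 + t 1 ^ 2, ?_⟩
  simp [blockNorm]
  ring

theorem four_le_of_inCode_ternary {t : Fin (2 * 6) → ℤ} (h : InCode ternaryIndex t) (ht : t ≠ 0) :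
    4 ≤ qi (weightGram ternaryIndex) t := by
  have hmin := minShell_blockNorm_two
  rw [qi_weightGram]
  obtain ⟨a, ha⟩ := Function.ne_iff.mp ht
  obtain ⟨⟨i, k⟩, rfl⟩ := ternaryIndex.surjective a
  have hi := hmin.le (fun k => t (ternaryIndex (i, k))) (Function.ne_iff.mpr ⟨k, ha⟩)
  rw [← Finset.add_sum_erase _ _ (Finset.mem_univ i)]
  by_cases hj : ∃ j ≠ i, (fun k => t (ternaryIndex (j, k))) ≠ 0
  · obtain ⟨j, hji, hj⟩ := hj
    have h1 := hmin.le _ hj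
    have h2 := Finset.single_le_sum
      (f := fun i => blockNorm fun k => t (ternaryIndex (i, k))) (fun j _ => hmin.nonneg _)
      (Finset.mem_erase.mpr ⟨hji, Finset.mem_univ j⟩)
    linarith
  · push Not at hj
    have h0 : ∑ j ∈ Finset.univ.erase i, ∑ k, t (ternaryIndex (j, k)) = 0 :=
      Finset.sum_eq_zero fun j hji => by
        have := hj j (Finset.ne_of_mem_erase hji)
        exact Finset.sum_eq_zero fun k _ => congrFun this k
    have h1 : 0 ≤ ∑ j ∈ Finset.univ.erase i, blockNorm fun k => t (ternaryIndex (j, k)) :=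
      Finset.sum_nonneg fun j _ => hmin.nonneg _
    rw [inCode_ternary_iff, sum_blocks ternaryIndex, ← Finset.add_sum_erase _ _ (Finset.mem_univ i),
      h0, add_zero] at h
    obtain ⟨z, hz⟩ := h
    obtain ⟨y, hy⟩ := blockNorm_two_dvd fun k => t (ternaryIndex (i, k))
    have h3 : blockNorm (fun k => t (ternaryIndex (i, k))) =
        3 * (∑ k, t (ternaryIndex (i, k)) ^ 2) - 9 * z ^ 2 := by
      rw [blockNorm, hz]
      push_cast
      ring
    set b := blockNorm fun k => t (ternaryIndex (i, k))
    omega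

theorem three_dvd_of_ternary_shell (w : Fin (2 * 6) → ℤ)
    (hw : qi (rootGram ternaryIndex) (ternaryCobasisᵀ *ᵥ w) = 2 * (((2 : ℕ) : ℤ) + 1) ^ 2)
    (a : Fin (2 * 6)) : (((2 : ℕ) : ℤ) + 1) ∣ (ternaryCobasisᵀ *ᵥ w) a := by
  set u := ternaryCobasisᵀ *ᵥ w with hu
  have hcong : ∀ a, (3 : ℤ) ∣ u a - w 0 := fun a => by
    set R : Matrix (Fin (2 * 6)) (Fin (2 * 6)) ℤ := Matrix.of fun _ b => if b = 0 then 1 else 0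
      with hR
    have h1 : u a - w 0 = ((ternaryCobasisᵀ - R) *ᵥ w) a := by
      rw [sub_mulVec, Pi.sub_apply, hu]
      simp [mulVec, dotProduct, hR]
    have h2 : ∀ a j : Fin (2 * 6), (3 : ℤ) ∣
        ternaryCobasis j a - if j = 0 then 1 else 0 := by decide +kernel
    rw [h1]
    exact dvd_mulVec_of_left (fun j => h2 a j) w
  norm_num
  by_contra hcon
  have hw0 : ¬ (3 : ℤ) ∣ w 0 := fun h => hcon (by have := hcong a; omega)
  have hblock : ∀ i, 6 ≤ rootNorm fun k => u (ternaryIndex (i, k)) := fun i => by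
    obtain ⟨x, hx⟩ := hcong (ternaryIndex (i, 0))
    obtain ⟨y, hy⟩ := hcong (ternaryIndex (i, 1))
    have hxy : u (ternaryIndex (i, 1)) = u (ternaryIndex (i, 0)) + 3 * (y - x) := by linarith
    have hne : u (ternaryIndex (i, 0)) ≠ 0 := fun h0 => hw0 (by omega)
    have hform : rootNorm (fun k => u (ternaryIndex (i, k))) =
        6 * (u (ternaryIndex (i, 0)) ^ 2 + 3 * u (ternaryIndex (i, 0)) * (y - x) +
          3 * (y - x) ^ 2) := by
      simp only [rootNorm, Fin.sum_univ_two, hxy]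
      ring
    rw [hform]
    have : 0 < u (ternaryIndex (i, 0)) ^ 2 + 3 * u (ternaryIndex (i, 0)) * (y - x) +
        3 * (y - x) ^ 2 := by
      have := sq_pos_of_ne_zero hne
      nlinarith [sq_nonneg (u (ternaryIndex (i, 0)) + 2 * (y - x)),
        sq_nonneg (u (ternaryIndex (i, 0)) * 3 + 6 * (y - x))]
    omega
  rw [qi_rootGram] at hw
  have := Finset.sum_le_sum fun i (_ : i ∈ Finset.univ) => hblock i
  rw [hw] at this
  norm_num at this

theorem glueModel_ternary : GlueModel ternaryIndex 2 ternaryBasis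
    (ternaryBasisᵀ * weightGram ternaryIndex * ternaryBasis) ternaryDualGram where
  level := isLevel_ternary
  gram := rfl
  code := inCode_ternary
  min v hv := by
    rw [qi_mulVec]
    refine four_le_of_inCode_ternary ((inCode_ternary _).mpr ⟨v, rfl⟩) fun h0 => hv ?_
    exact mulVec_injective_of_mul_eq (by norm_num) ternaryBasis_mul (by rw [h0, mulVec_zero])
  attained := ⟨Pi.single 2 1 - Pi.single 4 1, by decide +kernel⟩

theorem shell_ternary_card : (shell ternaryDualGram 2).card = 36 :=
  shell_card_of_glue isLevel_ternary ternaryBasis_mul ternaryDualGram_smul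
    three_dvd_of_ternary_shell minShell_rootNorm_two

end Ternary

section Binary

/-- The numbering of sixteen blocks of size one. -/
def binaryIndex : Fin 16 × Fin 1 ≃ Fin (2 * 8) := finProdFinEquiv

/-- The parity checks of the extended Hamming code of length 16. -/
def binaryCheck : Matrix (Fin 5) (Fin (2 * 8)) ℤ :=
  Matrix.of fun j x => if j.1 = 4 then 1 else if x.1.testBit j.1 then 1 else 0

/-- The five information-free positions, as a function of the check. -/
def binaryPivot (j : Fin 5) : ℕ := if j.1 = 4 then 0 else 2 ^ j.1

/-- The coefficients of the pivot positions of a codeword. -/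
def binaryCoeff (j : Fin 5) (x : Fin (2 * 8)) : ℤ :=
  if j.1 = 4 then (1 + ∑ i : Fin 4, if x.1.testBit i.1 then 1 else 0) % 2
  else if x.1.testBit j.1 then 1 else 0

/-- A basis of the coordinate vectors of the glue lattice for `p = 2`. -/
def binaryBasis : Matrix (Fin (2 * 8)) (Fin (2 * 8)) ℤ :=
  Matrix.of fun y x => if ∃ j, x.1 = binaryPivot j then (if y = x then 2 else 0) else
    if y = x then 1 else ∑ j, if y.1 = binaryPivot j then binaryCoeff j x else 0

/-- Twice the inverse of `binaryBasis`. -/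
def binaryCobasis : Matrix (Fin (2 * 8)) (Fin (2 * 8)) ℤ :=
  Matrix.of fun y x => if ∃ j, x.1 = binaryPivot j then (if y = x then 1 else 0) else
    if y = x then 2 else -∑ j, if y.1 = binaryPivot j then binaryCoeff j x else 0

/-- The Gram matrix of the rescaled dual lattice for `p = 2`. -/
def binaryDualGram : Matrix (Fin (2 * 8)) (Fin (2 * 8)) ℤ :=
  Matrix.of fun i j =>
    (binaryCobasis * rootGram binaryIndex * binaryCobasisᵀ) i j / 4

/-- Pivot rows expressed through the checks. -/
def binaryPivotMatrix : Matrix (Fin (2 * 8)) (Fin 5) ℤ :=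
  Matrix.of fun y j => if y.1 = 0 then 1 else if y.1 = binaryPivot j then 1 else 0

theorem binaryBasis_mul : binaryBasis * binaryCobasis = (((1 : ℕ) : ℤ) + 1) • 1 := by
  ext i j
  rw [Matrix.smul_apply]
  revert i j
  decide +kernel

theorem binaryDualGram_smul : binaryCobasis * rootGram binaryIndex * binaryCobasisᵀ =
    ((((1 : ℕ) : ℤ) + 1) ^ 2) • binaryDualGram := by
  have h : ∀ i j, (4 : ℤ) ∣ (binaryCobasis * rootGram binaryIndex * binaryCobasisᵀ) i j := by
    decide +kernel
  ext i j
  rw [Matrix.smul_apply, binaryDualGram, Matrix.of_apply, smul_eq_mul]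
  norm_num
  exact (Int.mul_ediv_cancel' (h i j)).symm

theorem isLevel_binary : IsLevel (1 + 1) 8
    (binaryBasisᵀ * weightGram binaryIndex * binaryBasis) binaryDualGram := by
  refine isLevel_of_glue binaryIndex (by norm_num) binaryBasis_mul rfl binaryDualGram_smul
    (by decide +kernel) (by decide +kernel) ?_
  have h : binaryBasis.det = 32 := by
    have htri : ∀ i j : Fin (2 * 8), j < i → 1 * binaryBasis i j = 0 := by decide +kernel
    rw [Matrix.det_of_isUpperTriangular fun i j hij => by simpa using htri i j hij]
    decide +kernel
  rw [h]
  norm_num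

theorem inCode_binary_iff (t : Fin (2 * 8) → ℤ) :
    InCode binaryIndex t ↔ ∀ j, (2 : ℤ) ∣ (binaryCheck *ᵥ t) j := by
  have h2 : ∀ z : ℤ, (z : ZMod 2) = 0 ↔ (2 : ℤ) ∣ z := fun z =>
    ZMod.intCast_zmod_eq_zero_iff_dvd z 2
  have ht : ∀ i : Fin 16, (∑ k, t (binaryIndex (i, k))) = t i := fun i => by
    rw [Fin.sum_univ_one]
    congr 1
    exact Fin.ext (by simp [binaryIndex, finProdFinEquiv])
  rw [InCode, glueCode, Finset.mem_filter]
  simp only [Finset.mem_univ, true_and, Nat.reduceAdd, if_true, ht]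
  rw [Fin.forall_fin_succ' (n := 4), and_comm]
  refine and_congr (forall_congr' fun j => ?_) ?_
  · have h3 : (binaryCheck *ᵥ t) j.castSucc = ∑ i : Fin 16, if i.1.testBit j.1 then t i else 0 := by
      rw [mulVec, dotProduct]
      refine Finset.sum_congr rfl fun i _ => ?_
      simp [binaryCheck, j.2.ne]
    rw [h3, ← h2, Int.cast_sum]
    simp only [Int.cast_ite, Int.cast_zero]
  · have h3 : (binaryCheck *ᵥ t) (Fin.last 4) = ∑ i : Fin 16, t i := by
      rw [mulVec, dotProduct]
      refine Finset.sum_congr rfl fun i _ => ?_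
      simp [binaryCheck]
    rw [h3, ← h2, Int.cast_sum]

theorem inCode_binary (t : Fin (2 * 8) → ℤ) :
    InCode binaryIndex t ↔ ∃ c, t = binaryBasis *ᵥ c := by
  rw [inCode_binary_iff]
  exact exists_mulVec_iff_dvd (by norm_num) binaryBasis_mul (M := binaryPivotMatrix)
    (by decide +kernel) (by decide +kernel) t

theorem qi_weightGram_binary (t : Fin (2 * 8) → ℤ) :
    qi (weightGram binaryIndex) t = ∑ a, t a ^ 2 := by
  rw [qi_weightGram, sum_blocks binaryIndex fun a => t a ^ 2]
  refine Finset.sum_congr rfl fun i _ => ?_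
  simp only [blockNorm, Fin.sum_univ_one]
  push_cast
  ring

theorem exists_odd_of_check {t : Fin (2 * 8) → ℤ} {j : Fin 5} (h : (2 : ℤ) ∣ (binaryCheck *ᵥ t) j)
    {a : Fin (2 * 8)} (ha : ¬ (2 : ℤ) ∣ t a) (hja : binaryCheck j a = 1) :
    ∃ b ≠ a, binaryCheck j b = 1 ∧ ¬ (2 : ℤ) ∣ t b := by
  by_contra! hcon
  have h1 : (binaryCheck *ᵥ t) j =
      binaryCheck j a * t a + ∑ b ∈ Finset.univ.erase a, binaryCheck j b * t b := by
    rw [mulVec, dotProduct]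
    exact (Finset.add_sum_erase _ _ (Finset.mem_univ a)).symm
  rw [h1, hja, one_mul] at h
  refine ha ((dvd_add_left (Finset.dvd_sum fun b hb => ?_)).mp h)
  have h01 : binaryCheck j b = 0 ∨ binaryCheck j b = 1 := by
    simp only [binaryCheck, Matrix.of_apply]
    split_ifs <;> simp
  rcases h01 with h0 | h0
  · rw [h0, zero_mul]
    exact dvd_zero _
  · exact Dvd.dvd.mul_left (hcon b (Finset.ne_of_mem_erase hb) h0) _

theorem four_le_of_inCode_binary {t : Fin (2 * 8) → ℤ} (h : InCode binaryIndex t) (ht : t ≠ 0) :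
    4 ≤ qi (weightGram binaryIndex) t := by
  rw [qi_weightGram_binary]
  by_cases hodd : ∃ a, ¬ (2 : ℤ) ∣ t a
  · rw [inCode_binary_iff] at h
    obtain ⟨a, ha⟩ := hodd
    have hlast : ∀ x, binaryCheck 4 x = 1 := fun x => by simp [binaryCheck]
    have key : ∀ a b : Fin (2 * 8), a = b ∨ ∃ j, binaryCheck j a * binaryCheck j b = 0 ∧
        binaryCheck j a + binaryCheck j b = 1 * 1 := by decide +kernel
    obtain ⟨b, hba, -, hb⟩ := exists_odd_of_check (h 4) ha (hlast a)
    obtain ⟨j, hj0, hj1⟩ := (key a b).resolve_left hba.symm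
    obtain ⟨c, hca, hcb, hc⟩ : ∃ c, c ≠ a ∧ c ≠ b ∧ ¬ (2 : ℤ) ∣ t c := by
      rcases mul_eq_zero.mp hj0 with h0 | h0
      · obtain ⟨c, hc1, hc2, hc3⟩ := exists_odd_of_check (h j) hb (by linarith)
        exact ⟨c, fun hca => by rw [hca, h0] at hc2; norm_num at hc2, hc1, hc3⟩
      · obtain ⟨c, hc1, hc2, hc3⟩ := exists_odd_of_check (h j) ha (by linarith)
        exact ⟨c, hc1, fun hcb => by rw [hcb, h0] at hc2; norm_num at hc2, hc3⟩
    have hsq : ∀ x, ¬ (2 : ℤ) ∣ t x → 1 ≤ t x ^ 2 := fun x hx => by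
      have : t x ≠ 0 := fun h0 => hx (by rw [h0]; exact dvd_zero 2)
      have := sq_pos_of_ne_zero this
      omega
    have h3 : ∑ x ∈ ({a, b, c} : Finset (Fin (2 * 8))), t x ^ 2 ≤ ∑ x, t x ^ 2 :=
      Finset.sum_le_sum_of_subset_of_nonneg (Finset.subset_univ _) fun _ _ _ => sq_nonneg _
    rw [Finset.sum_insert (by simp [hba.symm, hca.symm]), Finset.sum_pair hcb.symm] at h3
    have hev : (2 : ℤ) ∣ ∑ x, t x ^ 2 := by
      have h4 := h 4
      have h5 : (binaryCheck *ᵥ t) 4 = ∑ x, t x := by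
        simp only [mulVec, dotProduct, hlast, one_mul]
      rw [h5] at h4
      have h6 : (2 : ℤ) ∣ ∑ x, (t x ^ 2 - t x) := Finset.dvd_sum fun x _ => by
        have := Int.even_mul_pred_self (t x)
        rw [show t x ^ 2 - t x = t x * (t x - 1) by ring]
        exact this.two_dvd
      rw [Finset.sum_sub_distrib] at h6
      exact (dvd_sub_left h4).mp h6
    have := hsq a ha
    have := hsq b hb
    have := hsq c hc
    omega
  · push Not at hodd
    obtain ⟨s, rfl⟩ := exists_smul_of_dvd hodd
    obtain ⟨a, ha⟩ := Function.ne_iff.mp ht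
    have h1 : ((2 : ℤ) • s) a ^ 2 ≤ ∑ x, ((2 : ℤ) • s) x ^ 2 :=
      Finset.single_le_sum (f := fun x => ((2 : ℤ) • s) x ^ 2) (fun _ _ => sq_nonneg _)
        (Finset.mem_univ a)
    refine le_trans ?_ h1
    have hs : s a ≠ 0 := fun h0 => ha (by simp [h0])
    have := sq_pos_of_ne_zero hs
    simp only [Pi.smul_apply, smul_eq_mul]
    nlinarith

theorem two_dvd_of_binary_shell (w : Fin (2 * 8) → ℤ)
    (hw : qi (rootGram binaryIndex) (binaryCobasisᵀ *ᵥ w) = 2 * (((1 : ℕ) : ℤ) + 1) ^ 2)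
    (a : Fin (2 * 8)) : (((1 : ℕ) : ℤ) + 1) ∣ (binaryCobasisᵀ *ᵥ w) a := by
  set u := binaryCobasisᵀ *ᵥ w with hu
  have hnorm : ∑ a, u a ^ 2 = 4 := by
    have : qi (rootGram binaryIndex) u = 2 * ∑ a, u a ^ 2 := by
      rw [qi_rootGram, sum_blocks binaryIndex fun a => u a ^ 2, Finset.mul_sum]
      refine Finset.sum_congr rfl fun i _ => ?_
      simp only [rootNorm, Fin.sum_univ_one]
      ring
    rw [this] at hw
    norm_num at hw
    linarith
  set y := binaryPivotMatrixᵀ *ᵥ w with hy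
  have hmod : ∀ i j, (2 : ℤ) ∣ binaryCobasis i j - (binaryPivotMatrix * binaryCheck) i j := by
    decide +kernel
  have hcong : ∀ a, ((u a : ℤ) : ZMod 2) =
      ∑ j, (binaryCheck j a : ZMod 2) * ((y j : ℤ) : ZMod 2) := fun a => by
    have h1 : (2 : ℤ) ∣ ((binaryCobasis - binaryPivotMatrix * binaryCheck)ᵀ *ᵥ w) a :=
      dvd_mulVec_of_left (fun j => hmod j a) w
    rw [transpose_sub, sub_mulVec, transpose_mul, ← mulVec_mulVec, ← hu, ← hy] at h1
    have h2 := (ZMod.intCast_zmod_eq_zero_iff_dvd _ 2).mpr h1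
    rw [Pi.sub_apply, Int.cast_sub, sub_eq_zero] at h2
    rw [h2, mulVec, dotProduct]
    push_cast
    rfl
  have hcount : (Finset.univ.filter fun a => ((u a : ℤ) : ZMod 2) ≠ 0).card ≤ 4 := by
    have h1 : ∑ a ∈ Finset.univ.filter (fun a => ((u a : ℤ) : ZMod 2) ≠ 0), (1 : ℤ) ≤
        ∑ a, u a ^ 2 := by
      rw [Finset.sum_filter]
      refine Finset.sum_le_sum fun a _ => ?_
      split_ifs with h
      · have : u a ≠ 0 := fun h0 => h (by rw [h0, Int.cast_zero])
        have := sq_pos_of_ne_zero this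
        omega
      · exact sq_nonneg _
    rw [hnorm] at h1
    simpa using h1
  have hweight : ∀ z : Fin 5 → ZMod 2,
      (∑ a, if (∑ j, (binaryCheck j a : ZMod 2) * z j) = 0 then 0 else 1) ≤ 4 →
      ∀ a, (∑ j, (binaryCheck j a : ZMod 2) * z j) = 0 := by decide +kernel
  have h0 := hweight (fun j => ((y j : ℤ) : ZMod 2)) (by
    rw [Finset.card_filter] at hcount
    simpa only [hcong, ne_eq, ite_not] using hcount) a
  rw [← hcong] at h0
  exact (ZMod.intCast_zmod_eq_zero_iff_dvd _ 2).mp h0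

theorem glueModel_binary : GlueModel binaryIndex 2 binaryBasis
    (binaryBasisᵀ * weightGram binaryIndex * binaryBasis) binaryDualGram where
  level := isLevel_binary
  gram := rfl
  code := inCode_binary
  min v hv := by
    rw [qi_mulVec]
    refine four_le_of_inCode_binary ((inCode_binary _).mpr ⟨v, rfl⟩) fun h0 => hv ?_
    exact mulVec_injective_of_mul_eq (by norm_num) binaryBasis_mul (by rw [h0, mulVec_zero])
  attained := ⟨Pi.single 0 1, by decide +kernel⟩

theorem shell_binary_card : (shell binaryDualGram 2).card = 32 :=
  shell_card_of_glue isLevel_binary binaryBasis_mul binaryDualGram_smul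
    two_dvd_of_binary_shell minShell_rootNorm_one

end Binary

section UniqueFive

variable {q r m : ℕ}

theorem isUnit_of_det_sq_mul {n : ℕ} {S B L : Matrix (Fin n) (Fin n) ℤ} (h : Sᵀ * B * S = L)
    (hdet : B.det = L.det) (h0 : L.det ≠ 0) : IsUnit S.det := by
  have h1 : S.det * S.det = 1 := by
    have := congrArg Matrix.det h
    rw [det_mul, det_mul, det_transpose, hdet] at this
    refine mul_right_cancel₀ h0 ?_
    linear_combination this
  exact IsUnit.of_mul_eq_one _ h1

theorem unique_of_ge [NeZero (q + 1)] (hq : 3 ≤ q) (e : Fin r × Fin q ≃ Fin (2 * m)) {s : ℕ}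
    (hs : q = 2 * s) (hm : q * r = 2 * m) (hexp : (q - 1) * r = m + 2) (hr : 0 < r)
    (hS : MinShell (blockNorm (q := q)) q (2 * (q + 1)))
    {B C : Matrix (Fin (2 * m)) (Fin (2 * m)) ℤ} (H : IsLevel (q + 1) m B C)
    (hmin : ∀ v : Fin (2 * m) → ℤ, v ≠ 0 → (2 * s : ℤ) ≤ qi B v)
    (hk : ∀ a, Isotropic B a → (q + 1 + 1) * (m + 2) < 12 * (s + 1) ∨
      (q + 1 + 1) * (m + 2) = 12 * (s + 1) ∧ ∃ τ : ℂ, 0 < τ.im ∧ thG (q + 1) C a 2 τ = 0)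
    (hk' : (q + 1 + 1) * m < 12 * (s + 1)) :
    ∃ b : Fin (2 * m) → GVec (q + 1) r,
      (∀ i, MemGlue (q + 1) r (b i)) ∧
      (∀ x, MemGlue (q + 1) r x → ∃ c : Fin (2 * m) → ℤ, x = ∑ i, (c i : ℚ) • b i) ∧
      ∀ i j, blN (q + 1) r (b i) (b j) = (B i j : ℚ) := by
  obtain ⟨G, hG⟩ := glueModel_of_ge hq H.prime e hs hexp hr hS
  have hs' : (q : ℤ) = 2 * s := by exact_mod_cast hs
  have hcard : (shell B (2 * s)).card = r * (2 * (q + 1)) := by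
    rw [← hG]
    exact (IsLevel.shell_card_eq H G.level hmin G.min (by omega) hk').2
  have hinj := H.mulVec_B_injective
  have key : ∀ x y : Fin (2 * m) → ℤ, ∑ v ∈ shell B (2 * s), (x ⬝ᵥ B *ᵥ v) * (y ⬝ᵥ B *ᵥ v) =
      (2 * (q + 1) : ℤ) * (x ⬝ᵥ B *ᵥ y) := by
    intro x y
    have := H.design ((shell B (2 * s)).image (B *ᵥ ·)) (ρ := 2 * (q + 1)) (fun a ha => by
        rw [Finset.sum_image fun _ _ _ _ h => hinj h]
        exact (H.harmonic_sums hmin ha (hk a ha)).2) (by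
        rw [Finset.sum_image fun _ _ _ _ h => hinj h, Finset.sum_congr rfl fun v hv => by
          rw [H.qi_C_mulVec, H.mem_shell_B.mp hv], Finset.sum_const, hcard, ← hm, ← hs', nsmul_eq_mul]
        push_cast
        ring) (fun h => by rw [h] at hexp hm; simp only [mul_zero, mul_eq_zero] at hm; omega) x y
    rwa [Finset.sum_image fun _ _ _ _ h => hinj h] at this
  have tight : TightShell (q + 1) (fun v w => v ⬝ᵥ B *ᵥ w) (shell B (2 * s)) :=
    { symm := fun x y => bilin_comm H.symmB x y
      neg := fun x y => neg_dotProduct _ _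
      neg_mem := fun x hx => by
        rw [H.mem_shell_B] at hx ⊢
        rw [qi_neg, hx]
      norm := fun x hx => by
        have := H.mem_shell_B.mp hx
        rw [qi] at this
        rw [this, ← hs']
        push_cast
        ring
      tight := fun x _ y _ => by
        rw [key]
        push_cast
        ring }
  obtain ⟨x, -, hx⟩ := tight.exists_blocks (q := q) (r := r) (by omega) rfl
    (by rw [hcard]; exact le_of_eq (by ring))
  set S : Matrix (Fin (2 * m)) (Fin (2 * m)) ℤ :=
    Matrix.of fun a b => x (e.symm b).1 (e.symm b).2 a with hSdef
  have hSB : Sᵀ * B * S = weightGram e := by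
    ext a b
    rw [← col_bilin]
    obtain ⟨⟨i, k⟩, rfl⟩ := e.surjective a
    obtain ⟨⟨j, l⟩, rfl⟩ := e.surjective b
    have h1 : ∀ i k, S.col (e (i, k)) = x i k := by
      intro i k
      ext a
      simp [hSdef]
    rw [h1, h1, hx]
    simp only [weightGram, onesGram, Matrix.sub_apply, Matrix.smul_apply, Matrix.of_apply,
      Matrix.one_apply, e.injective.eq_iff, Equiv.symm_apply_apply, Prod.mk.injEq, smul_eq_mul]
    split_ifs <;> simp_all
  have hdet : B.det = (weightGram e).det := by rw [H.det, G.level.det]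
  have hu := isUnit_of_det_sq_mul hSB hdet (by rw [G.level.det]; positivity)
  refine exists_glue_basis e (T := S⁻¹) ?_ fun t => ?_
  · rw [← hSB, transpose_nonsing_inv, Matrix.mul_assoc, Matrix.mul_assoc, Matrix.mul_assoc,
      mul_nonsing_inv _ hu, Matrix.mul_one, ← Matrix.mul_assoc, nonsing_inv_mul _ (by
        rwa [det_transpose]), Matrix.one_mul]
  · exact iff_of_true (inCode_of_ge hq e t) ⟨S *ᵥ t, by
      rw [mulVec_mulVec, nonsing_inv_mul _ hu, one_mulVec]⟩

end UniqueFive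

section Quotient

variable {n : ℕ} {T : Matrix (Fin n) (Fin n) ℤ}

/-- The sublattice of `ℤⁿ` spanned by the columns of `T`. -/
def colLattice (T : Matrix (Fin n) (Fin n) ℤ) : Submodule ℤ (Fin n → ℤ) :=
  LinearMap.range T.mulVecLin

theorem mem_colLattice {t : Fin n → ℤ} : t ∈ colLattice T ↔ ∃ c, t = T *ᵥ c := by
  simp only [colLattice, LinearMap.mem_range, mulVecLin_apply, eq_comm]

theorem card_quotient_colLattice (hT : Function.Injective T.mulVec) :
    Nat.card ((Fin n → ℤ) ⧸ colLattice T) = T.det.natAbs := by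
  have hT' : Function.Injective T.mulVecLin := hT
  let f : (Fin n → ℤ) ≃+ colLattice T := (LinearEquiv.ofInjective T.mulVecLin hT').toAddEquiv
  have h : (colLattice T).subtype ∘ₗ AddMonoidHom.toIntLinearMap (f : (Fin n → ℤ) →+ colLattice T) =
      Matrix.toLin' T := by
    ext x
    rfl
  rw [← Submodule.natAbs_det_equiv (colLattice T) f, h, LinearMap.det_toLin']

theorem mk_eq_sum (N : Submodule ℤ (Fin n → ℤ)) (t : Fin n → ℤ) :
    (N.mkQ t) = ∑ a, t a • N.mkQ (Pi.single a 1) := by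
  conv_lhs => rw [← Finset.univ_sum_single t, map_sum]
  refine Finset.sum_congr rfl fun a _ => ?_
  rw [← map_smul, ← Pi.single_smul, smul_eq_mul, mul_one]

theorem nonempty_basis_of_card {A : Type*} [AddCommGroup A] {p k : ℕ} [Fact p.Prime]
    [Module (ZMod p) A] (hA : Nat.card A = p ^ k) : Nonempty (Module.Basis (Fin k) (ZMod p) A) := by
  have hpos : 0 < p ^ k := pow_pos (Fact.out : p.Prime).pos k
  have hfin : Finite A := Nat.finite_of_card_ne_zero (by omega)
  have h1 := FiniteField.pow_finrank_eq_natCard p A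
  rw [hA] at h1
  have h2 := Nat.pow_right_injective (Fact.out : p.Prime).two_le h1
  have hf : Module.Finite (ZMod p) A := Module.Finite.of_finite
  exact ⟨Module.finBasisOfFinrankEq (ZMod p) A h2⟩

/-- An elementary abelian group of order `p ^ k`. -/
theorem nonempty_addEquiv_pi {A : Type*} [AddCommGroup A] {p k : ℕ} [Fact p.Prime]
    (hA : Nat.card A = p ^ k) (hp : ∀ x : A, p • x = 0) : Nonempty (A ≃+ (Fin k → ZMod p)) := by
  let _ : Module (ZMod p) A := AddCommGroup.zmodModule hp
  obtain ⟨b⟩ := nonempty_basis_of_card (p := p) hA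
  exact ⟨b.equivFun.toAddEquiv⟩

end Quotient

section Transport

variable {q r m : ℕ} (e : Fin r × Fin q ≃ Fin (2 * m))

theorem weightGram_apply (a b : Fin (2 * m)) : weightGram e a b =
    (if a = b then (q : ℤ) + 1 else 0) - if (e.symm a).1 = (e.symm b).1 then 1 else 0 := by
  rw [weightGram, Matrix.sub_apply, Matrix.smul_apply, Matrix.one_apply, onesGram, of_apply]
  simp

theorem gram_of_root_frame {B C W : Matrix (Fin (2 * m)) (Fin (2 * m)) ℤ}
    (H : IsLevel (q + 1) m B C) (hW : Wᵀ * C * W = rootGram e) (hdet : (rootGram e).det ≠ 0) :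
    W * weightGram e * Wᵀ = B := by
  have hd : W.det ≠ 0 := by
    intro h
    apply hdet
    rw [← hW, det_mul, h, mul_zero]
  have hp : ((q : ℤ) + 1) ≠ 0 := by positivity
  have hBC : B * C = ((q : ℤ) + 1) • 1 := by
    have := H.mul
    push_cast at this
    exact this
  have hCB : C * B = ((q : ℤ) + 1) • 1 := by
    have := H.mul'
    push_cast at this
    exact this
  have h1 : (W * weightGram e * Wᵀ * C) * W = (((q : ℤ) + 1) • (1 : Matrix _ _ ℤ)) * W := by
    rw [show W * weightGram e * Wᵀ * C * W = W * (weightGram e * (Wᵀ * C * W)) by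
      simp only [Matrix.mul_assoc], hW, weightGram_mul_rootGram, Matrix.mul_smul,
      Matrix.smul_mul, Matrix.mul_one, Matrix.one_mul]
  have h2 := congrArg (· * W.adjugate) h1
  simp only [Matrix.mul_assoc, mul_adjugate, Matrix.mul_smul, Matrix.mul_one] at h2
  have h3 := smul_right_injective _ hd h2
  have h4 := congrArg (· * B) h3
  simp only [Matrix.mul_assoc, hCB, Matrix.mul_smul, Matrix.mul_one, Matrix.smul_mul,
    Matrix.one_mul] at h4
  have h5 := smul_right_injective _ hp h4
  simpa only [Matrix.mul_assoc] using h5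

theorem det_sq_of_root_frame {B C W : Matrix (Fin (2 * m)) (Fin (2 * m)) ℤ}
    (H : IsLevel (q + 1) m B C) (hW : W * weightGram e * Wᵀ = B) (hq : 0 < q) {k : ℕ}
    (hk : (q - 1) * r + 2 * k = m + 2) : W.det.natAbs = (q + 1) ^ k := by
  have h := congrArg Matrix.det hW
  rw [det_mul, det_mul, det_transpose, det_weightGram e hq, H.det, ← hk, pow_add] at h
  have hp : ((q : ℤ) + 1) ^ ((q - 1) * r) ≠ 0 := by positivity
  have h1 : W.det ^ 2 = (((q + 1) ^ k : ℕ) : ℤ) ^ 2 := by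
    refine mul_right_cancel₀ hp ?_
    push_cast at h ⊢
    linear_combination h
  have := Int.natAbs_eq_iff_sq_eq.mpr h1
  rwa [Int.natAbs_natCast] at this

end Transport

section Ternary

theorem ternary_sign {x y : ZMod 3} (hx : x ≠ 0) (hy : y ≠ 0) (h : x + y ≠ 0) : x = y := by
  revert x y
  decide

theorem exists_sign {x : ZMod 3} (hx : x ≠ 0) : ∃ s : ℤ, s * s = 1 ∧ (s : ZMod 3) = x := by
  have : x = 1 ∨ x = -1 := by
    revert x
    decide
  rcases this with rfl | rfl
  · exact ⟨1, by norm_num, by norm_num⟩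
  · exact ⟨-1, by norm_num, by norm_num⟩

/-- A sublattice of index `3` of the ternary weight lattice with minimum `4` is the glue lattice
up to signs. -/
theorem exists_ternary_realization {B T : Matrix (Fin (2 * 6)) (Fin (2 * 6)) ℤ}
    (hT : Tᵀ * weightGram ternaryIndex * T = B) (hdet : T.det.natAbs = 3)
    (hmin : ∀ v : Fin (2 * 6) → ℤ, v ≠ 0 → 4 ≤ qi B v) :
    ∃ T' : Matrix (Fin (2 * 6)) (Fin (2 * 6)) ℤ, T'ᵀ * weightGram ternaryIndex * T' = B ∧
      ∀ t, InCode ternaryIndex t ↔ ∃ c, t = T' *ᵥ c := by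
  have hinj : Function.Injective T.mulVec := by
    refine mulVec_injective_of_mul_eq (P := T.adjugate) (k := T.det) ?_ (mul_adjugate T)
    intro h
    simp [h] at hdet
  obtain ⟨φ⟩ := nonempty_addEquiv_pi (A := (Fin (2 * 6) → ℤ) ⧸ colLattice T) (p := 3) (k := 1)
    (by rw [card_quotient_colLattice hinj, hdet, pow_one]) (fun x => by
      have := card_nsmul_eq_zero' (G := (Fin (2 * 6) → ℤ) ⧸ colLattice T) (x := x)
      rwa [card_quotient_colLattice hinj, hdet] at this)
  set χ : (Fin (2 * 6) → ℤ) → ZMod 3 := fun t => φ ((colLattice T).mkQ t) 0 with hχ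
  have hker : ∀ t, χ t = 0 ↔ ∃ c, t = T *ᵥ c := by
    intro t
    rw [← mem_colLattice, ← Submodule.Quotient.mk_eq_zero, ← map_eq_zero_iff φ φ.injective,
      funext_iff, Fin.forall_fin_one]
    rfl
  have hadd : ∀ t u, χ (t + u) = χ t + χ u := by
    intro t u
    simp [hχ]
  have hsum : ∀ t, χ t = ∑ a, (t a : ZMod 3) * χ (Pi.single a 1) := by
    intro t
    simp only [hχ]
    rw [mk_eq_sum, map_sum, Finset.sum_apply]
    refine Finset.sum_congr rfl fun a _ => ?_
    rw [map_zsmul, Pi.smul_apply, zsmul_eq_mul]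
  have hsmall : ∀ t, t ≠ 0 → qi (weightGram ternaryIndex) t < 4 → χ t ≠ 0 := by
    intro t ht hlt h
    obtain ⟨c, rfl⟩ := (hker t).mp h
    have hc : c ≠ 0 := by
      rintro rfl
      exact ht (mulVec_zero T)
    have := hmin c hc
    rw [← hT, qi_mulVec] at this
    omega
  have hone : ∀ a, χ (Pi.single a 1) ≠ 0 := by
    intro a
    refine hsmall _ (by simp) ?_
    rw [qi, mulVec_single_one, single_one_dotProduct, col_apply, weightGram_diag]
    norm_num
  have hpair : ∀ i, χ (Pi.single (ternaryIndex (i, 0)) 1) =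
      χ (Pi.single (ternaryIndex (i, 1)) 1) := by
    intro i
    refine ternary_sign (hone _) (hone _) ?_
    rw [← hadd]
    have hne : ternaryIndex (i, 0) ≠ ternaryIndex (i, 1) := by
      simp [ternaryIndex.injective.eq_iff]
    refine hsmall _ ?_ ?_
    · intro h
      have := congrFun h (ternaryIndex (i, 0))
      simp [hne] at this
    · rw [qi, mulVec_add, mulVec_single_one, mulVec_single_one, add_dotProduct, dotProduct_add,
        dotProduct_add, single_one_dotProduct, single_one_dotProduct, single_one_dotProduct,
        single_one_dotProduct]
      simp [weightGram_apply, hne, hne.symm]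
  choose σ hσ hσχ using fun i => exists_sign (hone (ternaryIndex (i, 0)))
  set s : Fin (2 * 6) → ℤ := fun a => σ (ternaryIndex.symm a).1 with hs
  have hs1 : ∀ a, s a * s a = 1 := fun a => hσ _
  have hsχ : ∀ a, χ (Pi.single a 1) = s a := by
    intro a
    obtain ⟨⟨i, k⟩, rfl⟩ := ternaryIndex.surjective a
    simp only [hs, Equiv.symm_apply_apply, hσχ]
    fin_cases k
    · rfl
    · exact (hpair i).symm
  have hDD : (diagonal s) * (diagonal s) = 1 := by
    rw [diagonal_mul_diagonal, ← diagonal_one]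
    exact congrArg _ (funext hs1)
  have hD : diagonal s * weightGram ternaryIndex * diagonal s = weightGram ternaryIndex := by
    ext a b
    rw [mul_diagonal, diagonal_mul]
    by_cases h : (ternaryIndex.symm a).1 = (ternaryIndex.symm b).1
    · have : s a = s b := by simp only [hs, h]
      rw [this, mul_right_comm, hs1, one_mul]
    · have hab : a ≠ b := by
        rintro rfl
        exact h rfl
      simp [weightGram_apply, h, hab]
  refine ⟨diagonal s * T, ?_, fun t => ?_⟩
  · rw [transpose_mul, diagonal_transpose, ← hT]
    conv_rhs => rw [← hD]
    simp only [Matrix.mul_assoc]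
  · have h1 : χ (diagonal s *ᵥ t) = ((∑ a, t a : ℤ) : ZMod 3) := by
      rw [hsum]
      push_cast
      refine Finset.sum_congr rfl fun a _ => ?_
      rw [hsχ, mulVec_diagonal, ← Int.cast_mul, mul_right_comm, hs1, one_mul]
    rw [inCode_ternary_iff, ← Nat.cast_ofNat, ← ZMod.intCast_zmod_eq_zero_iff_dvd, ← h1, hker]
    refine exists_congr fun c => ⟨fun h => ?_, fun h => ?_⟩
    · rw [← mulVec_mulVec, ← h, mulVec_mulVec, hDD, one_mulVec]
    · rw [h, mulVec_mulVec, ← Matrix.mul_assoc, hDD, Matrix.one_mul]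

end Ternary

section Binary

theorem weightGram_binary : weightGram binaryIndex = 1 := by
  ext a b
  have h : (binaryIndex.symm a).1 = (binaryIndex.symm b).1 ↔ a = b := by
    constructor
    · intro h
      exact binaryIndex.symm.injective (Prod.ext h (Subsingleton.elim _ _))
    · rintro rfl
      rfl
  rw [weightGram_apply, Matrix.one_apply]
  simp only [h]
  split_ifs <;> norm_num

/-- The binary digits of a position. -/
def binaryDigits (a : Fin (2 * 8)) (j : Fin 4) : ZMod 2 := if a.1.testBit j.1 then 1 else 0

theorem binaryDigits_bijective : Function.Bijective binaryDigits := by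
  rw [Fintype.bijective_iff_injective_and_card]
  refine ⟨?_, by simp⟩
  have h : ∀ a b : Fin (2 * 8), (∀ j, binaryDigits a j = binaryDigits b j) → a = b := by
    unfold binaryDigits
    decide +kernel
  exact fun a b hab => h a b fun j => congrFun hab j

theorem inCode_binary_iff_digits (t : Fin (2 * 8) → ℤ) : InCode binaryIndex t ↔
    ∑ a, (t a : ZMod 2) = 0 ∧ ∀ j, ∑ a, (t a : ZMod 2) * binaryDigits a j = 0 := by
  rw [inCode_binary_iff, Fin.forall_fin_succ' (n := 4), and_comm]
  have h2 : ∀ z : ℤ, (z : ZMod 2) = 0 ↔ (2 : ℤ) ∣ z := fun z =>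
    ZMod.intCast_zmod_eq_zero_iff_dvd z 2
  simp only [← h2]
  refine and_congr (Eq.congr ?_ rfl) (forall_congr' fun j => Eq.congr ?_ rfl)
  · rw [mulVec, dotProduct, Int.cast_sum]
    refine Finset.sum_congr rfl fun i _ => ?_
    simp [binaryCheck]
  · rw [mulVec, dotProduct, Int.cast_sum]
    refine Finset.sum_congr rfl fun i _ => ?_
    by_cases h : i.1.testBit j.1 <;> simp [binaryCheck, binaryDigits, j.2.ne, h]

theorem card_ker_of_surjective {A : Type*} [AddCommGroup A] {n : ℕ} (f : A →ₗ[ℤ] ZMod n)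
    (hf : Function.Surjective f) : Nat.card A = Nat.card (LinearMap.ker f) * n := by
  rw [Submodule.card_eq_card_quotient_mul_card (LinearMap.ker f),
    Nat.card_congr (f.quotKerEquivOfSurjective hf).toEquiv, Nat.card_zmod]

/-- A sublattice of `ℤ¹⁶` of index `32` containing `2ℤ¹⁶`, even and with minimum `4`, is the
construction A lattice of the extended Hamming code up to a permutation. -/
theorem exists_binary_realization {B T P : Matrix (Fin (2 * 8)) (Fin (2 * 8)) ℤ}
    (hT : Tᵀ * weightGram binaryIndex * T = B) (hdet : T.det.natAbs = 32)
    (hP : T * P = (2 : ℤ) • 1) (heven : ∀ v, 2 ∣ qi B v)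
    (hmin : ∀ v : Fin (2 * 8) → ℤ, v ≠ 0 → 4 ≤ qi B v) :
    ∃ T' : Matrix (Fin (2 * 8)) (Fin (2 * 8)) ℤ, T'ᵀ * weightGram binaryIndex * T' = B ∧
      ∀ t, InCode binaryIndex t ↔ ∃ c, t = T' *ᵥ c := by
  have hinj : Function.Injective T.mulVec := mulVec_injective_of_mul_eq (by norm_num) hP
  have hnorm : ∀ c, ∑ a, (T *ᵥ c) a ^ 2 = qi B c := by
    intro c
    rw [← hT, qi_mulVec, qi_weightGram_binary]
  set Q := (Fin (2 * 8) → ℤ) ⧸ colLattice T with hQ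
  have hcardQ : Nat.card Q = 32 := by rw [hQ, card_quotient_colLattice hinj, hdet]
  have hzero : ∀ t, (colLattice T).mkQ t = 0 ↔ ∃ c, t = T *ᵥ c := by
    intro t
    rw [← mem_colLattice, Submodule.mkQ_apply, Submodule.Quotient.mk_eq_zero]
  have htwo : ∀ x : Q, 2 • x = 0 := by
    intro x
    obtain ⟨t, rfl⟩ := (colLattice T).mkQ_surjective x
    rw [← map_nsmul, hzero]
    refine ⟨P *ᵥ t, ?_⟩
    rw [mulVec_mulVec, hP, smul_mulVec, one_mulVec, ← natCast_zsmul]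
    rfl
  let par : (Fin (2 * 8) → ℤ) →ₗ[ℤ] ZMod 2 := AddMonoidHom.toIntLinearMap
    { toFun := fun t => ∑ a, (t a : ZMod 2)
      map_zero' := by simp
      map_add' := fun t u => by simp [Finset.sum_add_distrib] }
  have hpar : ∀ t, par t = ∑ a, (t a : ZMod 2) := fun t => rfl
  have hle : colLattice T ≤ LinearMap.ker par := by
    intro t ht
    obtain ⟨c, rfl⟩ := mem_colLattice.mp ht
    have hsq : ∀ x : ZMod 2, x ^ 2 = x := by decide
    have h1 : par (T *ᵥ c) = ((qi B c : ℤ) : ZMod 2) := by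
      rw [hpar, ← hnorm]
      push_cast
      exact Finset.sum_congr rfl fun a _ => (hsq _).symm
    rw [LinearMap.mem_ker, h1]
    exact (ZMod.intCast_zmod_eq_zero_iff_dvd _ 2).mpr (heven c)
  let ψ : Q →ₗ[ℤ] ZMod 2 := (colLattice T).liftQ par hle
  have hψ : ∀ t, ψ ((colLattice T).mkQ t) = par t := fun t => rfl
  have hparone : ∀ a, par (Pi.single a 1) = 1 := by
    intro a
    rw [hpar, Finset.sum_eq_single a (fun b _ hb => by simp [hb]) (by simp)]
    simp
  have hsurj : Function.Surjective ψ := by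
    intro z
    have hz : z = 0 ∨ z = 1 := by
      revert z
      decide
    rcases hz with rfl | rfl
    · exact ⟨0, map_zero _⟩
    · exact ⟨(colLattice T).mkQ (Pi.single 0 1), by rw [hψ, hparone]⟩
  have hcardA : Nat.card (LinearMap.ker ψ) = 2 ^ 4 := by
    have := card_ker_of_surjective ψ hsurj
    rw [hcardQ] at this
    omega
  obtain ⟨φ⟩ := nonempty_addEquiv_pi (p := 2) hcardA fun x =>
    Subtype.ext (by rw [Submodule.coe_smul_of_tower, htwo, Submodule.coe_zero])
  let δ : Fin (2 * 8) → LinearMap.ker ψ := fun a =>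
    ⟨(colLattice T).mkQ (Pi.single a 1) - (colLattice T).mkQ (Pi.single 0 1), by
      rw [LinearMap.mem_ker, map_sub, hψ, hψ, hparone, hparone, sub_self]⟩
  have hδ : Function.Injective δ := by
    intro a b hab
    by_contra hne
    have h1 : (colLattice T).mkQ (Pi.single a 1 - Pi.single b 1) = 0 := by
      have := congrArg Subtype.val hab
      rw [map_sub, sub_eq_zero]
      exact sub_left_inj.mp this
    obtain ⟨c, hc⟩ := (hzero _).mp h1
    have h2 : qi B c = 2 := by
      rw [← hnorm, ← hc]
      rw [← Finset.add_sum_erase _ _ (Finset.mem_univ a),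
        ← Finset.add_sum_erase _ _ (Finset.mem_erase.mpr ⟨Ne.symm hne, Finset.mem_univ b⟩),
        Finset.sum_eq_zero fun x hx => ?_]
      · simp [hne, Ne.symm hne]
      · simp only [Finset.mem_erase] at hx
        simp [hx.1, hx.2.1]
    have h3 : c ≠ 0 := by
      rintro rfl
      simp [qi] at h2
    have := hmin c h3
    omega
  have hlam : Function.Bijective fun a => φ (δ a) := by
    rw [Fintype.bijective_iff_injective_and_card]
    exact ⟨φ.injective.comp hδ, by simp⟩
  set π : Fin (2 * 8) ≃ Fin (2 * 8) :=
    (Equiv.ofBijective _ hlam).trans (Equiv.ofBijective _ binaryDigits_bijective).symm with hπdef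
  have hπ : ∀ a, binaryDigits (π a) = φ (δ a) := by
    intro a
    rw [hπdef, Equiv.trans_apply]
    exact (Equiv.ofBijective _ binaryDigits_bijective).apply_symm_apply _
  have hker : ∀ t, (∃ c, t = T *ᵥ c) ↔ ∑ a, (t a : ZMod 2) = 0 ∧
      ∀ j, ∑ a, (t a : ZMod 2) * φ (δ a) j = 0 := by
    intro t
    have h1 : ∀ t, par t = 0 → (colLattice T).mkQ t = ((∑ a, t a • δ a : LinearMap.ker ψ) : Q) := by
      intro t ht
      obtain ⟨z, hz⟩ := (ZMod.intCast_zmod_eq_zero_iff_dvd (∑ a, t a) 2).mp (by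
        rw [← ht, hpar, Int.cast_sum])
      rw [AddSubmonoidClass.coe_finsetSum, mk_eq_sum]
      have h2 : ∀ a, ((t a • δ a : LinearMap.ker ψ) : Q) = t a • (colLattice T).mkQ (Pi.single a 1) -
          t a • (colLattice T).mkQ (Pi.single 0 1) := fun a => smul_sub _ _ _
      rw [Finset.sum_congr rfl fun a _ => h2 a, Finset.sum_sub_distrib, ← Finset.sum_smul, hz,
        mul_comm ((2 : ℕ) : ℤ) z, mul_smul, natCast_zsmul, htwo, smul_zero, sub_zero]
    rw [← hzero, ← hpar]
    constructor
    · intro ht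
      have hp0 : par t = 0 := by rw [← hψ, ht, map_zero]
      refine ⟨hp0, fun j => ?_⟩
      rw [h1 t hp0, Submodule.coe_eq_zero] at ht
      have := congrFun (congrArg φ ht) j
      rw [map_zero, map_sum, Finset.sum_apply] at this
      simpa [zsmul_eq_mul] using this
    · rintro ⟨hp0, hj⟩
      rw [h1 t hp0, Submodule.coe_eq_zero, ← map_eq_zero_iff φ φ.injective, map_sum]
      ext j
      rw [Finset.sum_apply]
      simpa [zsmul_eq_mul] using hj j
  refine ⟨T.submatrix π.symm id, ?_, fun t => ?_⟩
  · rw [← hT, weightGram_binary, Matrix.mul_one, Matrix.mul_one, transpose_submatrix,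
      submatrix_mul_equiv, submatrix_id_id]
  · have h1 : ∀ c, t = T.submatrix π.symm id *ᵥ c ↔ t ∘ π = T *ᵥ c := by
      intro c
      have h2 : T.submatrix π.symm id *ᵥ c = (T *ᵥ c) ∘ π.symm := rfl
      rw [h2, Equiv.eq_comp_symm]
    simp only [h1]
    rw [inCode_binary_iff_digits, hker, ← π.sum_comp]
    refine and_congr Iff.rfl (forall_congr' fun j => ?_)
    rw [← π.sum_comp]
    simp only [hπ, Function.comp_apply]

end Binary

section DualShell

theorem rootGram_apply_apply {q r d : ℕ} (e : Fin r × Fin q ≃ Fin d) (i j : Fin r) (k l : Fin q) :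
    rootGram e (e (i, k)) (e (j, l)) =
      (if i = j ∧ k = l then 1 else 0) + if i = j then 1 else 0 := by
  simp only [rootGram, Matrix.add_apply, Matrix.one_apply, onesGram, of_apply,
    e.injective.eq_iff, Equiv.symm_apply_apply, Prod.mk.injEq]

variable {q r m : ℕ} {B C : Matrix (Fin (2 * m)) (Fin (2 * m)) ℤ}

theorem exists_root_frame (e : Fin r × Fin q ≃ Fin (2 * m)) (H : IsLevel (q + 1) m B C)
    (hq : 0 < q) {k : ℕ} (hk : (q - 1) * r + 2 * k = m + 2) (y : Fin r → Fin q → Fin (2 * m) → ℤ)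
    (hy : ∀ i k j l, y i k ⬝ᵥ C *ᵥ y j l = rootGram e (e (i, k)) (e (j, l))) :
    ∃ T P : Matrix (Fin (2 * m)) (Fin (2 * m)) ℤ, Tᵀ * weightGram e * T = B ∧
      T.det.natAbs = (q + 1) ^ k ∧ T * P = rootGram e := by
  set W : Matrix (Fin (2 * m)) (Fin (2 * m)) ℤ :=
    Matrix.of fun a b => y (e.symm b).1 (e.symm b).2 a with hWdef
  have hW : Wᵀ * C * W = rootGram e := by
    ext a b
    rw [← col_bilin]
    obtain ⟨⟨i, k⟩, rfl⟩ := e.surjective a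
    obtain ⟨⟨j, l⟩, rfl⟩ := e.surjective b
    have h1 : ∀ i k, W.col (e (i, k)) = y i k := by
      intro i k
      ext a
      simp [hWdef]
    rw [h1, h1, hy]
  have hdet : (rootGram e).det ≠ 0 := by
    intro h
    have h1 := congrArg Matrix.det (weightGram_mul_rootGram e)
    rw [det_mul, h, mul_zero, det_smul, det_one, mul_one] at h1
    have h2 : ((q : ℤ) + 1) ^ Fintype.card (Fin (2 * m)) ≠ 0 := by positivity
    exact h2 h1.symm
  have hB := gram_of_root_frame e H hW hdet
  refine ⟨Wᵀ, C * W, by rwa [transpose_transpose], ?_, by rw [← Matrix.mul_assoc, hW]⟩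
  rw [det_transpose]
  exact det_sq_of_root_frame e H hB hq hk

theorem dual_shell_tight {p s : ℕ} (H : IsLevel p m B C) (hm : m ≠ 0)
    (hmin : ∀ v : Fin (2 * m) → ℤ, v ≠ 0 → (2 * s : ℤ) ≤ qi B v)
    (hk : (p + 1) * (m + 2) < 12 * (s + 1)) (hcard : (shell C 2).card = 2 * p * m)
    (x y : Fin (2 * m) → ℤ) :
    ∑ u ∈ shell C 2, (x ⬝ᵥ C *ᵥ u) * (y ⬝ᵥ C *ᵥ u) = 2 * p * (x ⬝ᵥ C *ᵥ y) := by
  have h := H.design (shell C 2) (ρ := 2) (fun a ha => (H.harmonic_sums hmin ha (Or.inl hk)).1) (by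
    rw [Finset.sum_congr rfl fun w hw => H.mem_shell_C.mp hw, Finset.sum_const, hcard,
      nsmul_eq_mul]
    push_cast
    ring) hm (C *ᵥ x) (C *ᵥ y)
  have hs : ∀ u w : Fin (2 * m) → ℤ, (C *ᵥ u) ⬝ᵥ w = u ⬝ᵥ C *ᵥ w := by
    intro u w
    rw [dotProduct_comm, bilin_comm H.symmC]
  simp only [hs] at h
  rw [h, H.mulVec_mulVec, mulVec_smul, dotProduct_smul, smul_eq_mul, mul_assoc]

end DualShell

section UniqueSmall

theorem unique_ternary {B C : Matrix (Fin (2 * 6)) (Fin (2 * 6)) ℤ} (H : IsLevel (2 + 1) 6 B C)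
    (hmin : ∀ v : Fin (2 * 6) → ℤ, v ≠ 0 → (2 * (2 : ℕ) : ℤ) ≤ qi B v) :
    ∃ b : Fin (2 * 6) → GVec (2 + 1) 6,
      (∀ i, MemGlue (2 + 1) 6 (b i)) ∧
      (∀ x, MemGlue (2 + 1) 6 x → ∃ c : Fin (2 * 6) → ℤ, x = ∑ i, (c i : ℚ) • b i) ∧
      ∀ i j, blN (2 + 1) 6 (b i) (b j) = (B i j : ℚ) := by
  have hcard : (shell C 2).card = 36 := by
    rw [← shell_ternary_card]
    exact (IsLevel.shell_card_eq H glueModel_ternary.level hmin glueModel_ternary.min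
      (by norm_num) (by norm_num)).1
  have key := dual_shell_tight H (by norm_num) hmin (by norm_num) (by rw [hcard])
  have tight : TightShell (2 + 1) (fun v w => v ⬝ᵥ C *ᵥ w) (shell C 2) :=
    { symm := fun x y => bilin_comm H.symmC x y
      neg := fun x y => neg_dotProduct _ _
      neg_mem := fun x hx => by
        rw [H.mem_shell_C] at hx ⊢
        rw [qi_neg, hx]
      norm := fun x hx => by
        have := H.mem_shell_C.mp hx
        rw [qi] at this
        rw [this]
        norm_num
      tight := fun x _ y _ => key x y }
  obtain ⟨x, -, hx⟩ := tight.exists_blocks (q := 2) (r := 6) (by norm_num) rfl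
    (by rw [hcard])
  let s : Fin 2 → ℤ := ![1, -1]
  obtain ⟨T, -, hT, hdet, -⟩ := exists_root_frame ternaryIndex H (by norm_num) (k := 1) (by norm_num)
    (fun i k => s k • x i k) (by
      intro i k j l
      rw [mulVec_smul, smul_dotProduct, dotProduct_smul, hx, rootGram_apply_apply]
      by_cases hij : i = j
      · simp only [hij, true_and, if_true]
        fin_cases k <;> fin_cases l <;> simp [s]
      · simp [hij])
  obtain ⟨T', hT', hcode⟩ := exists_ternary_realization hT (by simpa using hdet)
    (fun v hv => by simpa using hmin v hv)
  exact exists_glue_basis ternaryIndex hT' hcode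

theorem unique_binary {B C : Matrix (Fin (2 * 8)) (Fin (2 * 8)) ℤ} (H : IsLevel (1 + 1) 8 B C)
    (hmin : ∀ v : Fin (2 * 8) → ℤ, v ≠ 0 → (2 * (2 : ℕ) : ℤ) ≤ qi B v) :
    ∃ b : Fin (2 * 8) → GVec (1 + 1) 16,
      (∀ i, MemGlue (1 + 1) 16 (b i)) ∧
      (∀ x, MemGlue (1 + 1) 16 x → ∃ c : Fin (2 * 8) → ℤ, x = ∑ i, (c i : ℚ) • b i) ∧
      ∀ i j, blN (1 + 1) 16 (b i) (b j) = (B i j : ℚ) := by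
  have hcard : (shell C 2).card = 32 := by
    rw [← shell_binary_card]
    exact (IsLevel.shell_card_eq H glueModel_binary.level hmin glueModel_binary.min
      (by norm_num) (by norm_num)).1
  have key := dual_shell_tight H (by norm_num) hmin (by norm_num) (by rw [hcard])
  have hnorm : ∀ v ∈ shell C 2, v ⬝ᵥ C *ᵥ v = 2 := fun v hv => H.mem_shell_C.mp hv
  have hD : ∀ v ∈ shell C 2, ((shell C 2).filter fun u => v ⬝ᵥ C *ᵥ u ≠ 0).card ≤ 2 := by
    intro v hv
    have hneg : -v ∈ shell C 2 := by
      rw [H.mem_shell_C, qi_neg]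
      exact hnorm v hv
    have hne : v ≠ -v := by
      intro h
      have h1 := hnorm v hv
      have h2 : v ⬝ᵥ C *ᵥ (-v) = -2 := by rw [mulVec_neg, dotProduct_neg, h1]
      rw [← h, h1] at h2
      norm_num at h2
    refine le_trans (Finset.card_le_card (t := {v, -v}) fun u hu => ?_) Finset.card_le_two
    by_contra hcon
    simp only [Finset.mem_insert, Finset.mem_singleton, not_or] at hcon
    obtain ⟨huX, hu0⟩ := Finset.mem_filter.mp hu
    have hsub : ({u, v, -v} : Finset (Fin (2 * 8) → ℤ)) ⊆ shell C 2 := by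
      intro w hw
      simp only [Finset.mem_insert, Finset.mem_singleton] at hw
      rcases hw with rfl | rfl | rfl
      exacts [huX, hv, hneg]
    have h1 := Finset.sum_le_sum_of_subset_of_nonneg (f := fun u => (v ⬝ᵥ C *ᵥ u) * (v ⬝ᵥ C *ᵥ u))
      hsub fun u _ _ => mul_self_nonneg _
    rw [key, hnorm v hv, Finset.sum_insert (by simp [hcon.1, hcon.2]), Finset.sum_pair hne,
      mulVec_neg, dotProduct_neg, hnorm v hv] at h1
    have := mul_self_pos.mpr hu0
    push_cast at h1
    linarith
  obtain ⟨w, hwX, hw⟩ := exists_orthogonal_family (fun x y => bilin_comm H.symmC x y)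
    (by norm_num : 0 < 2) hD 16 (by rw [hcard])
  obtain ⟨T, P, hT, hdet, hP⟩ := exists_root_frame binaryIndex H (by norm_num) (k := 5)
    (by norm_num) (fun i _ => w i) (by
      intro i k j l
      rw [rootGram_apply_apply]
      by_cases hij : i = j
      · simp [hij, hnorm _ (hwX j), Subsingleton.elim k l]
      · simp [hij, hw i j hij])
  have hroot : rootGram binaryIndex = (2 : ℤ) • 1 := by
    have := weightGram_mul_rootGram binaryIndex
    rw [weightGram_binary, Matrix.one_mul] at this
    rw [this]
    norm_num
  obtain ⟨T', hT', hcode⟩ := exists_binary_realization hT (by simpa using hdet)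
    (by rw [hP, hroot]) (two_dvd_qi H.symmB H.evenB) (fun v hv => by simpa using hmin v hv)
  exact exists_glue_basis binaryIndex hT' hcode

end UniqueSmall

section Conclusion

theorem blN_sum {p r n : ℕ} (b : Fin n → GVec p r) (c : Fin n → ℚ) :
    blN p r (∑ i, c i • b i) (∑ i, c i • b i) = ∑ i, ∑ j, c i * (c j * blN p r (b i) (b j)) := by
  have hadd : ∀ (y : GVec p r) {x x' : GVec p r}, blN p r (x + x') y = blN p r x y + blN p r x' y := by
    intro y x x'
    simp only [blN, Pi.add_apply, add_mul, Finset.sum_add_distrib, mul_add]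
  have hsmul : ∀ (y : GVec p r) (a : ℚ) (x : GVec p r), blN p r (a • x) y = a * blN p r x y := by
    intro y a x
    simp only [blN, Pi.smul_apply, smul_eq_mul, mul_assoc, ← Finset.mul_sum]
    ring
  have hcomm : ∀ x y : GVec p r, blN p r x y = blN p r y x := by
    intro x y
    simp only [blN, mul_comm]
  have hsum : ∀ y : GVec p r, blN p r (∑ i, c i • b i) y = ∑ i, c i * blN p r (b i) y := by
    intro y
    have h : ∀ t : Finset (Fin n), blN p r (∑ i ∈ t, c i • b i) y =
        ∑ i ∈ t, c i * blN p r (b i) y := by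
      intro t
      induction t using Finset.induction_on with
      | empty => simp [blN]
      | insert i t hi ih => rw [Finset.sum_insert hi, Finset.sum_insert hi, hadd, hsmul, ih]
    exact h Finset.univ
  rw [hsum]
  refine Finset.sum_congr rfl fun i _ => ?_
  rw [hcomm, hsum, Finset.mul_sum]
  exact Finset.sum_congr rfl fun j _ => by rw [hcomm]

theorem glue_conclusion {p q r m s : ℕ} [NeZero p] (hpq : p = q + 1) (hs : 0 < s) {κ : ℚ} {κ' : ℤ}
    (hκ : κ = 2 * s) (hκ' : κ' = 2 * s) {e : Fin r × Fin q ≃ Fin (2 * m)}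
    {T A D : Matrix (Fin (2 * m)) (Fin (2 * m)) ℤ} (G : GlueModel e s T A D)
    (hu : ∀ B C : Matrix (Fin (2 * m)) (Fin (2 * m)) ℤ, IsLevel (q + 1) m B C →
      (∀ v : Fin (2 * m) → ℤ, v ≠ 0 → (2 * s : ℤ) ≤ qi B v) →
      ∃ b : Fin (2 * m) → GVec (q + 1) r,
        (∀ i, MemGlue (q + 1) r (b i)) ∧
        (∀ x, MemGlue (q + 1) r x → ∃ c : Fin (2 * m) → ℤ, x = ∑ i, (c i : ℚ) • b i) ∧
        ∀ i j, blN (q + 1) r (b i) (b j) = (B i j : ℚ)) :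
    (∀ x : GVec p r, MemGlue p r x → ∃ z : ℤ, nrmN p r x = 2 * z) ∧
    (∃ b : Fin (2 * m) → GVec p r,
      (∀ i, MemGlue p r (b i)) ∧
      (∀ x, MemGlue p r x → ∃ c : Fin (2 * m) → ℤ, x = ∑ i, (c i : ℚ) • b i) ∧
      (Matrix.of fun i j => blN p r (b i) (b j)).PosDef ∧
      (Matrix.of fun i j => blN p r (b i) (b j)).det = (p : ℚ) ^ (m + 2) ∧
      (∃ C : Matrix (Fin (2 * m)) (Fin (2 * m)) ℚ,
        (Matrix.of fun i j => blN p r (b i) (b j)) * C = (p : ℚ) • 1 ∧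
        (∀ i j, isInt (C i j)) ∧ ∀ i, ∃ z : ℤ, C i i = 2 * z)) ∧
    (∀ x : GVec p r, MemGlue p r x → x ≠ 0 → κ ≤ nrmN p r x) ∧
    (∃ x : GVec p r, MemGlue p r x ∧ nrmN p r x = κ) ∧
    (∀ B : Matrix (Fin (2 * m)) (Fin (2 * m)) ℤ, B.IsSymm → (∀ i, 2 ∣ B i i) →
      (B.map (Int.cast : ℤ → ℚ)).PosDef → B.det = (p : ℤ) ^ (m + 2) →
      (∃ C : Matrix (Fin (2 * m)) (Fin (2 * m)) ℤ,
        B * C = (p : ℤ) • 1 ∧ ∀ i, 2 ∣ C i i) →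
      ∃ v : Fin (2 * m) → ℤ, v ≠ 0 ∧ v ⬝ᵥ B.mulVec v ≤ κ') ∧
    (∀ B : Matrix (Fin (2 * m)) (Fin (2 * m)) ℤ, B.IsSymm → (∀ i, 2 ∣ B i i) →
      (B.map (Int.cast : ℤ → ℚ)).PosDef → B.det = (p : ℤ) ^ (m + 2) →
      (∃ C : Matrix (Fin (2 * m)) (Fin (2 * m)) ℤ,
        B * C = (p : ℤ) • 1 ∧ ∀ i, 2 ∣ C i i) →
      (∀ v : Fin (2 * m) → ℤ, v ≠ 0 → κ' ≤ v ⬝ᵥ B.mulVec v) →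
      ∃ b : Fin (2 * m) → GVec p r,
        (∀ i, MemGlue p r (b i)) ∧
        (∀ x, MemGlue p r x → ∃ c : Fin (2 * m) → ℤ, x = ∑ i, (c i : ℚ) • b i) ∧
        ∀ i j, blN p r (b i) (b j) = (B i j : ℚ)) := by
  subst hpq hκ hκ'
  have hcoord : ∀ x : GVec (q + 1) r, MemGlue (q + 1) r x →
      ∃ c, x = glueVec e (T *ᵥ c) ∧ nrmN (q + 1) r x = (qi A c : ℚ) := by
    intro x hx
    obtain ⟨t, rfl, ht⟩ := (memGlue_iff e x).mp hx
    obtain ⟨c, rfl⟩ := (G.code t).mp ht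
    exact ⟨c, rfl, by rw [nrmN_glueVec, ← G.gram, qi_mulVec]⟩
  have hattained : ∃ x : GVec (q + 1) r, MemGlue (q + 1) r x ∧ nrmN (q + 1) r x = 2 * (s : ℚ) := by
    obtain ⟨c, hc⟩ := G.attained
    refine ⟨glueVec e (T *ᵥ c), (memGlue_iff e _).mpr ⟨_, rfl, (G.code _).mpr ⟨c, rfl⟩⟩, ?_⟩
    rw [nrmN_glueVec, ← qi_mulVec, G.gram, hc]
    push_cast
    rfl
  have huniq : ∀ B : Matrix (Fin (2 * m)) (Fin (2 * m)) ℤ, B.IsSymm → (∀ i, 2 ∣ B i i) →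
      (B.map (Int.cast : ℤ → ℚ)).PosDef → B.det = ((q + 1 : ℕ) : ℤ) ^ (m + 2) →
      (∃ C : Matrix (Fin (2 * m)) (Fin (2 * m)) ℤ,
        B * C = ((q + 1 : ℕ) : ℤ) • 1 ∧ ∀ i, 2 ∣ C i i) →
      (∀ v : Fin (2 * m) → ℤ, v ≠ 0 → (2 * s : ℤ) ≤ qi B v) →
      ∃ b : Fin (2 * m) → GVec (q + 1) r,
        (∀ i, MemGlue (q + 1) r (b i)) ∧
        (∀ x, MemGlue (q + 1) r x → ∃ c : Fin (2 * m) → ℤ, x = ∑ i, (c i : ℚ) • b i) ∧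
        ∀ i j, blN (q + 1) r (b i) (b j) = (B i j : ℚ) := by
    rintro B hsymm heven hpos hdet ⟨C, hC, hCeven⟩ hmin
    exact hu B C ⟨G.level.prime, hsymm, heven, posDef_real_of_rat hpos, hdet, hC, hCeven⟩ hmin
  refine ⟨fun x hx => ?_, ?_, fun x hx hx0 => ?_, hattained, ?_, huniq⟩
  · obtain ⟨c, -, hc⟩ := hcoord x hx
    obtain ⟨z, hz⟩ := two_dvd_qi G.level.symmB G.level.evenB c
    exact ⟨z, by rw [hc, hz]; push_cast; rfl⟩
  · obtain ⟨b, hb, hspan, hgram⟩ := exists_glue_basis e G.gram G.code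
    have hof : (Matrix.of fun i j => blN (q + 1) r (b i) (b j)) = A.map (Int.cast : ℤ → ℚ) := by
      ext i j
      rw [of_apply, hgram, map_apply]
    refine ⟨b, hb, hspan, ?_, ?_, D.map Int.cast, ?_, fun i j => ⟨D i j, rfl⟩, fun i => ?_⟩
    · rw [hof]
      exact posDef_rat_of_real G.level.posB
    · rw [hof]
      have := (Int.castRingHom ℚ).map_det A
      rw [G.level.det] at this
      simpa using this.symm
    · rw [hof]
      have := congrArg (fun M : Matrix (Fin (2 * m)) (Fin (2 * m)) ℤ => M.map (Int.castRingHom ℚ))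
        G.level.mul
      simp only [Matrix.map_mul] at this
      refine this.trans ?_
      ext i j
      rw [map_apply, Matrix.smul_apply, Matrix.smul_apply, Matrix.one_apply, Matrix.one_apply]
      split_ifs <;> simp
    · obtain ⟨z, hz⟩ := G.level.evenC i
      exact ⟨z, by rw [map_apply, hz]; push_cast; rfl⟩
  · obtain ⟨c, rfl, hc⟩ := hcoord x hx
    have hc0 : c ≠ 0 := by
      rintro rfl
      apply hx0
      rw [mulVec_zero]
      funext i k
      refine Fin.lastCases ?_ (fun k => ?_) k <;> simp [glueVec]
    rw [hc]
    exact_mod_cast G.min c hc0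
  · intro B hsymm heven hpos hdet hC
    by_contra! hcon
    obtain ⟨b, -, hspan, hgram⟩ := huniq B hsymm heven hpos hdet hC fun v hv => (hcon v hv).le
    obtain ⟨x, hx, hnx⟩ := hattained
    obtain ⟨c, rfl⟩ := hspan x hx
    have hq : nrmN (q + 1) r (∑ i, (c i : ℚ) • b i) = (qi B c : ℚ) := by
      rw [nrmN_eq_blN, blN_sum, qi, dotProduct]
      push_cast
      refine Finset.sum_congr rfl fun i _ => ?_
      rw [mulVec, dotProduct, Int.cast_sum, Finset.mul_sum]
      refine Finset.sum_congr rfl fun j _ => ?_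
      rw [hgram]
      push_cast
      ring
    rw [hnx] at hq
    have hq' : (2 * s : ℤ) = qi B c := by exact_mod_cast hq
    have hc0 : c ≠ 0 := by
      rintro rfl
      simp only [qi, zero_dotProduct] at hq'
      omega
    exact absurd hq' (hcon c hc0).ne

end Conclusion

/-- the lattice `N = √p (A_q^r, G)` lies in the genus
`II_{2m,0}(p^{ε_p(m+2)})`, its minimal norm is `4` for `p = 2,3,5` and `6` for `p = 7`,
this is the largest possible minimal norm in this genus, and `N` is the unique lattice
in this genus with this minimal norm, up to isomorphism. -/
theorem glueLattice_genus_minimal_norm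
    (p q r m : ℕ) [NeZero p] (hp : p = 2 ∨ p = 3 ∨ p = 5 ∨ p = 7)
    (hq : q = p - 1) (hr : q * (p + 1) * r = 48) (hm : (p + 1) * m = 24) :
    -- N is in the genus II_{2m,0}(p^{ε_p(m+2)}): it is even, positive definite
    -- (immediate from the model), of rank 2m with determinant p^{m+2}, and of level p
    (∀ x : GVec p r, MemGlue p r x → ∃ z : ℤ, nrmN p r x = 2 * z) ∧
    (∃ b : Fin (2 * m) → GVec p r,
      (∀ i, MemGlue p r (b i)) ∧
      (∀ x, MemGlue p r x → ∃ c : Fin (2 * m) → ℤ, x = ∑ i, (c i : ℚ) • b i) ∧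
      (Matrix.of fun i j => blN p r (b i) (b j)).PosDef ∧
      (Matrix.of fun i j => blN p r (b i) (b j)).det = (p : ℚ) ^ (m + 2) ∧
      (∃ C : Matrix (Fin (2 * m)) (Fin (2 * m)) ℚ,
        (Matrix.of fun i j => blN p r (b i) (b j)) * C = (p : ℚ) • 1 ∧
        (∀ i j, isInt (C i j)) ∧ ∀ i, ∃ z : ℤ, C i i = 2 * z)) ∧
    -- the minimal norm of N is 4 (p = 2,3,5) resp. 6 (p = 7)
    (∀ x : GVec p r, MemGlue p r x → x ≠ 0 →
      (if p = 7 then (6 : ℚ) else 4) ≤ nrmN p r x) ∧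
    (∃ x : GVec p r, MemGlue p r x ∧ nrmN p r x = (if p = 7 then (6 : ℚ) else 4)) ∧
    -- this is the largest possible minimal norm of a lattice in this genus ...
    (∀ B : Matrix (Fin (2 * m)) (Fin (2 * m)) ℤ, B.IsSymm → (∀ i, 2 ∣ B i i) →
      (B.map (Int.cast : ℤ → ℚ)).PosDef → B.det = (p : ℤ) ^ (m + 2) →
      (∃ C : Matrix (Fin (2 * m)) (Fin (2 * m)) ℤ,
        B * C = (p : ℤ) • 1 ∧ ∀ i, 2 ∣ C i i) →
      ∃ v : Fin (2 * m) → ℤ, v ≠ 0 ∧ v ⬝ᵥ B.mulVec v ≤ (if p = 7 then 6 else 4)) ∧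
    -- ... and N is the unique lattice in this genus attaining it, up to isomorphism
    (∀ B : Matrix (Fin (2 * m)) (Fin (2 * m)) ℤ, B.IsSymm → (∀ i, 2 ∣ B i i) →
      (B.map (Int.cast : ℤ → ℚ)).PosDef → B.det = (p : ℤ) ^ (m + 2) →
      (∃ C : Matrix (Fin (2 * m)) (Fin (2 * m)) ℤ,
        B * C = (p : ℤ) • 1 ∧ ∀ i, 2 ∣ C i i) →
      (∀ v : Fin (2 * m) → ℤ, v ≠ 0 →
        (if p = 7 then (6 : ℤ) else 4) ≤ v ⬝ᵥ B.mulVec v) →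
      ∃ b : Fin (2 * m) → GVec p r,
        (∀ i, MemGlue p r (b i)) ∧
        (∀ x, MemGlue p r x → ∃ c : Fin (2 * m) → ℤ, x = ∑ i, (c i : ℚ) • b i) ∧
        ∀ i j, blN p r (b i) (b j) = (B i j : ℚ)) := by
  rcases hp with rfl | rfl | rfl | rfl
  · obtain rfl : q = 1 := by omega
    obtain rfl : r = 16 := by omega
    obtain rfl : m = 8 := by omega
    exact glue_conclusion rfl (by norm_num) (by norm_num) (by norm_num) glueModel_binary
      fun B C H hmin => unique_binary H hmin
  · obtain rfl : q = 2 := by omega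
    obtain rfl : r = 6 := by omega
    obtain rfl : m = 6 := by omega
    exact glue_conclusion rfl (by norm_num) (by norm_num) (by norm_num) glueModel_ternary
      fun B C H hmin => unique_ternary H hmin
  · obtain rfl : q = 4 := by omega
    obtain rfl : r = 2 := by omega
    obtain rfl : m = 4 := by omega
    let e : Fin 2 × Fin 4 ≃ Fin (2 * 4) := finProdFinEquiv
    exact glue_conclusion rfl (s := 2) (by norm_num) (by norm_num) (by norm_num)
      (glueModel_of_ge (by norm_num) (by norm_num) e (by norm_num) (by norm_num) (by norm_num)
        minShell_blockNorm_four).1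
      fun B C H hmin => unique_of_ge (by norm_num) e (by norm_num) (by norm_num) (by norm_num)
        (by norm_num) minShell_blockNorm_four H hmin
        (fun a ha => Or.inr ⟨by norm_num, IsLevel.exists_zero_thG H ha⟩) (by norm_num)
  · obtain rfl : q = 6 := by omega
    obtain rfl : r = 1 := by omega
    obtain rfl : m = 3 := by omega
    let e : Fin 1 × Fin 6 ≃ Fin (2 * 3) := finProdFinEquiv
    exact glue_conclusion rfl (s := 3) (by norm_num) (by norm_num) (by norm_num)
      (glueModel_of_ge (by norm_num) (by norm_num) e (by norm_num) (by norm_num) (by norm_num)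
        minShell_blockNorm_six).1
      fun B C H hmin => unique_of_ge (by norm_num) e (by norm_num) (by norm_num) (by norm_num)
        (by norm_num) minShell_blockNorm_six H hmin (fun a ha => Or.inl (by norm_num)) (by norm_num)
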